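/- Let N ≥ 2, let a : ℝ^N × ℝ^N → ℂ be smooth and compactly supported, and let ψ : ℝ^N × ℝ^N → ℝ be smooth. Assume that for every (x,y) in the support of a the N × N matrix (∂²ψ/∂x_i∂y_j(x,y)) has rank N−1, and that for every (x₀,y₀) in the support of a and every unit vector e ∈ ℝ^N such that ∇_y (e·∇_x ψ)(x₀,y₀) = 0, the N × N matrix (∂²(e·∇_x ψ)/∂y_i∂y_j (x₀,y₀)) has rank N−1. Then there exists C > 0 such that for every λ ≥ 1, every finite orthonormal family (f_j)_{j∈J} in L²(ℝ^N), and every family of complex coefficients (ν_j)_{j∈J}, one has ‖∑_{j∈J} ν_j |T_λ f_j|²‖_{L^{(N+1)/(N−1)}(ℝ^N)} ≤ C λ^{−N(N−1)/(N+1)} (∑_{j∈J} |ν_j|^{(N+1)/N})^{N/(N+1)}. -/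

import Mathlib

open Real MeasureTheory

namespace OscInt

open scoped ContDiff

open Set Filter Topology

section Nonstationary

variable {P : Type*} [NormedAddCommGroup P] [NormedSpace ℝ P] {d : ℕ}

/-- Partial derivative in the `j`-th coordinate of the second variable. -/
noncomputable def pderivSnd {F : Type*} [NormedAddCommGroup F] [NormedSpace ℝ F]
    (g : P × (Fin d → ℝ) → F) (j : Fin d) (q : P × (Fin d → ℝ)) : F :=
  fderiv ℝ g q (0, Pi.single j 1)

theorem contDiff_pderivSnd {F : Type*} [NormedAddCommGroup F] [NormedSpace ℝ F]
    {g : P × (Fin d → ℝ) → F} (hg : ContDiff ℝ ∞ g) (j : Fin d) :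
    ContDiff ℝ ∞ (pderivSnd g j) :=
  (hg.fderiv_right (m := ∞) (by simp)).clm_apply contDiff_const

theorem tsupport_pderivSnd_subset {F : Type*} [NormedAddCommGroup F] [NormedSpace ℝ F]
    (g : P × (Fin d → ℝ) → F) (j : Fin d) : tsupport (pderivSnd g j) ⊆ tsupport g := by
  refine closure_minimal (fun x hx => ?_) (isClosed_tsupport g)
  by_contra hxg
  apply hx
  have : fderiv ℝ g x = 0 := by
    by_contra h
    exact hxg (support_fderiv_subset ℝ h)
  simp [pderivSnd, this]

theorem fderiv_slice {F : Type*} [NormedAddCommGroup F] [NormedSpace ℝ F]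
    {g : P × (Fin d → ℝ) → F} (hg : ContDiff ℝ ∞ g) (p : P) (y : Fin d → ℝ) (j : Fin d) :
    fderiv ℝ (fun y => g (p, y)) y (Pi.single j 1) = pderivSnd g j (p, y) := by
  have h1 : HasFDerivAt g (fderiv ℝ g (p, y)) (p, y) :=
    (hg.differentiable (by simp)).differentiableAt.hasFDerivAt
  have h2 : HasFDerivAt (fun y : Fin d → ℝ => (p, y))
      (ContinuousLinearMap.inr ℝ P (Fin d → ℝ)) y := hasFDerivAt_prodMk_right p y
  have := (h1.comp y h2).fderiv
  change fderiv ℝ (g ∘ fun y => (p, y)) y _ = _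
  rw [this]
  simp [pderivSnd]

theorem hasCompactSupport_slice {P F : Type*} [NormedAddCommGroup P] [NormedAddCommGroup F]
    {g : P × (Fin d → ℝ) → F} (hg : HasCompactSupport g) (p : P) :
    HasCompactSupport (fun y => g (p, y)) := by
  refine HasCompactSupport.of_support_subset_isCompact (hg.image continuous_snd) ?_
  intro y hy
  exact ⟨(p, y), subset_tsupport _ hy, rfl⟩

/-- The oscillatory integral with phase `Ψ` and amplitude `b` in the second variable. -/
noncomputable def oscIntegral (Ψ : P × (Fin d → ℝ) → ℝ) (b : P × (Fin d → ℝ) → ℂ) (p : P)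
    (μ : ℝ) : ℂ :=
  ∫ y, Complex.exp (Complex.I * (μ * Ψ (p, y) : ℝ)) * b (p, y)

theorem norm_exp_I_mul_ofReal' (t : ℝ) : ‖Complex.exp (Complex.I * (t : ℝ))‖ = 1 := by
  rw [mul_comm]; exact Complex.norm_exp_ofReal_mul_I t

theorem exists_oscIntegral_le {P : Type*} [NormedAddCommGroup P] (Ψ : P × (Fin d → ℝ) → ℝ)
    (b : P × (Fin d → ℝ) → ℂ)
    (hb : Continuous b) (hbs : HasCompactSupport b) :
    ∃ C : ℝ, 0 ≤ C ∧ ∀ p μ, ‖oscIntegral Ψ b p μ‖ ≤ C := by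
  obtain ⟨B, hB⟩ := hb.bounded_above_of_compact_support hbs
  set K := Prod.snd '' tsupport b with hK
  have hKc : IsCompact K := hbs.image continuous_snd
  refine ⟨max B 0 * volume.real K, by positivity, fun p μ => ?_⟩
  have hzero : ∀ y ∉ K,
      Complex.exp (Complex.I * (μ * Ψ (p, y) : ℝ)) * b (p, y) = 0 := by
    intro y hy
    have : b (p, y) = 0 := by
      by_contra h
      exact hy ⟨(p, y), subset_tsupport _ h, rfl⟩
    simp [this]
  have : oscIntegral Ψ b p μ =
      ∫ y in K, Complex.exp (Complex.I * (μ * Ψ (p, y) : ℝ)) * b (p, y) :=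
    (setIntegral_eq_integral_of_forall_compl_eq_zero hzero).symm
  rw [this]
  refine norm_setIntegral_le_of_norm_le_const hKc.measure_lt_top fun y _ => ?_
  rw [norm_mul, norm_exp_I_mul_ofReal', one_mul]
  exact (hB _).trans (le_max_left _ _)

theorem exists_nonstationary_step (Ψ : P × (Fin d → ℝ) → ℝ) (hΨ : ContDiff ℝ ∞ Ψ)
    (b : P × (Fin d → ℝ) → ℂ) (hb : ContDiff ℝ ∞ b) (hbs : HasCompactSupport b)
    (hgrad : ∀ q ∈ tsupport b, ∃ j, pderivSnd Ψ j q ≠ 0) :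
    ∃ b' : P × (Fin d → ℝ) → ℂ, ContDiff ℝ ∞ b' ∧ tsupport b' ⊆ tsupport b ∧
      ∀ p μ, (Complex.I * μ) * oscIntegral Ψ b p μ = - oscIntegral Ψ b' p μ := by
  set G : P × (Fin d → ℝ) → ℝ := fun q => ∑ j, (pderivSnd Ψ j q) ^ 2 with hG
  have hGs : ContDiff ℝ ∞ G := ContDiff.sum fun j _ => (contDiff_pderivSnd hΨ j).pow 2
  have hGne : ∀ q ∈ tsupport b, G q ≠ 0 := by
    intro q hq
    obtain ⟨j, hj⟩ := hgrad q hq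
    have : 0 < G q := Finset.sum_pos' (fun i _ => sq_nonneg _) ⟨j, Finset.mem_univ _, by positivity⟩
    exact this.ne'
  set c : Fin d → P × (Fin d → ℝ) → ℂ := fun j q => ((pderivSnd Ψ j q / G q : ℝ) : ℂ) * b q with hc
  have hcsupp : ∀ j, tsupport (c j) ⊆ tsupport b := fun j =>
    closure_mono (fun x hx hx' => hx (by simp [hc, hx']))
  have hcs : ∀ j, ContDiff ℝ ∞ (c j) := by
    intro j
    rw [contDiff_iff_contDiffAt]
    intro q
    by_cases hq : q ∈ tsupport b
    · refine ContDiffAt.mul ?_ hb.contDiffAt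
      exact Complex.ofRealCLM.contDiff.contDiffAt.comp q
        (((contDiff_pderivSnd hΨ j).contDiffAt).div hGs.contDiffAt (hGne q hq))
    · have : c j =ᶠ[𝓝 q] fun _ => 0 := by
        filter_upwards [(isClosed_tsupport b).isOpen_compl.mem_nhds hq] with x hx
        simp [hc, image_eq_zero_of_notMem_tsupport hx]
      exact contDiffAt_const.congr_of_eventuallyEq this
  have hcc : ∀ j, HasCompactSupport (c j) := fun j =>
    hbs.of_isClosed_subset (isClosed_tsupport _) (hcsupp j)
  refine ⟨fun q => ∑ j, pderivSnd (c j) j q, ContDiff.sum fun j _ => contDiff_pderivSnd (hcs j) j,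
    ?_, fun p μ => ?_⟩
  · refine closure_minimal (fun x hx => ?_) (isClosed_tsupport b)
    by_contra hxb
    apply hx
    refine Finset.sum_eq_zero fun j _ => ?_
    by_contra h
    exact hxb (hcsupp j (tsupport_pderivSnd_subset _ _ (subset_tsupport _ h)))
  set ex : (Fin d → ℝ) → ℂ := fun y => Complex.exp (Complex.I * (μ * Ψ (p, y) : ℝ)) with hex
  have hsl : ContDiff ℝ ∞ fun y : Fin d → ℝ => Ψ (p, y) := hΨ.comp (contDiff_prodMk_right p)
  have hexs : ContDiff ℝ ∞ ex := by
    refine ContDiff.cexp (contDiff_const.mul ?_)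
    exact Complex.ofRealCLM.contDiff.comp (contDiff_const.mul hsl)
  have hexd : ∀ j y, fderiv ℝ ex y (Pi.single j 1) =
      (Complex.I * μ) * (pderivSnd Ψ j (p, y) : ℝ) * ex y := by
    intro j y
    have h1 : HasFDerivAt (fun y => Ψ (p, y)) (fderiv ℝ (fun y => Ψ (p, y)) y) y :=
      (hsl.differentiable (by simp)).differentiableAt.hasFDerivAt
    have h2 : HasFDerivAt (fun y => ((μ * Ψ (p, y) : ℝ) : ℂ))
        (Complex.ofRealCLM.comp (μ • fderiv ℝ (fun y => Ψ (p, y)) y)) y :=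
      Complex.ofRealCLM.hasFDerivAt.comp y (h1.const_mul μ)
    have h3 := (h2.const_mul Complex.I).cexp
    rw [h3.fderiv]
    simp [fderiv_slice hΨ, hex]
    ring
  have hInt : ∀ (g : P × (Fin d → ℝ) → ℂ) (h : (Fin d → ℝ) → ℂ), Continuous g →
      HasCompactSupport g → Continuous h →
      Integrable (fun y => h y * g (p, y)) := by
    intro g h hg hgs hh
    refine Continuous.integrable_of_hasCompactSupport (by fun_prop) ?_
    exact (hasCompactSupport_slice hgs p).mul_left
  have key : ∀ j, ∫ y, fderiv ℝ ex y (Pi.single j 1) * c j (p, y) =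
      - ∫ y, ex y * pderivSnd (c j) j (p, y) := by
    intro j
    have hd : ∀ y, fderiv ℝ (fun y => c j (p, y)) y (Pi.single j 1) = pderivSnd (c j) j (p, y) :=
      fun y => fderiv_slice (hcs j) p y j
    have hexc : Continuous fun y => fderiv ℝ ex y (Pi.single j 1) :=
      ((hexs.fderiv_right (m := ∞) (by simp)).clm_apply contDiff_const).continuous
    have := integral_mul_fderiv_eq_neg_fderiv_mul_of_integrable (μ := volume) (f := ex)
      (g := fun y => c j (p, y)) (v := Pi.single j 1)
      (hInt _ _ (hcs j).continuous (hcc j) hexc)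
      (by simp_rw [hd]
          exact hInt _ _ (contDiff_pderivSnd (hcs j) j).continuous
            ((hcc j).of_isClosed_subset (isClosed_tsupport _) (tsupport_pderivSnd_subset _ _))
            hexs.continuous)
      (hInt _ _ (hcs j).continuous (hcc j) hexs.continuous)
      (fun x _ => (hexs.differentiable (by simp)).differentiableAt)
      (fun x _ => (((hcs j).comp (contDiff_prodMk_right p)).differentiable
        (by simp)).differentiableAt)
    simp_rw [hd] at this
    rw [this, neg_neg]
  have hI1 : ∀ j ∈ Finset.univ,
      Integrable (fun y => fderiv ℝ ex y (Pi.single j 1) * c j (p, y)) := by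
    intro j _
    have hexc : Continuous fun y => fderiv ℝ ex y (Pi.single j 1) :=
      ((hexs.fderiv_right (m := ∞) (by simp)).clm_apply contDiff_const).continuous
    exact hInt _ _ (hcs j).continuous (hcc j) hexc
  have hI2 : ∀ j ∈ Finset.univ, Integrable (fun y => ex y * pderivSnd (c j) j (p, y)) := fun j _ =>
    hInt _ _ (contDiff_pderivSnd (hcs j) j).continuous
      ((hcc j).of_isClosed_subset (isClosed_tsupport _) (tsupport_pderivSnd_subset _ _))
      hexs.continuous
  calc (Complex.I * μ) * oscIntegral Ψ b p μ
      = ∫ y, ∑ j, fderiv ℝ ex y (Pi.single j 1) * c j (p, y) := by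
        rw [oscIntegral, ← integral_const_mul]
        congr 1
        ext y
        simp only [hexd, hc]
        by_cases hq : (p, y) ∈ tsupport b
        · have hne := hGne _ hq
          have : ∑ j, (pderivSnd Ψ j (p, y)) * (pderivSnd Ψ j (p, y) / G (p, y)) = 1 := by
            rw [← div_self hne]
            conv_rhs => rw [hG]
            rw [Finset.sum_div]
            exact Finset.sum_congr rfl fun j _ => by ring
          have h2 : ∑ j, ((pderivSnd Ψ j (p, y) : ℝ) : ℂ) *
              ((pderivSnd Ψ j (p, y) / G (p, y) : ℝ) : ℂ) = 1 := by
            exact_mod_cast this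
          calc _ = (Complex.I * μ) * ex y * b (p, y) * 1 := by simp only [hex]; ring
            _ = _ := by
              rw [← h2, Finset.mul_sum]
              exact Finset.sum_congr rfl fun j _ => by ring
        · simp [image_eq_zero_of_notMem_tsupport hq]
    _ = ∑ j, ∫ y, fderiv ℝ ex y (Pi.single j 1) * c j (p, y) := integral_finsetSum _ hI1
    _ = - ∑ j, ∫ y, ex y * pderivSnd (c j) j (p, y) := by
        simp_rw [key, Finset.sum_neg_distrib]
    _ = _ := by
        rw [← integral_finsetSum _ hI2, oscIntegral]
        simp_rw [Finset.mul_sum, hex]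

theorem exists_pow_mul_oscIntegral_le (Ψ : P × (Fin d → ℝ) → ℝ) (hΨ : ContDiff ℝ ∞ Ψ)
    (M : ℕ) (b : P × (Fin d → ℝ) → ℂ) (hb : ContDiff ℝ ∞ b) (hbs : HasCompactSupport b)
    (hgrad : ∀ q ∈ tsupport b, ∃ j, pderivSnd Ψ j q ≠ 0) :
    ∃ C : ℝ, 0 ≤ C ∧ ∀ p, ∀ μ : ℝ, 0 ≤ μ → μ ^ M * ‖oscIntegral Ψ b p μ‖ ≤ C := by
  induction M generalizing b with
  | zero =>
    obtain ⟨C, hC, h⟩ := exists_oscIntegral_le Ψ b hb.continuous hbs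
    exact ⟨C, hC, fun p μ _ => by simpa using h p μ⟩
  | succ M ih =>
    obtain ⟨b', hb', hsub, hstep⟩ := exists_nonstationary_step Ψ hΨ b hb hbs hgrad
    obtain ⟨C, hC, h⟩ := ih b' hb' (hbs.of_isClosed_subset (isClosed_tsupport _) hsub)
      (fun q hq => hgrad q (hsub hq))
    refine ⟨C, hC, fun p μ hμ => ?_⟩
    have h1 : μ * ‖oscIntegral Ψ b p μ‖ = ‖oscIntegral Ψ b' p μ‖ := by
      have := congrArg norm (hstep p μ)
      simpa [abs_of_nonneg hμ] using this
    calc _ = μ ^ M * (μ * ‖oscIntegral Ψ b p μ‖) := by ring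
      _ ≤ C := by rw [h1]; exact h p μ hμ

/-- Non-stationary phase, uniformly in parameters. -/
theorem nonstationary_phase (Ψ : P × (Fin d → ℝ) → ℝ) (hΨ : ContDiff ℝ ∞ Ψ)
    (m : ℝ) (b : P × (Fin d → ℝ) → ℂ) (hb : ContDiff ℝ ∞ b) (hbs : HasCompactSupport b)
    (hgrad : ∀ q ∈ tsupport b, ∃ j, pderivSnd Ψ j q ≠ 0) :
    ∃ C : ℝ, 0 ≤ C ∧ ∀ p, ∀ μ : ℝ, 0 ≤ μ → ‖oscIntegral Ψ b p μ‖ ≤ C * (1 + μ) ^ (-m) := by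
  obtain ⟨M, hM⟩ := exists_nat_ge m
  obtain ⟨C0, hC0, h0⟩ := exists_oscIntegral_le Ψ b hb.continuous hbs
  obtain ⟨C1, hC1, h1⟩ := exists_pow_mul_oscIntegral_le Ψ hΨ M b hb hbs hgrad
  refine ⟨2 ^ (M - 1) * (C0 + C1), by positivity, fun p μ hμ => ?_⟩
  have h2 : (1 + μ) ^ M * ‖oscIntegral Ψ b p μ‖ ≤ 2 ^ (M - 1) * (C0 + C1) := by
    calc _ ≤ (2 ^ (M - 1) * (1 ^ M + μ ^ M)) * ‖oscIntegral Ψ b p μ‖ := by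
          gcongr
          exact add_pow_le zero_le_one hμ M
      _ = 2 ^ (M - 1) * (‖oscIntegral Ψ b p μ‖ + μ ^ M * ‖oscIntegral Ψ b p μ‖) := by ring
      _ ≤ _ := by gcongr; exacts [h0 p μ, h1 p μ hμ]
  have hpos : (0 : ℝ) < 1 + μ := by linarith
  calc ‖oscIntegral Ψ b p μ‖ = ((1 + μ) ^ M * ‖oscIntegral Ψ b p μ‖) * (1 + μ) ^ (-(M : ℝ)) := by
        rw [Real.rpow_neg hpos.le, Real.rpow_natCast]; field_simp
    _ ≤ (2 ^ (M - 1) * (C0 + C1)) * (1 + μ) ^ (-m) := by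
        gcongr
        linarith

end Nonstationary

section Hadamard

variable {P V W : Type*} [NormedAddCommGroup P] [NormedSpace ℝ P]
  [NormedAddCommGroup V] [NormedSpace ℝ V] [NormedAddCommGroup W] [NormedSpace ℝ W]

theorem contDiff_integral_unit {g : P × ℝ → ℝ} (hg : ContDiff ℝ ∞ g) :
    ContDiff ℝ ∞ fun p => ∫ u in (0 : ℝ)..1, g (p, u) := by
  let χ : ContDiffBump (0 : ℝ) := ⟨2, 3, by norm_num, by norm_num⟩
  let G : P → ℝ → ℝ := fun p s => χ s * g (p, -s)
  let f : ℝ → ℝ := indicator (Ioc 0 1) 1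
  have hf : LocallyIntegrable f volume := by
    refine Integrable.locallyIntegrable ?_
    exact (integrable_indicator_iff measurableSet_Ioc).2
      (integrableOn_const (by simp) (by simp))
  have hG : ContDiffOn ℝ ∞ (Function.uncurry G) (univ ×ˢ univ) := by
    refine ContDiff.contDiffOn ?_
    refine ContDiff.mul (χ.contDiff.comp contDiff_snd) ?_
    exact hg.comp (contDiff_fst.prodMk contDiff_snd.neg)
  have h := contDiffOn_convolution_right_with_param_comp (μ := volume)
    (ContinuousLinearMap.mul ℝ ℝ) (v := fun _ : P => (0 : ℝ)) (contDiffOn_const) (f := f) (g := G)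
    (s := univ) (k := tsupport χ) isOpen_univ χ.hasCompactSupport
    (fun p x _ hx => by simp [G, image_eq_zero_of_notMem_tsupport hx]) hf hG
  rw [contDiffOn_univ] at h
  convert h using 1
  ext p
  rw [convolution_def, intervalIntegral.integral_of_le zero_le_one,
    ← integral_indicator measurableSet_Ioc]
  congr 1
  ext t
  by_cases ht : t ∈ Ioc (0 : ℝ) 1
  · have : χ (0 - t) = 1 := by
      apply χ.one_of_mem_closedBall
      simp only [mem_closedBall_zero_iff, zero_sub, norm_neg, Real.norm_eq_abs]
      rw [abs_of_pos ht.1]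
      change t ≤ 2
      linarith [ht.2]
    simp [f, ht, G]
    simp at this
    simp [this]
  · simp [f, ht]

/-- The smooth difference quotient of `F` in its first variable,
`(F (x + r θ, w) - F (x, w)) / r`, extended smoothly across `r = 0`. -/
noncomputable def diffQuot (F : V × W → ℝ) (x : V) (r : ℝ) (θ : V) (w : W) : ℝ :=
  ∫ u in (0 : ℝ)..1, fderiv ℝ F (x + (u * r) • θ, w) (θ, 0)

theorem contDiff_diffQuot {F : V × W → ℝ} (hF : ContDiff ℝ ∞ F) :
    ContDiff ℝ ∞ fun q : V × ℝ × V × W => diffQuot F q.1 q.2.1 q.2.2.1 q.2.2.2 := by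
  refine contDiff_integral_unit
    (g := fun z : (V × ℝ × V × W) × ℝ =>
      fderiv ℝ F (z.1.1 + (z.2 * z.1.2.1) • z.1.2.2.1, z.1.2.2.2) (z.1.2.2.1, 0)) ?_
  refine ContDiff.clm_apply ((hF.fderiv_right (m := ∞) (by simp)).comp ?_) ?_ <;> fun_prop

theorem mul_diffQuot {F : V × W → ℝ} (hF : ContDiff ℝ ∞ F) (x : V) (r : ℝ) (θ : V) (w : W) :
    r * diffQuot F x r θ w = F (x + r • θ, w) - F (x, w) := by
  have hd : ∀ u ∈ uIcc (0 : ℝ) 1, HasDerivAt (fun u : ℝ => F (x + (u * r) • θ, w))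
      (r * fderiv ℝ F (x + (u * r) • θ, w) (θ, 0)) u := by
    intro u _
    have h1 : HasFDerivAt F (fderiv ℝ F (x + (u * r) • θ, w)) (x + (u * r) • θ, w) :=
      (hF.differentiable (by simp)).differentiableAt.hasFDerivAt
    have h2 : HasDerivAt (fun u : ℝ => (x + (u * r) • θ, w)) ((r • θ, 0) : V × W) u := by
      refine HasDerivAt.prodMk ?_ (hasDerivAt_const u w)
      have := (((hasDerivAt_id u).mul_const r).smul_const θ).const_add x
      simpa using this
    have h3 := h1.comp_hasDerivAt u h2
    have h4 : ((r • θ, 0) : V × W) = r • (θ, 0) := by simp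
    rw [h4, map_smul, smul_eq_mul] at h3
    exact h3
  have hc : Continuous fun u : ℝ => r * fderiv ℝ F (x + (u * r) • θ, w) (θ, 0) := by
    refine continuous_const.mul ?_
    have : Continuous (fderiv ℝ F) := (hF.fderiv_right (m := ∞) (by simp)).continuous
    fun_prop
  have := intervalIntegral.integral_eq_sub_of_hasDerivAt hd (hc.intervalIntegrable 0 1)
  rw [diffQuot, ← intervalIntegral.integral_const_mul, this]
  simp

theorem diffQuot_zero (F : V × W → ℝ) (x : V) (θ : V) (w : W) :
    diffQuot F x 0 θ w = fderiv ℝ F (x, w) (θ, 0) := by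
  simp [diffQuot]

end Hadamard

section Cutoff

variable {Z : Type*} [NormedAddCommGroup Z] [NormedSpace ℝ Z] [FiniteDimensional ℝ Z]

/-- Smooth compactly supported cutoff equal to one near a compact set. -/
theorem exists_cutoff {K U : Set Z} (hK : IsCompact K) (hU : IsOpen U) (hKU : K ⊆ U) :
    ∃ χ : Z → ℝ, ContDiff ℝ ∞ χ ∧ HasCompactSupport χ ∧ tsupport χ ⊆ U ∧
      ∃ O, IsOpen O ∧ K ⊆ O ∧ ∀ z ∈ O, χ z = 1 := by
  obtain ⟨δ, hδ, hδU⟩ := hK.exists_cthickening_subset_open hU hKU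
  have h1 : Metric.cthickening (δ / 4) K ⊆ Metric.thickening (δ / 2) K :=
    Metric.cthickening_subset_thickening' (by linarith) (by linarith) K
  obtain ⟨χ, hχ, -, hsupp, hone⟩ := exists_contMDiff_support_eq_eq_one_iff (n := (⊤ : ℕ∞))
    (modelWithCornersSelf ℝ Z) Metric.isOpen_thickening Metric.isClosed_cthickening h1
  have hts : tsupport χ ⊆ Metric.cthickening (δ / 2) K := by
    rw [tsupport, hsupp]
    exact Metric.closure_thickening_subset_cthickening _ _
  refine ⟨χ, hχ.contDiff, ?_, hts.trans ((Metric.cthickening_mono (by linarith) K).trans hδU),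
    Metric.thickening (δ / 4) K, Metric.isOpen_thickening,
    Metric.self_subset_thickening (by linarith) K, fun z hz => ?_⟩
  · exact hK.cthickening.of_isClosed_subset (isClosed_tsupport _) hts
  · exact (hone z).1 (Metric.thickening_subset_cthickening _ _ hz)

/-- An additive property of smooth compactly supported functions that holds locally on the support
of `b` holds for `b`. -/
theorem localization {Q : (Z → ℂ) → Prop} (hzero : Q 0)
    (hadd : ∀ f g : Z → ℂ, ContDiff ℝ ∞ f → ContDiff ℝ ∞ g →
      HasCompactSupport f → HasCompactSupport g → Q f → Q g → Q (f + g))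
    {b : Z → ℂ} (hb : ContDiff ℝ ∞ b) (hbs : HasCompactSupport b)
    (hloc : ∀ z ∈ tsupport b, ∃ δ > 0, ∀ f : Z → ℂ, ContDiff ℝ ∞ f → HasCompactSupport f →
      tsupport f ⊆ Metric.ball z δ → Q f) : Q b := by
  have main : ∃ χ : Z → ℝ, ContDiff ℝ ∞ χ ∧ (∀ z ∈ tsupport b, χ z = 1) ∧
      ∀ η : Z → ℝ, ContDiff ℝ ∞ η → Q (fun z => ((η z * χ z : ℝ) : ℂ) * b z) := by
    refine hbs.induction_on (p := fun s => ∃ χ : Z → ℝ, ContDiff ℝ ∞ χ ∧ (∀ z ∈ s, χ z = 1) ∧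
      ∀ η : Z → ℝ, ContDiff ℝ ∞ η → Q (fun z => ((η z * χ z : ℝ) : ℂ) * b z)) ?_ ?_ ?_ ?_
    · refine ⟨fun _ => 0, contDiff_const, by simp, fun η _ => ?_⟩
      convert hzero using 1
      ext z
      simp
    · rintro s t hst ⟨χ, h1, h2, h3⟩
      exact ⟨χ, h1, fun z hz => h2 z (hst hz), h3⟩
    · rintro s t ⟨χ, h1, h2, h3⟩ ⟨χ', h1', h2', h3'⟩
      refine ⟨fun z => χ z + (1 - χ z) * χ' z, h1.add ((contDiff_const.sub h1).mul h1'), ?_, ?_⟩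
      · rintro z (hz | hz)
        · simp [h2 z hz]
        · simp [h2' z hz]
      · intro η hη
        have hη' : ContDiff ℝ ∞ fun z => η z * (1 - χ z) := hη.mul (contDiff_const.sub h1)
        have hcd : ∀ g : Z → ℝ, ContDiff ℝ ∞ g → ContDiff ℝ ∞ fun z => ((g z : ℝ) : ℂ) * b z :=
          fun g hg => (Complex.ofRealCLM.contDiff.comp hg).mul hb
        have := hadd _ _ (hcd _ (hη.mul h1)) (hcd _ (hη'.mul h1')) hbs.mul_left hbs.mul_left
          (h3 η hη) (h3' _ hη')
        convert this using 1
        ext z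
        simp only [Pi.add_apply]
        push_cast
        ring
    · intro z hz
      obtain ⟨δ, hδ, hQ⟩ := hloc z hz
      obtain ⟨χ, hχ, -, hχs, O, hO, hzO, hone⟩ := exists_cutoff (isCompact_singleton (x := z))
        (Metric.isOpen_ball (x := z) (ε := δ)) (by simpa using hδ)
      refine ⟨O, mem_nhdsWithin_of_mem_nhds (hO.mem_nhds (hzO rfl)), χ, hχ, hone, fun η hη => ?_⟩
      refine hQ _ ((Complex.ofRealCLM.contDiff.comp (hη.mul hχ)).mul hb) hbs.mul_left ?_
      refine Subset.trans (closure_mono fun x hx => ?_) hχs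
      by_contra h
      exact hx (by simp [Function.notMem_support.1 h])
  obtain ⟨χ, -, h1, h2⟩ := main
  have := h2 (fun _ => 1) contDiff_const
  convert this using 1
  ext z
  by_cases hz : z ∈ tsupport b
  · simp [h1 z hz]
  · simp [image_eq_zero_of_notMem_tsupport hz]

end Cutoff

section Decay

variable {P : Type*} [NormedAddCommGroup P] [NormedSpace ℝ P] {d : ℕ}

/-- The oscillatory integral with amplitude `b` decays like `(1 + μ) ^ (-m)`, uniformly in the
parameter. -/
def Decays (Ψ : P × (Fin d → ℝ) → ℝ) (m : ℝ) (b : P × (Fin d → ℝ) → ℂ) : Prop :=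
  ∃ C, 0 ≤ C ∧ ∀ p μ, 0 ≤ μ → ‖oscIntegral Ψ b p μ‖ ≤ C * (1 + μ) ^ (-m)

/-- Decay of order `m` for all amplitudes supported sufficiently close to `q`. -/
def DecaysAt (Ψ : P × (Fin d → ℝ) → ℝ) (m : ℝ) (q : P × (Fin d → ℝ)) : Prop :=
  ∃ δ > 0, ∀ b : P × (Fin d → ℝ) → ℂ, ContDiff ℝ ∞ b → HasCompactSupport b →
    tsupport b ⊆ Metric.ball q δ → Decays Ψ m b

theorem isOpen_setOf_decaysAt (Ψ : P × (Fin d → ℝ) → ℝ) (m : ℝ) :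
    IsOpen {q | DecaysAt Ψ m q} := by
  rw [Metric.isOpen_iff]
  rintro q ⟨δ, hδ, h⟩
  refine ⟨δ / 2, by linarith, fun z hz => ⟨δ / 2, by linarith, fun b hb hbs hbt => h b hb hbs ?_⟩⟩
  refine hbt.trans (Metric.ball_subset_ball' ?_)
  have := Metric.mem_ball.1 hz
  linarith

theorem integrable_oscIntegrand {P : Type*} [NormedAddCommGroup P]
    {Ψ : P × (Fin d → ℝ) → ℝ} (hΨ : Continuous Ψ)
    {b : P × (Fin d → ℝ) → ℂ} (hb : Continuous b) (hbs : HasCompactSupport b) (p : P) (μ : ℝ) :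
    Integrable fun y => Complex.exp (Complex.I * (μ * Ψ (p, y) : ℝ)) * b (p, y) := by
  refine Continuous.integrable_of_hasCompactSupport (by fun_prop) ?_
  exact (hasCompactSupport_slice hbs p).mul_left

theorem decays_of_tsupport_subset [FiniteDimensional ℝ P] {Ψ : P × (Fin d → ℝ) → ℝ}
    (hΨ : Continuous Ψ) {m : ℝ} {b : P × (Fin d → ℝ) → ℂ} (hb : ContDiff ℝ ∞ b)
    (hbs : HasCompactSupport b) (h : tsupport b ⊆ {q | DecaysAt Ψ m q}) : Decays Ψ m b := by
  refine localization (Q := Decays Ψ m) ?_ ?_ hb hbs fun z hz => h hz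
  · exact ⟨0, le_rfl, fun p μ _ => by simp [oscIntegral]⟩
  · rintro f g hf hg hfs hgs ⟨C, hC, h1⟩ ⟨C', hC', h2⟩
    refine ⟨C + C', by positivity, fun p μ hμ => ?_⟩
    have : oscIntegral Ψ (f + g) p μ = oscIntegral Ψ f p μ + oscIntegral Ψ g p μ := by
      unfold oscIntegral
      rw [← integral_add (integrable_oscIntegrand hΨ hf.continuous hfs p μ)
        (integrable_oscIntegrand hΨ hg.continuous hgs p μ)]
      simp [mul_add]
    rw [this, add_mul]
    exact (norm_add_le _ _).trans (add_le_add (h1 p μ hμ) (h2 p μ hμ))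

theorem isOpen_setOf_pderivSnd_ne {Ψ : P × (Fin d → ℝ) → ℝ} (hΨ : ContDiff ℝ ∞ Ψ) :
    IsOpen {q | ∃ j, pderivSnd Ψ j q ≠ 0} := by
  simp only [ofPred_exists]
  exact isOpen_iUnion fun j => isOpen_ne_fun (contDiff_pderivSnd hΨ j).continuous continuous_const

theorem decaysAt_of_pderivSnd_ne {Ψ : P × (Fin d → ℝ) → ℝ} (hΨ : ContDiff ℝ ∞ Ψ) (m : ℝ)
    {q : P × (Fin d → ℝ)} (h : ∃ j, pderivSnd Ψ j q ≠ 0) : DecaysAt Ψ m q := by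
  obtain ⟨δ, hδ, hsub⟩ := Metric.isOpen_iff.1 (isOpen_setOf_pderivSnd_ne hΨ) q h
  exact ⟨δ, hδ, fun b hb hbs hbt => nonstationary_phase Ψ hΨ m b hb hbs fun z hz => hsub (hbt hz)⟩

theorem norm_sq_oscIntegral_eq {P : Type*} [NormedAddCommGroup P]
    {Ψ : P × (Fin d → ℝ) → ℝ} (hΨ : Continuous Ψ)
    {b : P × (Fin d → ℝ) → ℂ} (hb : Continuous b) (hbs : HasCompactSupport b) (p : P) (μ : ℝ) :
    ((‖oscIntegral Ψ b p μ‖ ^ 2 : ℝ) : ℂ) = ∫ h, ∫ y,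
      Complex.exp (Complex.I * (μ * (Ψ (p, y + h) - Ψ (p, y)) : ℝ)) *
        (b (p, y + h) * (starRingEnd ℂ) (b (p, y))) := by
  set g : (Fin d → ℝ) → ℂ := fun y => Complex.exp (Complex.I * (μ * Ψ (p, y) : ℝ)) * b (p, y)
    with hg
  have hgc : Continuous g := by fun_prop
  have hgs : HasCompactSupport g := (hasCompactSupport_slice hbs p).mul_left
  have h1 : ∀ y h, Complex.exp (Complex.I * (μ * (Ψ (p, y + h) - Ψ (p, y)) : ℝ)) *
        (b (p, y + h) * (starRingEnd ℂ) (b (p, y))) = (starRingEnd ℂ) (g y) * g (y + h) := by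
    intro y h
    simp only [hg, map_mul, ← Complex.exp_conj, Complex.conj_I, Complex.conj_ofReal]
    have : Complex.exp (Complex.I * (μ * (Ψ (p, y + h) - Ψ (p, y)) : ℝ)) =
        Complex.exp (-Complex.I * (μ * Ψ (p, y) : ℝ)) *
          Complex.exp (Complex.I * (μ * Ψ (p, y + h) : ℝ)) := by
      rw [← Complex.exp_add]
      congr 1
      push_cast
      ring
    rw [this]
    ring
  simp_rw [h1]
  rw [integral_integral_swap]
  · simp_rw [integral_const_mul, integral_add_left_eq_self (μ := volume) g]
    rw [integral_mul_const, integral_conj, ← Complex.normSq_eq_conj_mul_self,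
      Complex.normSq_eq_norm_sq]
    rfl
  · have hgi : Integrable g := hgc.integrable_of_hasCompactSupport hgs
    have hgi' : Integrable fun y => (starRingEnd ℂ) (g y) :=
      (Complex.continuous_conj.comp hgc).integrable_of_hasCompactSupport
        (hgs.comp_left (map_zero _))
    have h2 := (hgi'.mul_prod hgi)
    have h3 := (measurePreserving_prod_add (volume : Measure (Fin d → ℝ)) volume)
    have h4 := h3.integrable_comp_of_integrable h2
    exact h4.swap

end Decay

section Morse

variable {P : Type*} [NormedAddCommGroup P] [NormedSpace ℝ P] {d : ℕ}

theorem integral_one_add_mul_norm_rpow {d : ℕ} {μ : ℝ} (hμ : 0 < μ) :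
    ∫ h : Fin d → ℝ, (1 + μ * ‖h‖) ^ (-((d : ℝ) + 1)) =
      μ ^ (-(d : ℝ)) * ∫ h : Fin d → ℝ, (1 + ‖h‖) ^ (-((d : ℝ) + 1)) := by
  have := Measure.integral_comp_smul (volume : Measure (Fin d → ℝ))
    (fun h => (1 + ‖h‖) ^ (-((d : ℝ) + 1))) μ
  simp only [norm_smul, Real.norm_eq_abs, abs_of_pos hμ, Module.finrank_fintype_fun_eq_card,
    Fintype.card_fin, smul_eq_mul, abs_inv, abs_pow] at this
  rw [this, Real.rpow_neg hμ.le, Real.rpow_natCast]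

theorem integrable_one_add_mul_norm_rpow {d : ℕ} {μ : ℝ} (hμ : 0 < μ) :
    Integrable fun h : Fin d → ℝ => (1 + μ * ‖h‖) ^ (-((d : ℝ) + 1)) := by
  have h1 : Integrable fun h : Fin d → ℝ => (1 + ‖h‖) ^ (-((d : ℝ) + 1)) := by
    refine integrable_one_add_norm ?_
    simp
  have := h1.comp_smul hμ.ne'
  simpa [norm_smul, abs_of_pos hμ] using this

/-- The phase `(Ψ (p, y + ρ v) - Ψ (p, y)) / ρ` with parameters `(p, v, ρ)`. -/
noncomputable def diffPhase (Ψ : P × (Fin d → ℝ) → ℝ)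
    (z : (P × (Fin d → ℝ) × ℝ) × (Fin d → ℝ)) : ℝ :=
  diffQuot (fun w : (Fin d → ℝ) × P => Ψ (w.2, w.1)) z.2 z.1.2.2 z.1.2.1 z.1.1

theorem contDiff_diffPhase {Ψ : P × (Fin d → ℝ) → ℝ} (hΨ : ContDiff ℝ ∞ Ψ) :
    ContDiff ℝ ∞ (diffPhase Ψ) := by
  have h1 : ContDiff ℝ ∞ (fun w : (Fin d → ℝ) × P => Ψ (w.2, w.1)) :=
    hΨ.comp (contDiff_snd.prodMk contDiff_fst)
  exact (contDiff_diffQuot h1).comp (f := fun z : (P × (Fin d → ℝ) × ℝ) × (Fin d → ℝ) =>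
    (z.2, z.1.2.2, z.1.2.1, z.1.1)) (by fun_prop)

theorem mul_diffPhase {Ψ : P × (Fin d → ℝ) → ℝ} (hΨ : ContDiff ℝ ∞ Ψ) (p : P) (v : Fin d → ℝ)
    (ρ : ℝ) (y : Fin d → ℝ) :
    ρ * diffPhase Ψ ((p, v, ρ), y) = Ψ (p, y + ρ • v) - Ψ (p, y) := by
  have h1 : ContDiff ℝ ∞ (fun w : (Fin d → ℝ) × P => Ψ (w.2, w.1)) :=
    hΨ.comp (contDiff_snd.prodMk contDiff_fst)
  exact mul_diffQuot h1 y ρ v p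

theorem diffPhase_zero {Ψ : P × (Fin d → ℝ) → ℝ} (hΨ : ContDiff ℝ ∞ Ψ) (p : P) (v : Fin d → ℝ)
    (y : Fin d → ℝ) : diffPhase Ψ ((p, v, 0), y) = fderiv ℝ Ψ (p, y) (0, v) := by
  rw [diffPhase, diffQuot_zero]
  have h1 : HasFDerivAt Ψ (fderiv ℝ Ψ (p, y)) (p, y) :=
    (hΨ.differentiable (by simp)).differentiableAt.hasFDerivAt
  have h2 : HasFDerivAt (fun w : (Fin d → ℝ) × P => (w.2, w.1))
      ((ContinuousLinearMap.snd ℝ (Fin d → ℝ) P).prod (ContinuousLinearMap.fst ℝ (Fin d → ℝ) P))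
      (y, p) := hasFDerivAt_snd.prodMk hasFDerivAt_fst
  have h3 := (HasFDerivAt.comp (y, p) (f := fun w : (Fin d → ℝ) × P => (w.2, w.1)) h1 h2).fderiv
  change fderiv ℝ (Ψ ∘ fun w : (Fin d → ℝ) × P => (w.2, w.1)) (y, p) _ = _
  rw [h3]
  simp

variable [FiniteDimensional ℝ P]

theorem decaysAt_of_hessian_nondegenerate {Ψ : P × (Fin d → ℝ) → ℝ} (hΨ : ContDiff ℝ ∞ Ψ)
    (hd : 0 < d)
    {p₀ : P} {y₀ : Fin d → ℝ}
    (h : ∀ v : Fin d → ℝ, v ≠ 0 →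
      ∃ j, pderivSnd (fun q => fderiv ℝ Ψ q (0, v)) j (p₀, y₀) ≠ 0) :
    DecaysAt Ψ ((d : ℝ) / 2) (p₀, y₀) := by
  set Φ := diffPhase Ψ with hΦdef
  have hΦ : ContDiff ℝ ∞ Φ := contDiff_diffPhase hΨ
  let K : Set ((P × (Fin d → ℝ) × ℝ) × (Fin d → ℝ)) :=
    (fun v : Fin d → ℝ => ((p₀, v, (0 : ℝ)), y₀)) '' Metric.sphere 0 1
  have hK : IsCompact K := (isCompact_sphere _ _).image (by fun_prop)
  have hKU : K ⊆ {q | ∃ j, pderivSnd Φ j q ≠ 0} := by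
    rintro _ ⟨v, hv, rfl⟩
    have hv0 : v ≠ 0 := by
      rintro rfl
      simp at hv
    obtain ⟨j, hj⟩ := h v hv0
    refine ⟨j, ?_⟩
    rw [← fderiv_slice hΦ]
    have : (fun y => Φ ((p₀, v, 0), y)) = fun y => fderiv ℝ Ψ (p₀, y) (0, v) := by
      ext y
      exact diffPhase_zero hΨ _ _ _
    rw [this, fderiv_slice (g := fun q => fderiv ℝ Ψ q (0, v))
      ((hΨ.fderiv_right (m := ∞) (by simp)).clm_apply contDiff_const)]
    exact hj
  obtain ⟨χ, hχ, hχs, hχU, O, hO, hKO, hone⟩ :=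
    exists_cutoff hK (isOpen_setOf_pderivSnd_ne hΦ) hKU
  obtain ⟨ε, hε, hεO⟩ := hK.exists_thickening_subset_open hO hKO
  refine ⟨ε / 2, by linarith, fun b hb hbs hbt => ?_⟩
  have hbd : ∀ p y, b (p, y) ≠ 0 → dist p p₀ < ε / 2 ∧ dist y y₀ < ε / 2 := by
    intro p y hne
    have := Metric.mem_ball.1 (hbt (subset_tsupport _ hne))
    rw [Prod.dist_eq] at this
    exact max_lt_iff.1 this
  let B : (P × (Fin d → ℝ) × ℝ) × (Fin d → ℝ) → ℂ := fun z =>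
    (χ z : ℂ) * (b (z.1.1, z.2 + z.1.2.2 • z.1.2.1) * (starRingEnd ℂ) (b (z.1.1, z.2)))
  have hB : ContDiff ℝ ∞ B := by
    refine (Complex.ofRealCLM.contDiff.comp hχ).mul (ContDiff.mul (hb.comp ?_) ?_)
    · fun_prop
    · exact Complex.conjCLE.contDiff.comp (hb.comp (by fun_prop))
  have hχs' : HasCompactSupport fun z => (χ z : ℂ) := hχs.comp_left Complex.ofReal_zero
  have hBs : HasCompactSupport B := hχs'.mul_right
  have hBt : tsupport B ⊆ {q | ∃ j, pderivSnd Φ j q ≠ 0} := by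
    refine Subset.trans (closure_mono fun x hx => ?_) hχU
    by_contra h0
    exact hx (by simp [B, Function.notMem_support.1 h0])
  obtain ⟨C, hC, hdec⟩ := nonstationary_phase Φ hΦ ((d : ℝ) + 1) B hB hBs hBt
  obtain ⟨C₀, hC₀, hbd₀⟩ := exists_oscIntegral_le Ψ b hb.continuous hbs
  have hJ : ∀ p μ, 0 ≤ μ → ∀ h : Fin d → ℝ, h ≠ 0 →
      ‖∫ y, Complex.exp (Complex.I * (μ * (Ψ (p, y + h) - Ψ (p, y)) : ℝ)) *
        (b (p, y + h) * (starRingEnd ℂ) (b (p, y)))‖ ≤ C * (1 + μ * ‖h‖) ^ (-((d : ℝ) + 1)) := by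
    intro p μ hμ h hh
    have hn : ‖h‖ ≠ 0 := norm_ne_zero_iff.2 hh
    have hr : ‖h‖ • (‖h‖⁻¹ • h) = h := by rw [smul_smul, mul_inv_cancel₀ hn, one_smul]
    convert hdec (p, ‖h‖⁻¹ • h, ‖h‖) (μ * ‖h‖) (by positivity) using 2
    unfold oscIntegral
    congr 1
    ext y
    have h1 : μ * ‖h‖ * Φ ((p, ‖h‖⁻¹ • h, ‖h‖), y) = μ * (Ψ (p, y + h) - Ψ (p, y)) := by
      rw [mul_assoc, hΦdef, mul_diffPhase hΨ, hr]
    rw [h1]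
    congr 1
    simp only [B, hr]
    by_cases hz : b (p, y + h) = 0
    · simp [hz]
    by_cases hz' : b (p, y) = 0
    · simp [hz']
    have : χ ((p, ‖h‖⁻¹ • h, ‖h‖), y) = 1 := by
      apply hone
      apply hεO
      rw [Metric.mem_thickening_iff]
      refine ⟨_, ⟨‖h‖⁻¹ • h, ?_, rfl⟩, ?_⟩
      · rw [mem_sphere_zero_iff_norm, norm_smul, norm_inv, norm_norm, inv_mul_cancel₀ hn]
      · have h2 := hbd _ _ hz
        have h3 := hbd _ _ hz'
        have h4 : ‖h‖ < ε := by
          have : ‖h‖ = dist (y + h) y := by simp [dist_eq_norm]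
          rw [this]
          calc dist (y + h) y ≤ dist (y + h) y₀ + dist y y₀ := dist_triangle_right _ _ _
            _ < ε := by linarith [h2.2, h3.2]
        simp only [Prod.dist_eq, dist_self]
        refine max_lt (max_lt (by linarith [h2.1]) (max_lt hε ?_)) (by linarith [h3.2])
        simpa using h4
    simp [this]
  set M := ∫ h : Fin d → ℝ, (1 + ‖h‖) ^ (-((d : ℝ) + 1)) with hM
  have hM0 : 0 ≤ M := integral_nonneg fun h => by positivity
  have key : ∀ p μ, 0 < μ → ‖oscIntegral Ψ b p μ‖ ^ 2 ≤ C * M * μ ^ (-(d : ℝ)) := by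
    intro p μ hμ
    have h1 := norm_sq_oscIntegral_eq hΨ.continuous hb.continuous hbs p μ
    have h2 : ‖oscIntegral Ψ b p μ‖ ^ 2 = ‖((‖oscIntegral Ψ b p μ‖ ^ 2 : ℝ) : ℂ)‖ := by
      rw [Complex.norm_real, Real.norm_of_nonneg (by positivity)]
    rw [h2, h1]
    calc _ ≤ ∫ h : Fin d → ℝ, C * (1 + μ * ‖h‖) ^ (-((d : ℝ) + 1)) := by
          refine norm_integral_le_of_norm_le ((integrable_one_add_mul_norm_rpow hμ).const_mul C) ?_
          have : Nonempty (Fin d) := ⟨⟨0, hd⟩⟩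
          have : ∀ᵐ h : Fin d → ℝ, h ≠ 0 := by
            simp [ae_iff]
          filter_upwards [this] with h hh
          exact hJ p μ hμ.le h hh
      _ = _ := by
          rw [integral_const_mul, integral_one_add_mul_norm_rpow hμ]
          ring
  have h2d : (0 : ℝ) < 2 ^ ((d : ℝ) / 2) := by positivity
  refine ⟨(C₀ + √(C * M)) * 2 ^ ((d : ℝ) / 2), by positivity, fun p μ hμ => ?_⟩
  rcases lt_or_ge μ 1 with h1 | h1
  · calc ‖oscIntegral Ψ b p μ‖ ≤ C₀ * 1 := by simpa using hbd₀ p μ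
      _ ≤ (C₀ + √(C * M)) * (2 ^ ((d : ℝ) / 2) * (1 + μ) ^ (-((d : ℝ) / 2))) := by
        refine mul_le_mul (le_add_of_nonneg_right (Real.sqrt_nonneg _)) ?_ zero_le_one
          (by positivity)
        rw [Real.rpow_neg (by positivity), ← div_eq_mul_inv, one_le_div (by positivity)]
        exact Real.rpow_le_rpow (by positivity) (by linarith) (by positivity)
      _ = _ := by ring
  · have h3 : ‖oscIntegral Ψ b p μ‖ ≤ √(C * M) * μ ^ (-((d : ℝ) / 2)) := by
      refine (sq_le_sq₀ (norm_nonneg _) (by positivity)).1 ?_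
      rw [mul_pow, Real.sq_sqrt (by positivity), ← Real.rpow_natCast (μ ^ _), ← Real.rpow_mul hμ]
      have h5 : -((d : ℝ) / 2) * (2 : ℕ) = -(d : ℝ) := by
        push_cast
        ring
      rw [h5]
      exact key p μ (by linarith)
    refine h3.trans ?_
    have h4 : μ ^ (-((d : ℝ) / 2)) ≤ 2 ^ ((d : ℝ) / 2) * (1 + μ) ^ (-((d : ℝ) / 2)) := by
      rw [Real.rpow_neg (by positivity), Real.rpow_neg (by positivity), ← div_eq_mul_inv,
        ← Real.div_rpow (by positivity) (by positivity), ← Real.inv_rpow (by positivity)]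
      refine Real.rpow_le_rpow (by positivity) ?_ (by positivity)
      rw [inv_eq_one_div, div_le_div_iff₀ (by positivity) (by positivity)]
      linarith
    rw [mul_assoc]
    exact mul_le_mul (le_add_of_nonneg_left hC₀) h4 (by positivity) (by positivity)

end Morse

section PolarPhase

variable {d : ℕ}

/-- Insertion of a zero in position `j₀`, as a continuous linear map. -/
noncomputable def insertZero (j₀ : Fin (d + 1)) : (Fin d → ℝ) →L[ℝ] (Fin (d + 1) → ℝ) :=
  LinearMap.toContinuousLinearMap
    { toFun := fun y => j₀.insertNth (α := fun _ => ℝ) 0 y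
      map_add' := fun y z => by
        ext i
        refine Fin.succAboveCases j₀ ?_ (fun i => ?_) i <;> simp
      map_smul' := fun c y => by
        ext i
        refine Fin.succAboveCases j₀ ?_ (fun i => ?_) i <;> simp }

@[simp] theorem insertZero_apply (j₀ : Fin (d + 1)) (y : Fin d → ℝ) :
    insertZero j₀ y = j₀.insertNth (α := fun _ => ℝ) 0 y := rfl

theorem insertZero_single (j₀ : Fin (d + 1)) (j : Fin d) :
    insertZero j₀ (Pi.single j 1) = Pi.single (j₀.succAbove j) 1 := by
  ext i
  refine Fin.succAboveCases j₀ ?_ (fun i => ?_) i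
  · simp
  · simp [Pi.single_apply]

theorem insertNth_eq_add (j₀ : Fin (d + 1)) (s : ℝ) (y : Fin d → ℝ) :
    j₀.insertNth (α := fun _ => ℝ) s y = s • Pi.single j₀ (1 : ℝ) + insertZero j₀ y := by
  ext i
  refine Fin.succAboveCases j₀ ?_ (fun i => ?_) i <;> simp

theorem contDiff_insertNth {E : Type*} [NormedAddCommGroup E] [NormedSpace ℝ E]
    (j₀ : Fin (d + 1)) {f : E → ℝ} {g : E → Fin d → ℝ} (hf : ContDiff ℝ ∞ f)
    (hg : ContDiff ℝ ∞ g) : ContDiff ℝ ∞ fun z => j₀.insertNth (α := fun _ => ℝ) (f z) (g z) := by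
  simp_rw [insertNth_eq_add]
  exact (hf.smul contDiff_const).add ((insertZero j₀).contDiff.comp hg)

variable (ψ : (Fin (d + 1) → ℝ) × (Fin (d + 1) → ℝ) → ℝ)

/-- The phase `(ψ (x + r θ, y) - ψ (x, y)) / r` as a function of all coordinates of `y` except the
`j₀`-th one, with parameters `(x, r, θ, y j₀)`. -/
noncomputable def polarPhase (j₀ : Fin (d + 1))
    (z : ((Fin (d + 1) → ℝ) × ℝ × (Fin (d + 1) → ℝ) × ℝ) × (Fin d → ℝ)) : ℝ :=
  diffQuot ψ z.1.1 z.1.2.1 z.1.2.2.1 (j₀.insertNth (α := fun _ => ℝ) z.1.2.2.2 z.2)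

variable {ψ}

theorem contDiff_polarPhase (hψ : ContDiff ℝ ∞ ψ) (j₀ : Fin (d + 1)) :
    ContDiff ℝ ∞ (polarPhase ψ j₀) := by
  refine (contDiff_diffQuot hψ).comp
    (f := fun z : ((Fin (d + 1) → ℝ) × ℝ × (Fin (d + 1) → ℝ) × ℝ) × (Fin d → ℝ) =>
    (z.1.1, z.1.2.1, z.1.2.2.1, j₀.insertNth (α := fun _ => ℝ) z.1.2.2.2 z.2)) ?_
  have := contDiff_insertNth j₀
    (f := fun z : ((Fin (d + 1) → ℝ) × ℝ × (Fin (d + 1) → ℝ) × ℝ) × (Fin d → ℝ) => z.1.2.2.2)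
    (g := fun z => z.2) (by fun_prop) (by fun_prop)
  fun_prop

theorem mul_polarPhase (hψ : ContDiff ℝ ∞ ψ) (j₀ : Fin (d + 1)) (x : Fin (d + 1) → ℝ) (r : ℝ)
    (θ : Fin (d + 1) → ℝ) (s : ℝ) (y : Fin d → ℝ) :
    r * polarPhase ψ j₀ ((x, r, θ, s), y) =
      ψ (x + r • θ, j₀.insertNth (α := fun _ => ℝ) s y) -
        ψ (x, j₀.insertNth (α := fun _ => ℝ) s y) :=
  mul_diffQuot hψ x r θ _

theorem fderiv_comp_insertNth {F : Type*} [NormedAddCommGroup F] [NormedSpace ℝ F]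
    {g : (Fin (d + 1) → ℝ) → F} (hg : ContDiff ℝ ∞ g)
    (j₀ : Fin (d + 1)) (s : ℝ) (y v : Fin d → ℝ) :
    fderiv ℝ (fun y => g (j₀.insertNth (α := fun _ => ℝ) s y)) y v =
      fderiv ℝ g (j₀.insertNth (α := fun _ => ℝ) s y) (insertZero j₀ v) := by
  have h1 : HasFDerivAt g (fderiv ℝ g (j₀.insertNth (α := fun _ => ℝ) s y))
      (j₀.insertNth (α := fun _ => ℝ) s y) :=
    (hg.differentiable (by simp)).differentiableAt.hasFDerivAt
  have h2 : HasFDerivAt (fun y => j₀.insertNth (α := fun _ => ℝ) s y) (insertZero j₀) y := by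
    simp_rw [insertNth_eq_add]
    exact (insertZero j₀).hasFDerivAt.const_add _
  have h3 := (HasFDerivAt.comp y h1 h2).fderiv
  change fderiv ℝ (g ∘ fun y => j₀.insertNth (α := fun _ => ℝ) s y) y v = _
  rw [h3]
  rfl

theorem contDiff_fderiv_fst (hψ : ContDiff ℝ ∞ ψ) (x θ : Fin (d + 1) → ℝ) :
    ContDiff ℝ ∞ fun y => fderiv ℝ ψ (x, y) (θ, 0) :=
  ((hψ.fderiv_right (m := ∞) (by simp)).comp (contDiff_const.prodMk contDiff_id)).clm_apply
    contDiff_const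

theorem fderiv_slice_apply {P : Type*} [NormedAddCommGroup P] [NormedSpace ℝ P]
    {F : Type*} [NormedAddCommGroup F] [NormedSpace ℝ F]
    {g : P × (Fin d → ℝ) → F} (hg : ContDiff ℝ ∞ g) (p : P) (y v : Fin d → ℝ) :
    fderiv ℝ (fun y => g (p, y)) y v = fderiv ℝ g (p, y) (0, v) := by
  have h1 : HasFDerivAt g (fderiv ℝ g (p, y)) (p, y) :=
    (hg.differentiable (by simp)).differentiableAt.hasFDerivAt
  have h2 : HasFDerivAt (fun y : Fin d → ℝ => (p, y))
      (ContinuousLinearMap.inr ℝ P (Fin d → ℝ)) y := hasFDerivAt_prodMk_right p y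
  have := (h1.comp y h2).fderiv
  change fderiv ℝ (g ∘ fun y => (p, y)) y _ = _
  rw [this]
  simp

theorem polarPhase_zero (j₀ : Fin (d + 1)) (x θ : Fin (d + 1) → ℝ) (s : ℝ) (y : Fin d → ℝ) :
    polarPhase ψ j₀ ((x, 0, θ, s), y) =
      fderiv ℝ ψ (x, j₀.insertNth (α := fun _ => ℝ) s y) (θ, 0) :=
  diffQuot_zero ψ x θ _

theorem pderivSnd_polarPhase (hψ : ContDiff ℝ ∞ ψ) (j₀ : Fin (d + 1)) (j : Fin d)
    (x θ : Fin (d + 1) → ℝ) (s : ℝ) (y : Fin d → ℝ) :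
    pderivSnd (polarPhase ψ j₀) j ((x, 0, θ, s), y) =
      fderiv ℝ (fun y => fderiv ℝ ψ (x, y) (θ, 0)) (j₀.insertNth (α := fun _ => ℝ) s y)
        (Pi.single (j₀.succAbove j) 1) := by
  rw [← fderiv_slice (contDiff_polarPhase hψ j₀)]
  simp_rw [polarPhase_zero]
  rw [fderiv_comp_insertNth (contDiff_fderiv_fst hψ x θ), insertZero_single]

theorem pderivSnd_fderiv_polarPhase (hψ : ContDiff ℝ ∞ ψ) (j₀ : Fin (d + 1)) (j : Fin d)
    (x θ : Fin (d + 1) → ℝ) (s : ℝ) (y v : Fin d → ℝ) :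
    pderivSnd (fun q => fderiv ℝ (polarPhase ψ j₀) q (0, v)) j ((x, 0, θ, s), y) =
      fderiv ℝ (fun y => fderiv ℝ (fun y => fderiv ℝ ψ (x, y) (θ, 0)) y (insertZero j₀ v))
        (j₀.insertNth (α := fun _ => ℝ) s y) (Pi.single (j₀.succAbove j) 1) := by
  have hg := contDiff_fderiv_fst hψ x θ
  rw [← fderiv_slice (((contDiff_polarPhase hψ j₀).fderiv_right (m := ∞) (by simp)).clm_apply
    contDiff_const)]
  simp_rw [← fderiv_slice_apply (contDiff_polarPhase hψ j₀), polarPhase_zero,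
    fderiv_comp_insertNth hg]
  rw [fderiv_comp_insertNth (g := fun y => fderiv ℝ (fun y => fderiv ℝ ψ (x, y) (θ, 0)) y
    (insertZero j₀ v)) ((hg.fderiv_right (m := ∞) (by simp)).clm_apply contDiff_const),
    insertZero_single]

end PolarPhase

section Kernel

variable {d : ℕ}

/-- The kernel of `T T*` for the oscillatory integral operator `T` with phase `ψ` and
amplitude `b`. -/
noncomputable def ttKernel {X Y : Type*} [MeasureSpace Y] (ψ : X × Y → ℝ) (b : X × Y → ℂ)
    (lam : ℝ) (x x' : X) : ℂ :=
  ∫ y, Complex.exp (Complex.I * (lam * (ψ (x, y) - ψ (x', y)) : ℝ)) *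
    (b (x, y) * (starRingEnd ℂ) (b (x', y)))

theorem exists_ttKernel_le {ψ : (Fin (d + 1) → ℝ) × (Fin (d + 1) → ℝ) → ℝ}
    (hψ : ContDiff ℝ ∞ ψ) (j₀ : Fin (d + 1)) {S : Set (Fin (d + 1) → ℝ)} (hS : IsCompact S)
    (x₀ y₀ : Fin (d + 1) → ℝ) (m : ℝ)
    (hdec : ∀ θ ∈ S, DecaysAt (polarPhase ψ j₀) m
      ((x₀, 0, θ, y₀ j₀), j₀.removeNth (α := fun _ => ℝ) y₀)) (hS1 : ∀ θ ∈ S, ‖θ‖ = 1) :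
    ∃ ε > 0, ∀ b : (Fin (d + 1) → ℝ) × (Fin (d + 1) → ℝ) → ℂ, ContDiff ℝ ∞ b →
      HasCompactSupport b → tsupport b ⊆ Metric.ball (x₀, y₀) ε →
      ∃ C, 0 ≤ C ∧ ∀ lam, 0 ≤ lam → ∀ x r θ, 0 ≤ r → θ ∈ S →
        ‖ttKernel ψ b lam (x + r • θ) x‖ ≤ C * (1 + lam * r) ^ (-m) := by
  set Φ := polarPhase ψ j₀ with hΦdef
  have hΦ : ContDiff ℝ ∞ Φ := contDiff_polarPhase hψ j₀
  let K : Set (((Fin (d + 1) → ℝ) × ℝ × (Fin (d + 1) → ℝ) × ℝ) × (Fin d → ℝ)) :=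
    (fun θ => ((x₀, (0 : ℝ), θ, y₀ j₀), j₀.removeNth (α := fun _ => ℝ) y₀)) '' S
  have hK : IsCompact K := hS.image (by fun_prop)
  have hKU : K ⊆ {q | DecaysAt Φ m q} := by
    rintro _ ⟨θ, hθ, rfl⟩
    exact hdec θ hθ
  obtain ⟨χ, hχ, hχs, hχU, O, hO, hKO, hone⟩ :=
    exists_cutoff hK (isOpen_setOf_decaysAt Φ m) hKU
  obtain ⟨ε, hε, hεO⟩ := hK.exists_thickening_subset_open hO hKO
  refine ⟨ε / 2, by linarith, fun b hb hbs hbt => ?_⟩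
  have hbd : ∀ p y, b (p, y) ≠ 0 → dist p x₀ < ε / 2 ∧ dist y y₀ < ε / 2 := by
    intro p y hne
    have := Metric.mem_ball.1 (hbt (subset_tsupport _ hne))
    rw [Prod.dist_eq] at this
    exact max_lt_iff.1 this
  let B : ((Fin (d + 1) → ℝ) × ℝ × (Fin (d + 1) → ℝ) × ℝ) × (Fin d → ℝ) → ℂ := fun z =>
    (χ z : ℂ) * (b (z.1.1 + z.1.2.1 • z.1.2.2.1, j₀.insertNth (α := fun _ => ℝ) z.1.2.2.2 z.2) *
      (starRingEnd ℂ) (b (z.1.1, j₀.insertNth (α := fun _ => ℝ) z.1.2.2.2 z.2)))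
  have hins := contDiff_insertNth j₀
    (f := fun z : ((Fin (d + 1) → ℝ) × ℝ × (Fin (d + 1) → ℝ) × ℝ) × (Fin d → ℝ) => z.1.2.2.2)
    (g := fun z => z.2) (by fun_prop) (by fun_prop)
  have hB : ContDiff ℝ ∞ B := by
    refine (Complex.ofRealCLM.contDiff.comp hχ).mul (ContDiff.mul (hb.comp ?_) ?_)
    · fun_prop
    · exact Complex.conjCLE.contDiff.comp (hb.comp (by fun_prop))
  have hχs' : HasCompactSupport fun z => (χ z : ℂ) := hχs.comp_left Complex.ofReal_zero
  have hBs : HasCompactSupport B := hχs'.mul_right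
  have hBt : tsupport B ⊆ {q | DecaysAt Φ m q} := by
    refine Subset.trans (closure_mono fun x hx => ?_) hχU
    by_contra h0
    exact hx (by simp [B, Function.notMem_support.1 h0])
  obtain ⟨C, hC, hdecB⟩ := decays_of_tsupport_subset hΦ.continuous hB hBs hBt
  refine ⟨C * (2 * ε), by positivity, fun lam hlam x r θ hr hθ => ?_⟩
  set G : (Fin (d + 1) → ℝ) → ℂ := fun y =>
    Complex.exp (Complex.I * (lam * (ψ (x + r • θ, y) - ψ (x, y)) : ℝ)) *
      (b (x + r • θ, y) * (starRingEnd ℂ) (b (x, y))) with hG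
  have hψc := hψ.continuous
  have hbc := hb.continuous
  have hGc : Continuous G := by
    have := Complex.continuous_conj.comp (hbc.comp (Continuous.prodMk_right x))
    have h2 : Continuous fun y => (starRingEnd ℂ) (b (x, y)) := this
    fun_prop
  have hGi : Integrable G := by
    refine hGc.integrable_of_hasCompactSupport ?_
    exact HasCompactSupport.mul_left (HasCompactSupport.mul_right (hasCompactSupport_slice hbs _))
  have hmp := (volume_preserving_piFinSuccAbove (fun _ : Fin (d + 1) => ℝ) j₀).symm
  have hGi' : Integrable (fun z : ℝ × (Fin d → ℝ) => G (j₀.insertNth (α := fun _ => ℝ) z.1 z.2))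
      (volume.prod volume) :=
    hmp.integrable_comp_of_integrable hGi
  have h1 : ttKernel ψ b lam (x + r • θ) x =
      ∫ s : ℝ, ∫ y : Fin d → ℝ, G (j₀.insertNth (α := fun _ => ℝ) s y) := by
    rw [← integral_prod _ hGi']
    exact (hmp.integral_comp' G).symm
  have hmem : ∀ s y, G (j₀.insertNth (α := fun _ => ℝ) s y) ≠ 0 →
      dist s (y₀ j₀) < ε / 2 ∧ χ ((x, r, θ, s), y) = 1 := by
    intro s y hne
    have hne1 : b (x + r • θ, j₀.insertNth (α := fun _ => ℝ) s y) ≠ 0 := by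
      intro h0; simp [hG, h0] at hne
    have hne2 : b (x, j₀.insertNth (α := fun _ => ℝ) s y) ≠ 0 := by
      intro h0; simp [hG, h0] at hne
    have h2 := hbd _ _ hne1
    have h3 := hbd _ _ hne2
    have h4 : dist s (y₀ j₀) < ε / 2 := by
      have := (dist_le_pi_dist (j₀.insertNth (α := fun _ => ℝ) s y) y₀ j₀).trans_lt h3.2
      simpa using this
    refine ⟨h4, hone _ (hεO ?_)⟩
    rw [Metric.mem_thickening_iff]
    refine ⟨_, ⟨θ, hθ, rfl⟩, ?_⟩
    have h5 : dist r 0 < ε := by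
      have : dist r 0 = dist (x + r • θ) x := by
        simp [dist_eq_norm, norm_smul, hS1 θ hθ]
      rw [this]
      calc dist (x + r • θ) x ≤ dist (x + r • θ) x₀ + dist x x₀ := dist_triangle_right _ _ _
        _ < ε := by linarith [h2.1, h3.1]
    have h6 : dist y (j₀.removeNth (α := fun _ => ℝ) y₀) < ε := by
      rw [dist_pi_lt_iff hε]
      intro i
      have := (dist_le_pi_dist (j₀.insertNth (α := fun _ => ℝ) s y) y₀ (j₀.succAbove i)).trans_lt
        h3.2
      simp only [Fin.insertNth_apply_succAbove] at this
      simp only [Fin.removeNth]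
      linarith
    simp only [Prod.dist_eq, dist_self]
    exact max_lt (max_lt (by linarith [h3.1]) (max_lt h5 (max_lt hε (by linarith)))) h6
  have h2 : ∀ s, ∫ y : Fin d → ℝ, G (j₀.insertNth (α := fun _ => ℝ) s y) =
      oscIntegral Φ B (x, r, θ, s) (lam * r) := by
    intro s
    unfold oscIntegral
    congr 1
    ext y
    by_cases hz : G (j₀.insertNth (α := fun _ => ℝ) s y) = 0
    · rw [hz]
      have : b (x + r • θ, j₀.insertNth (α := fun _ => ℝ) s y) *
        (starRingEnd ℂ) (b (x, j₀.insertNth (α := fun _ => ℝ) s y)) = 0 := by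
        rcases mul_eq_zero.1 hz with h | h
        · exact absurd h (Complex.exp_ne_zero _)
        · exact h
      simp [B, this]
    · rw [mul_assoc lam r, hΦdef, mul_polarPhase hψ]
      simp [B, (hmem s y hz).2, hG]
  rw [h1]
  have h3 : ∀ s, ‖∫ y : Fin d → ℝ, G (j₀.insertNth (α := fun _ => ℝ) s y)‖ ≤
      (Metric.closedBall (y₀ j₀) ε).indicator (fun _ => C * (1 + lam * r) ^ (-m)) s := by
    intro s
    by_cases hs : s ∈ Metric.closedBall (y₀ j₀) ε
    · rw [indicator_of_mem hs, h2]
      exact hdecB _ _ (by positivity)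
    · rw [indicator_of_notMem hs]
      have : ∀ y, G (j₀.insertNth (α := fun _ => ℝ) s y) = 0 := by
        intro y
        by_contra hne
        exact hs (Metric.mem_closedBall.2 (by linarith [(hmem s y hne).1]))
      simp [this]
  calc _ ≤ ∫ s, (Metric.closedBall (y₀ j₀) ε).indicator (fun _ => C * (1 + lam * r) ^ (-m)) s := by
        refine norm_integral_le_of_norm_le ?_ (Eventually.of_forall h3)
        rw [integrable_indicator_iff measurableSet_closedBall]
        exact integrableOn_const measure_closedBall_lt_top.ne enorm_ne_top
    _ = _ := by
        rw [integral_indicator measurableSet_closedBall, setIntegral_const]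
        simp [Measure.real, Real.volume_closedBall, ENNReal.toReal_ofReal hε.le]
        ring

end Kernel

section LinearAlgebra

open Matrix

variable {d : ℕ}

theorem exists_ker_of_rank_eq {A : Matrix (Fin (d + 1)) (Fin (d + 1)) ℝ} (hA : A.rank = d) :
    ∃ v ≠ 0, A *ᵥ v = 0 ∧ ∀ w, A *ᵥ w = 0 → ∃ c : ℝ, w = c • v := by
  have h1 := LinearMap.finrank_range_add_finrank_ker A.mulVecLin
  have h2 : Module.finrank ℝ (LinearMap.range A.mulVecLin) = d := hA
  rw [h2, Module.finrank_fintype_fun_eq_card, Fintype.card_fin] at h1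
  have h3 : Module.finrank ℝ (LinearMap.ker A.mulVecLin) = 1 := by omega
  obtain ⟨v, hv, hv'⟩ := finrank_eq_one_iff'.1 h3
  refine ⟨v, by simpa using hv, LinearMap.mem_ker.1 v.2, fun w hw => ?_⟩
  obtain ⟨c, hc⟩ := hv' ⟨w, by simpa using hw⟩
  exact ⟨c, by rw [← Submodule.coe_smul, hc]⟩

theorem dotProduct_self_ne_zero {n : ℕ} {v : Fin n → ℝ} (hv : v ≠ 0) : v ⬝ᵥ v ≠ 0 := by
  simpa using hv

theorem det_add_vecMulVec_ne_zero {A : Matrix (Fin (d + 1)) (Fin (d + 1)) ℝ}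
    {e v : Fin (d + 1) → ℝ} (he : e ≠ 0) (hv : v ≠ 0) (heA : e ᵥ* A = 0)
    (hker : ∀ w, A *ᵥ w = 0 → ∃ c : ℝ, w = c • v) : (A + vecMulVec e v).det ≠ 0 := by
  intro h0
  obtain ⟨w, hw, hw0⟩ := exists_mulVec_eq_zero_iff.2 h0
  rw [add_mulVec, vecMulVec_mulVec] at hw0
  have h1 : e ⬝ᵥ (A *ᵥ w) = 0 := by rw [dotProduct_mulVec, heA, zero_dotProduct]
  have h2 := congrArg (e ⬝ᵥ ·) hw0
  simp only [dotProduct_add, h1, zero_add, dotProduct_zero, op_smul_eq_smul, dotProduct_smul,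
    smul_eq_mul, mul_eq_zero, dotProduct_self_ne_zero he, or_false] at h2
  rw [h2] at hw0
  obtain ⟨c, rfl⟩ := hker w (by simpa using hw0)
  rw [dotProduct_smul, smul_eq_mul, mul_eq_zero] at h2
  rcases h2 with h2 | h2
  · simp [h2] at hw
  · exact dotProduct_self_ne_zero hv h2

theorem det_smul_eq_smul_cramer {n : ℕ} {A : Matrix (Fin n) (Fin n) ℝ} {e v w : Fin n → ℝ}
    (hdet : (A + vecMulVec e v).det ≠ 0) (hw : A *ᵥ w = 0) :
    (A + vecMulVec e v).det • w = (v ⬝ᵥ w) • cramer (A + vecMulVec e v) e := by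
  have h1 : (A + vecMulVec e v) *ᵥ w = (v ⬝ᵥ w) • e := by
    rw [add_mulVec, vecMulVec_mulVec, hw, zero_add, op_smul_eq_smul]
  have h2 : (A + vecMulVec e v) *ᵥ ((A + vecMulVec e v).det • w -
      (v ⬝ᵥ w) • cramer (A + vecMulVec e v) e) = 0 := by
    rw [mulVec_sub, mulVec_smul, mulVec_smul, h1, mulVec_cramer, smul_comm, sub_self]
  exact sub_eq_zero.1 (eq_zero_of_mulVec_eq_zero hdet h2)

theorem contDiff_det {E : Type*} [NormedAddCommGroup E] [NormedSpace ℝ E] {n : ℕ}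
    {M : E → Matrix (Fin n) (Fin n) ℝ} (hM : ∀ i k, ContDiff ℝ ∞ fun p => M p i k) :
    ContDiff ℝ ∞ fun p => (M p).det := by
  simp_rw [det_apply]
  refine ContDiff.sum fun σ _ => ContDiff.const_smul _ ?_
  exact contDiff_prod fun i _ => hM _ _

/-- Differentiating a family of singular matrices of corank one: the derivative pairs to zero
with the left and right kernels. -/
theorem sum_fderiv_eq_zero_of_det_eq_zero {E : Type*} [NormedAddCommGroup E] [NormedSpace ℝ E]
    {M : E → Matrix (Fin (d + 1)) (Fin (d + 1)) ℝ} (hM : ∀ i k, ContDiff ℝ ∞ fun p => M p i k)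
    {U : Set E} (hU : IsOpen U) (hdet : ∀ p ∈ U, (M p).det = 0) {p₀ : E} (hp₀ : p₀ ∈ closure U)
    {e v : Fin (d + 1) → ℝ} (he : e ≠ 0) (hv : v ≠ 0) (heM : e ᵥ* M p₀ = 0) (hMv : M p₀ *ᵥ v = 0)
    (hker : ∀ w, M p₀ *ᵥ w = 0 → ∃ c : ℝ, w = c • v) (h : E) :
    ∑ i, ∑ k, e i * fderiv ℝ (fun p => M p i k) p₀ h * v k = 0 := by
  let A : E → Matrix (Fin (d + 1)) (Fin (d + 1)) ℝ := fun p => M p + vecMulVec e v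
  have hA : ∀ i k, ContDiff ℝ ∞ fun p => A p i k := fun i k => (hM i k).add contDiff_const
  let u : E → Fin (d + 1) → ℝ := fun p => cramer (A p) e
  have hu : ∀ k, ContDiff ℝ ∞ fun p => u p k := by
    intro k
    simp only [u, cramer_apply]
    refine contDiff_det fun i l => ?_
    simp only [updateCol_apply]
    split_ifs
    · exact contDiff_const
    · exact hA i l
  have hA₀ : (A p₀).det ≠ 0 := det_add_vecMulVec_ne_zero he hv heM hker
  let V := U ∩ {p | (A p).det ≠ 0}
  have hV : IsOpen V := hU.inter (isOpen_ne_fun (contDiff_det hA).continuous continuous_const)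
  have hp₀V : p₀ ∈ closure V := by
    rw [mem_closure_iff_nhds] at hp₀ ⊢
    intro t ht
    have := (isOpen_ne_fun (contDiff_det hA).continuous continuous_const).mem_nhds hA₀
    obtain ⟨z, hz1, hz2⟩ := hp₀ _ (inter_mem ht this)
    exact ⟨z, hz1.1, hz2, hz1.2⟩
  have hMu : ∀ p ∈ V, M p *ᵥ u p = 0 := by
    rintro p ⟨hp, hp'⟩
    obtain ⟨w, hw, hw0⟩ := exists_mulVec_eq_zero_iff.2 (hdet p hp)
    have h1 : (A p).det • w = (v ⬝ᵥ w) • u p := det_smul_eq_smul_cramer hp' hw0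
    have h2 : v ⬝ᵥ w ≠ 0 := by
      intro h0
      rw [h0, zero_smul, smul_eq_zero] at h1
      exact h1.elim hp' hw
    have h3 : (v ⬝ᵥ w) • M p *ᵥ u p = 0 := by
      rw [← mulVec_smul, ← h1, mulVec_smul, hw0, smul_zero]
    exact (smul_eq_zero.1 h3).resolve_left h2
  let G : Fin (d + 1) → E → ℝ := fun i p => ∑ k, M p i k * u p k
  have hG : ∀ i, ContDiff ℝ ∞ (G i) := fun i => ContDiff.sum fun k _ => (hM i k).mul (hu k)
  have hG0 : ∀ i, fderiv ℝ (G i) p₀ = 0 := by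
    intro i
    have hc : Continuous (fderiv ℝ (G i)) := ((hG i).fderiv_right (m := ∞) (by simp)).continuous
    have : closure V ⊆ {p | fderiv ℝ (G i) p = 0} := by
      refine closure_minimal (fun p hp => ?_) (isClosed_eq hc continuous_const)
      have : G i =ᶠ[𝓝 p] fun _ => 0 := by
        filter_upwards [hV.mem_nhds hp] with q hq
        exact congrFun (hMu q hq) i
      change fderiv ℝ (G i) p = 0
      rw [this.fderiv_eq]
      simp
    exact this hp₀V
  have hd : ∀ i, ∑ k, (fderiv ℝ (fun p => M p i k) p₀ h * u p₀ k +
      M p₀ i k * fderiv ℝ (fun p => u p k) p₀ h) = 0 := by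
    intro i
    have h1 : HasFDerivAt (G i) (∑ k, (M p₀ i k • fderiv ℝ (fun p => u p k) p₀ +
        u p₀ k • fderiv ℝ (fun p => M p i k) p₀)) p₀ := by
      refine HasFDerivAt.fun_sum fun k _ => ?_
      exact (((hM i k).differentiable (by simp)).differentiableAt.hasFDerivAt).mul
        (((hu k).differentiable (by simp)).differentiableAt.hasFDerivAt)
    have h2 := h1.fderiv
    rw [hG0] at h2
    have h3 := congrArg (fun L => L h) h2
    simp only [_root_.zero_apply, _root_.sum_apply,
      _root_.add_apply, _root_.smul_apply, smul_eq_mul] at h3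
    rw [h3]
    exact Finset.sum_congr rfl fun k _ => by ring
  have h1 : (A p₀).det • v = (v ⬝ᵥ v) • u p₀ := det_smul_eq_smul_cramer hA₀ hMv
  have h2 : ∀ k, v k = ((A p₀).det)⁻¹ * (v ⬝ᵥ v) * u p₀ k := by
    intro k
    have := congrFun h1 k
    simp only [Pi.smul_apply, smul_eq_mul] at this
    rw [mul_assoc, ← this, ← mul_assoc, inv_mul_cancel₀ hA₀, one_mul]
  have h3 : ∑ i, ∑ k, e i * fderiv ℝ (fun p => M p i k) p₀ h * u p₀ k = 0 := by
    have h4 : ∑ i, ∑ k, e i * (M p₀ i k * fderiv ℝ (fun p => u p k) p₀ h) = 0 := by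
      rw [Finset.sum_comm]
      refine Finset.sum_eq_zero fun k _ => ?_
      have := congrFun heM k
      simp only [vecMul, dotProduct, Pi.zero_apply] at this
      simp_rw [← mul_assoc]
      rw [← Finset.sum_mul, this, zero_mul]
    have h5 : ∑ i, e i * ∑ k, (fderiv ℝ (fun p => M p i k) p₀ h * u p₀ k +
      M p₀ i k * fderiv ℝ (fun p => u p k) p₀ h) = 0 := by simp [hd]
    simp_rw [Finset.mul_sum, mul_add, Finset.sum_add_distrib, h4, add_zero] at h5
    simpa [mul_assoc] using h5
  calc ∑ i, ∑ k, e i * fderiv ℝ (fun p => M p i k) p₀ h * v k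
      = ((A p₀).det)⁻¹ * (v ⬝ᵥ v) *
        ∑ i, ∑ k, e i * fderiv ℝ (fun p => M p i k) p₀ h * u p₀ k := by
        simp_rw [Finset.mul_sum]
        refine Finset.sum_congr rfl fun i _ => Finset.sum_congr rfl fun k _ => ?_
        rw [h2 k]
        ring
    _ = 0 := by rw [h3, mul_zero]

theorem exists_succAbove_ne_zero {n : ℕ} {j₀ : Fin (n + 1)} {v z : Fin (n + 1) → ℝ}
    (hv : v j₀ ≠ 0) (hz : z ≠ 0) (hzv : z ⬝ᵥ v = 0) : ∃ j, z (j₀.succAbove j) ≠ 0 := by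
  by_contra! h
  apply hz
  rw [dotProduct, Fin.sum_univ_succAbove _ j₀] at hzv
  simp only [h, zero_mul, Finset.sum_const_zero, add_zero, mul_eq_zero, hv, or_false] at hzv
  ext i
  exact Fin.succAboveCases j₀ (by simpa using hzv) h i

end LinearAlgebra

section MixedHessian

open Matrix

variable {d : ℕ} {ψ : (Fin (d + 1) → ℝ) × (Fin (d + 1) → ℝ) → ℝ}

/-- The matrix of mixed second derivatives `∂²ψ / ∂x_i ∂y_k`. -/
noncomputable def mixedHess (ψ : (Fin (d + 1) → ℝ) × (Fin (d + 1) → ℝ) → ℝ)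
    (q : (Fin (d + 1) → ℝ) × (Fin (d + 1) → ℝ)) : Matrix (Fin (d + 1)) (Fin (d + 1)) ℝ :=
  Matrix.of fun i k => pderivSnd (fun q => fderiv ℝ ψ q (Pi.single i 1, 0)) k q

theorem contDiff_fderiv_apply (hψ : ContDiff ℝ ∞ ψ) (v : (Fin (d + 1) → ℝ) × (Fin (d + 1) → ℝ)) :
    ContDiff ℝ ∞ fun q => fderiv ℝ ψ q v :=
  (hψ.fderiv_right (m := ∞) (by simp)).clm_apply contDiff_const

theorem contDiff_mixedHess (hψ : ContDiff ℝ ∞ ψ) (i k : Fin (d + 1)) :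
    ContDiff ℝ ∞ fun q => mixedHess ψ q i k :=
  contDiff_pderivSnd (contDiff_fderiv_apply hψ _) k

theorem prod_zero_eq_sum (θ : Fin (d + 1) → ℝ) :
    ((θ, 0) : (Fin (d + 1) → ℝ) × (Fin (d + 1) → ℝ)) = ∑ i, θ i • (Pi.single i 1, 0) := by
  ext i
  · simp [Prod.fst_sum, Finset.sum_apply, Pi.single_apply]
  · simp [Prod.snd_sum, Finset.sum_apply]

theorem zero_prod_eq_sum {P : Type*} [NormedAddCommGroup P] [NormedSpace ℝ P] {n : ℕ}
    (w : Fin n → ℝ) :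
    ((0, w) : P × (Fin n → ℝ)) = ∑ i, w i • (0, Pi.single i 1) := by
  ext i
  · simp [Prod.fst_sum]
  · simp [Prod.snd_sum, Finset.sum_apply, Pi.single_apply]

theorem fderiv_fst_eq_sum (θ : Fin (d + 1) → ℝ) (q : (Fin (d + 1) → ℝ) × (Fin (d + 1) → ℝ)) :
    fderiv ℝ ψ q (θ, 0) = ∑ i, θ i * fderiv ℝ ψ q (Pi.single i 1, 0) := by
  rw [prod_zero_eq_sum, map_sum]
  exact Finset.sum_congr rfl fun i _ => by rw [map_smul, smul_eq_mul]

theorem fderiv_fst_slice (hψ : ContDiff ℝ ∞ ψ) (x y v : Fin (d + 1) → ℝ) :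
    fderiv ℝ (fun x => ψ (x, y)) x v = fderiv ℝ ψ (x, y) (v, 0) := by
  have h1 : HasFDerivAt ψ (fderiv ℝ ψ (x, y)) (x, y) :=
    (hψ.differentiable (by simp)).differentiableAt.hasFDerivAt
  have h2 : HasFDerivAt (fun x : Fin (d + 1) → ℝ => (x, y))
      (ContinuousLinearMap.inl ℝ (Fin (d + 1) → ℝ) (Fin (d + 1) → ℝ)) x :=
    hasFDerivAt_prodMk_left x y
  have := (h1.comp x h2).fderiv
  change fderiv ℝ (ψ ∘ fun x => (x, y)) x _ = _
  rw [this]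
  simp

theorem fderiv_apply_eq {E F : Type*} [NormedAddCommGroup E] [NormedSpace ℝ E]
    [NormedAddCommGroup F] [NormedSpace ℝ F] {g : E → F} (hg : ContDiff ℝ ∞ g) (q u v : E) :
    fderiv ℝ (fun q => fderiv ℝ g q v) q u = fderiv ℝ (fderiv ℝ g) q u v := by
  have h : DifferentiableAt ℝ (fderiv ℝ g) q :=
    ((hg.fderiv_right (m := ∞) (by simp)).differentiable (by simp)).differentiableAt
  rw [fderiv_clm_apply h (differentiableAt_const v)]
  simp

theorem fderiv_fderiv_comm {E F : Type*} [NormedAddCommGroup E] [NormedSpace ℝ E]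
    [NormedAddCommGroup F] [NormedSpace ℝ F] {g : E → F} (hg : ContDiff ℝ ∞ g) (q u v : E) :
    fderiv ℝ (fun q => fderiv ℝ g q v) q u = fderiv ℝ (fun q => fderiv ℝ g q u) q v := by
  rw [fderiv_apply_eq hg, fderiv_apply_eq hg]
  exact ((contDiff_infty.1 hg 2).contDiffAt.isSymmSndFDerivAt (by simp)).eq u v

theorem fderiv_fderiv_eq_mixedHess (hψ : ContDiff ℝ ∞ ψ)
    (p : (Fin (d + 1) → ℝ) × (Fin (d + 1) → ℝ)) (i j : Fin (d + 1)) :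
    fderiv ℝ (fun x => fderiv ℝ (fun y => ψ (x, y)) p.2 (Pi.single j 1)) p.1 (Pi.single i 1) =
      mixedHess ψ p i j := by
  simp_rw [fderiv_slice_apply hψ]
  rw [fderiv_fst_slice (ψ := fun q => fderiv ℝ ψ q (0, Pi.single j 1))
    (contDiff_fderiv_apply hψ _), fderiv_fderiv_comm hψ]
  rfl

theorem fderiv_fderiv_fst (hψ : ContDiff ℝ ∞ ψ) (x y θ w : Fin (d + 1) → ℝ) :
    fderiv ℝ (fun y => fderiv ℝ ψ (x, y) (θ, 0)) y w =
      ∑ i, ∑ k, θ i * mixedHess ψ (x, y) i k * w k := by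
  simp_rw [fderiv_fst_eq_sum θ]
  rw [fderiv_fun_sum]
  · rw [_root_.sum_apply]
    refine Finset.sum_congr rfl fun i _ => ?_
    rw [fderiv_const_mul, _root_.smul_apply,
      fderiv_slice_apply (g := fun q => fderiv ℝ ψ q (Pi.single i 1, 0))
        (contDiff_fderiv_apply hψ _), zero_prod_eq_sum, map_sum, smul_eq_mul, Finset.mul_sum]
    · refine Finset.sum_congr rfl fun k _ => ?_
      simp only [map_smul, smul_eq_mul, mixedHess, of_apply, pderivSnd]
      ring
    · exact ((contDiff_fderiv_fst hψ x _).differentiable (by simp)).differentiableAt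
  · intro i _
    exact (((contDiff_fderiv_fst hψ x _).differentiable (by simp)).differentiableAt).const_mul _

theorem fderiv_fderiv_fderiv_fst (hψ : ContDiff ℝ ∞ ψ) (x y θ w u : Fin (d + 1) → ℝ) :
    fderiv ℝ (fun y => fderiv ℝ (fun y => fderiv ℝ ψ (x, y) (θ, 0)) y w) y u =
      ∑ i, ∑ k, θ i * fderiv ℝ (fun q => mixedHess ψ q i k) (x, y) (0, u) * w k := by
  simp_rw [fderiv_fderiv_fst hψ]
  have hd : ∀ i k, DifferentiableAt ℝ (fun y => mixedHess ψ (x, y) i k) y := fun i k =>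
    (((contDiff_mixedHess hψ i k).comp
      (contDiff_prodMk_right x)).differentiable (by simp)).differentiableAt
  rw [fderiv_fun_sum]
  · rw [_root_.sum_apply]
    refine Finset.sum_congr rfl fun i _ => ?_
    rw [fderiv_fun_sum, _root_.sum_apply]
    · refine Finset.sum_congr rfl fun k _ => ?_
      rw [fderiv_mul_const ((hd i k).const_mul _), fderiv_const_mul (hd i k), _root_.smul_apply,
        _root_.smul_apply, fderiv_slice_apply (contDiff_mixedHess hψ i k)]
      simp only [smul_eq_mul]
      ring
    · exact fun k _ => ((hd i k).const_mul _).mul_const _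
  · exact fun i _ => DifferentiableAt.fun_sum fun k _ => ((hd i k).const_mul _).mul_const _

/-- The Hessian in `y` of `θ · ∇ₓ ψ`. -/
noncomputable def dirHess (ψ : (Fin (d + 1) → ℝ) × (Fin (d + 1) → ℝ) → ℝ)
    (q : (Fin (d + 1) → ℝ) × (Fin (d + 1) → ℝ)) (θ : Fin (d + 1) → ℝ) :
    Matrix (Fin (d + 1)) (Fin (d + 1)) ℝ :=
  Matrix.of fun j k => ∑ i, θ i * fderiv ℝ (fun q => mixedHess ψ q i k) q (0, Pi.single j 1)

theorem dirHess_mulVec_apply (q : (Fin (d + 1) → ℝ) × (Fin (d + 1) → ℝ)) (θ w : Fin (d + 1) → ℝ)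
    (j : Fin (d + 1)) : (dirHess ψ q θ *ᵥ w) j =
      ∑ i, ∑ k, θ i * fderiv ℝ (fun q => mixedHess ψ q i k) q (0, Pi.single j 1) * w k := by
  simp only [mulVec, dotProduct, dirHess, of_apply, Finset.sum_mul]
  rw [Finset.sum_comm]

theorem fderiv_fderiv_fst_single (hψ : ContDiff ℝ ∞ ψ) (x y θ w : Fin (d + 1) → ℝ)
    (j : Fin (d + 1)) :
    fderiv ℝ (fun y => fderiv ℝ (fun y => fderiv ℝ ψ (x, y) (θ, 0)) y w) y (Pi.single j 1) =
      (dirHess ψ (x, y) θ *ᵥ w) j := by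
  rw [fderiv_fderiv_fderiv_fst hψ, dirHess_mulVec_apply]

theorem dirHess_apply_eq (hψ : ContDiff ℝ ∞ ψ) (x y θ : Fin (d + 1) → ℝ) (j k : Fin (d + 1)) :
    dirHess ψ (x, y) θ j k =
    fderiv ℝ (fun y => fderiv ℝ (fun y => fderiv ℝ ψ (x, y) (θ, 0)) y (Pi.single k 1)) y
      (Pi.single j 1) := by
  rw [fderiv_fderiv_fst_single hψ]
  simp

theorem dirHess_transpose (hψ : ContDiff ℝ ∞ ψ) (q : (Fin (d + 1) → ℝ) × (Fin (d + 1) → ℝ))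
    (θ : Fin (d + 1) → ℝ) : (dirHess ψ q θ)ᵀ = dirHess ψ q θ := by
  ext j k
  rw [transpose_apply, dirHess_apply_eq hψ q.1 q.2, dirHess_apply_eq hψ q.1 q.2]
  exact fderiv_fderiv_comm (contDiff_fderiv_fst hψ _ _) _ _ _

theorem dirHess_smul (q : (Fin (d + 1) → ℝ) × (Fin (d + 1) → ℝ)) (c : ℝ) (θ : Fin (d + 1) → ℝ) :
    dirHess ψ q (c • θ) = c • dirHess ψ q θ := by
  ext j k
  simp [dirHess, Finset.mul_sum, mul_assoc]

theorem fderiv_fst_single (hψ : ContDiff ℝ ∞ ψ) (x y θ : Fin (d + 1) → ℝ) (j : Fin (d + 1)) :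
    fderiv ℝ (fun y => fderiv ℝ ψ (x, y) (θ, 0)) y (Pi.single j 1) =
      (θ ᵥ* mixedHess ψ (x, y)) j := by
  rw [fderiv_fderiv_fst hψ]
  simp [vecMul, dotProduct, Pi.single_apply]

theorem sum_fderiv_fst (hψ : ContDiff ℝ ∞ ψ) (e x y : Fin (d + 1) → ℝ) :
    ∑ i, e i * fderiv ℝ (fun x => ψ (x, y)) x (Pi.single i 1) = fderiv ℝ ψ (x, y) (e, 0) := by
  simp_rw [fderiv_fst_slice hψ, ← fderiv_fst_eq_sum]

end MixedHessian

section LocalKernel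

open Matrix

variable {d : ℕ} {ψ : (Fin (d + 1) → ℝ) × (Fin (d + 1) → ℝ) → ℝ}

theorem exists_local_ttKernel_le (hd : 0 < d) (hψ : ContDiff ℝ ∞ ψ)
    {q : (Fin (d + 1) → ℝ) × (Fin (d + 1) → ℝ)}
    {U : Set ((Fin (d + 1) → ℝ) × (Fin (d + 1) → ℝ))} (hU : IsOpen U) (hqU : q ∈ closure U)
    (hdet : ∀ p ∈ U, (mixedHess ψ p).det = 0) (hrank : (mixedHess ψ q).rank = d)
    (hcurv : ∀ e : Fin (d + 1) → ℝ, ∑ i, e i ^ 2 = 1 → e ᵥ* mixedHess ψ q = 0 →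
      (dirHess ψ q e).rank = d) :
    ∃ i₀ : Fin (d + 1), ∃ ε > 0, ∀ b : (Fin (d + 1) → ℝ) × (Fin (d + 1) → ℝ) → ℂ,
      ContDiff ℝ ∞ b → HasCompactSupport b → tsupport b ⊆ Metric.ball q ε →
      ∃ C, 0 ≤ C ∧ ∀ lam, 0 ≤ lam → ∀ x x',
        (x i₀ = x' i₀ → ‖ttKernel ψ b lam x x'‖ ≤
          C * (1 + lam * ‖x - x'‖) ^ (-((d : ℝ) + 1))) ∧
        ‖ttKernel ψ b lam x x'‖ ≤ C * (1 + lam * ‖x - x'‖) ^ (-((d : ℝ) / 2)) := by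
  obtain ⟨x₀, y₀⟩ := q
  set M := mixedHess ψ (x₀, y₀) with hM
  obtain ⟨v, hv, hMv, hker⟩ := exists_ker_of_rank_eq hrank
  obtain ⟨e, he, heM, hker'⟩ := exists_ker_of_rank_eq (A := Mᵀ) (by rw [rank_transpose, hrank])
  rw [mulVec_transpose] at heM
  simp only [mulVec_transpose] at hker'
  obtain ⟨i₀, hi₀⟩ := Function.ne_iff.1 he
  obtain ⟨j₀, hj₀⟩ := Function.ne_iff.1 hv
  simp only [Pi.zero_apply] at hi₀ hj₀
  have hins : j₀.insertNth (α := fun _ => ℝ) (y₀ j₀) (j₀.removeNth (α := fun _ => ℝ) y₀) = y₀ :=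
    Fin.insertNth_self_removeNth j₀ y₀
  have hNS : ∀ m θ, θ ᵥ* M ≠ 0 → DecaysAt (polarPhase ψ j₀) m
      ((x₀, 0, θ, y₀ j₀), j₀.removeNth (α := fun _ => ℝ) y₀) := by
    intro m θ hθ
    refine decaysAt_of_pderivSnd_ne (contDiff_polarPhase hψ j₀) m ?_
    obtain ⟨j, hj⟩ := exists_succAbove_ne_zero hj₀ hθ
      (by rw [← dotProduct_mulVec, hMv, dotProduct_zero])
    refine ⟨j, ?_⟩
    rw [pderivSnd_polarPhase hψ, hins, fderiv_fst_single hψ]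
    exact hj
  have hSQ : ∀ θ, θ ≠ 0 → θ ᵥ* M = 0 → DecaysAt (polarPhase ψ j₀) ((d : ℝ) / 2)
      ((x₀, 0, θ, y₀ j₀), j₀.removeNth (α := fun _ => ℝ) y₀) := by
    intro θ hθ hθM
    refine decaysAt_of_hessian_nondegenerate (contDiff_polarPhase hψ j₀) hd fun w hw => ?_
    simp_rw [pderivSnd_fderiv_polarPhase hψ, hins, fderiv_fderiv_fst_single hψ]
    set H := dirHess ψ (x₀, y₀) θ with hH
    have hHr : H.rank = d := by
      set s := √(∑ i, θ i ^ 2) with hs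
      have hpos : 0 < ∑ i, θ i ^ 2 := by
        obtain ⟨i, hi⟩ := Function.ne_iff.1 hθ
        exact Finset.sum_pos' (fun i _ => sq_nonneg _)
          ⟨i, Finset.mem_univ i, by have : θ i ≠ 0 := hi
                                    positivity⟩
      have hs0 : s ≠ 0 := (Real.sqrt_pos.2 hpos).ne'
      have h1 := hcurv (s⁻¹ • θ) (by
        simp only [Pi.smul_apply, smul_eq_mul, mul_pow, ← Finset.mul_sum]
        rw [inv_pow, hs, Real.sq_sqrt hpos.le, inv_mul_cancel₀ hpos.ne'])
        (by rw [smul_vecMul, hθM, smul_zero])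
      rw [dirHess_smul] at h1
      rwa [rank_smul_of_mem_nonZeroDivisors _
        (mem_nonZeroDivisors_of_ne_zero (inv_ne_zero hs0))] at h1
    have hHv : H *ᵥ v = 0 := by
      ext j
      rw [dirHess_mulVec_apply]
      exact sum_fderiv_eq_zero_of_det_eq_zero (fun i k => contDiff_mixedHess hψ i k) hU hdet hqU
        hθ hv hθM hMv hker _
    obtain ⟨v', hv', hHv', hkerH⟩ := exists_ker_of_rank_eq hHr
    have hw' : insertZero j₀ w ≠ 0 := by
      intro h0
      apply hw
      ext j
      have := congrFun h0 (j₀.succAbove j)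
      simpa using this
    have hHw : H *ᵥ insertZero j₀ w ≠ 0 := by
      intro h0
      obtain ⟨c, hc⟩ := hkerH _ h0
      obtain ⟨c', hc'⟩ := hkerH _ hHv
      have h1 := congrFun hc j₀
      simp only [insertZero_apply, Fin.insertNth_apply_same, Pi.smul_apply, smul_eq_mul] at h1
      have h2 : v' j₀ ≠ 0 := by
        intro h0
        apply hj₀
        rw [hc']
        simp [h0]
      have h3 : c = 0 := by
        rcases mul_eq_zero.1 h1.symm with h | h
        · exact h
        · exact absurd h h2
      rw [h3, zero_smul] at hc
      exact hw' hc
    refine exists_succAbove_ne_zero hj₀ hHw ?_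
    rw [dotProduct_comm, dotProduct_mulVec, ← mulVec_transpose, hH, dirHess_transpose hψ, ← hH,
      hHv, zero_dotProduct]
  have hdec : ∀ θ, θ ≠ 0 → DecaysAt (polarPhase ψ j₀) ((d : ℝ) / 2)
      ((x₀, 0, θ, y₀ j₀), j₀.removeNth (α := fun _ => ℝ) y₀) := by
    intro θ hθ
    by_cases h : θ ᵥ* M = 0
    · exact hSQ θ hθ h
    · exact hNS _ θ h
  let S : Set (Fin (d + 1) → ℝ) := Metric.sphere 0 1
  let S₀ : Set (Fin (d + 1) → ℝ) := S ∩ {θ | θ i₀ = 0}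
  have hS : IsCompact S := isCompact_sphere _ _
  have hS₀ : IsCompact S₀ := hS.inter_right (isClosed_eq (continuous_apply i₀) continuous_const)
  have hne : ∀ θ ∈ S, θ ≠ 0 := by
    rintro θ hθ rfl
    simp [S] at hθ
  have hne₀ : ∀ θ ∈ S₀, θ ᵥ* M ≠ 0 := by
    rintro θ ⟨hθ, hθ₀⟩ h0
    obtain ⟨c, rfl⟩ := hker' θ h0
    have : c = 0 := by
      rcases mul_eq_zero.1 hθ₀ with h | h
      · exact h
      · exact absurd h hi₀
    exact hne _ hθ (by simp [this])
  obtain ⟨ε₁, hε₁, hb₁⟩ := exists_ttKernel_le hψ j₀ hS x₀ y₀ ((d : ℝ) / 2)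
    (fun θ hθ => hdec θ (hne θ hθ)) (fun θ hθ => mem_sphere_zero_iff_norm.1 hθ)
  obtain ⟨ε₂, hε₂, hb₂⟩ := exists_ttKernel_le hψ j₀ hS₀ x₀ y₀ ((d : ℝ) + 1)
    (fun θ hθ => hNS _ θ (hne₀ θ hθ)) (fun θ hθ => mem_sphere_zero_iff_norm.1 hθ.1)
  refine ⟨i₀, min ε₁ ε₂, lt_min hε₁ hε₂, fun b hb hbs hbt => ?_⟩
  obtain ⟨C₁, hC₁, h₁⟩ := hb₁ b hb hbs (hbt.trans (Metric.ball_subset_ball (min_le_left _ _)))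
  obtain ⟨C₂, hC₂, h₂⟩ := hb₂ b hb hbs (hbt.trans (Metric.ball_subset_ball (min_le_right _ _)))
  refine ⟨max C₁ C₂, le_max_of_le_left hC₁, fun lam hlam x x' => ?_⟩
  have hpolar : ∃ θ ∈ S, x = x' + ‖x - x'‖ • θ ∧ (x i₀ = x' i₀ → θ i₀ = 0) := by
    by_cases hx : x = x'
    · have : Nontrivial (Fin (d + 1)) := Fin.nontrivial_iff_two_le.2 (by omega)
      obtain ⟨i, hi⟩ := exists_ne i₀
      refine ⟨Pi.single i 1, by simp [S, Pi.norm_single], by simp [hx], fun _ => ?_⟩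
      simp [hi.symm]
    · have hn : ‖x - x'‖ ≠ 0 := norm_ne_zero_iff.2 (sub_ne_zero.2 hx)
      refine ⟨‖x - x'‖⁻¹ • (x - x'), ?_, ?_, fun h => ?_⟩
      · rw [mem_sphere_zero_iff_norm, norm_smul, norm_inv, norm_norm, inv_mul_cancel₀ hn]
      · rw [smul_smul, mul_inv_cancel₀ hn, one_smul, add_sub_cancel]
      · simp [h]
  obtain ⟨θ, hθ, hxθ, hθ₀⟩ := hpolar
  constructor
  · intro hx
    have := h₂ lam hlam x' ‖x - x'‖ θ (norm_nonneg _) ⟨hθ, hθ₀ hx⟩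
    rw [← hxθ] at this
    exact this.trans (mul_le_mul_of_nonneg_right (le_max_right _ _) (by positivity))
  · have := h₁ lam hlam x' ‖x - x'‖ θ (norm_nonneg _) hθ
    rw [← hxθ] at this
    exact this.trans (mul_le_mul_of_nonneg_right (le_max_left _ _) (by positivity))

end LocalKernel

section AnalyticFamily

variable {α : Type*} [MeasurableSpace α] {μ : Measure α} [IsFiniteMeasure μ] {A b : α → ℂ}
  {CA Cb : ℝ}

theorem norm_mul_exp_le {A b z : ℂ} {CA Cb : ℝ} (hA : ‖A‖ ≤ CA) (hb : ‖b‖ ≤ Cb) :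
    ‖A * Complex.exp (z * b)‖ ≤ CA * Real.exp (‖z‖ * Cb) := by
  rw [norm_mul]
  have h0 : 0 ≤ CA := (norm_nonneg _).trans hA
  gcongr
  refine (Complex.norm_exp_le_exp_norm _).trans (Real.exp_le_exp.2 ?_)
  rw [norm_mul]
  gcongr

theorem norm_integral_mul_exp_le (hAb : ∀ᵐ q ∂μ, ‖A q‖ ≤ CA) (hbb : ∀ᵐ q ∂μ, ‖b q‖ ≤ Cb) (z : ℂ) :
    ‖∫ q, A q * Complex.exp (z * b q) ∂μ‖ ≤ CA * Real.exp (‖z‖ * Cb) * μ.real univ := by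
  refine norm_integral_le_of_norm_le_const ?_
  filter_upwards [hAb, hbb] with q h1 h2 using norm_mul_exp_le h1 h2

theorem differentiable_integral_mul_exp (hA : AEStronglyMeasurable A μ)
    (hb : AEStronglyMeasurable b μ) (hAb : ∀ᵐ q ∂μ, ‖A q‖ ≤ CA) (hbb : ∀ᵐ q ∂μ, ‖b q‖ ≤ Cb) :
    Differentiable ℂ fun z : ℂ => ∫ q, A q * Complex.exp (z * b q) ∂μ := by
  intro z₀
  have hmeas : ∀ z : ℂ, AEStronglyMeasurable (fun q => A q * Complex.exp (z * b q)) μ := fun z =>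
    hA.mul (Complex.continuous_exp.comp_aestronglyMeasurable (hb.const_mul z))
  refine (hasDerivAt_integral_of_dominated_loc_of_deriv_le (μ := μ) (𝕜 := ℂ)
    (F := fun z q => A q * Complex.exp (z * b q))
    (F' := fun z q => A q * (Complex.exp (z * b q) * b q))
    (bound := fun _ => CA * Real.exp ((‖z₀‖ + 1) * Cb) * Cb) (x₀ := z₀)
    (Metric.ball_mem_nhds z₀ one_pos) (Eventually.of_forall hmeas) ?_ ?_ ?_
    (integrable_const _) ?_).2.differentiableAt
  · refine Integrable.of_bound (hmeas z₀) (CA * Real.exp (‖z₀‖ * Cb)) ?_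
    filter_upwards [hAb, hbb] with q h1 h2 using norm_mul_exp_le h1 h2
  · have := (hmeas z₀).mul hb
    refine this.congr (Eventually.of_forall fun q => ?_)
    simp [mul_assoc]
  · filter_upwards [hAb, hbb] with q h1 h2 z hz
    rw [← mul_assoc, norm_mul]
    have h0 : 0 ≤ CA := (norm_nonneg _).trans h1
    have h0' : 0 ≤ Cb := (norm_nonneg _).trans h2
    have hz' : ‖z‖ ≤ ‖z₀‖ + 1 := by
      have := norm_le_norm_add_norm_sub' z z₀
      have := (mem_ball_iff_norm.1 hz).le
      linarith
    refine mul_le_mul ((norm_mul_exp_le h1 h2).trans ?_) h2 (norm_nonneg _) (by positivity)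
    gcongr
  · filter_upwards with q z _
    have : HasDerivAt (fun z => z * b q) (b q) z := by simpa using (hasDerivAt_id z).mul_const (b q)
    exact this.cexp.const_mul (A q)

end AnalyticFamily

section GammaBound

theorem norm_sinh_div_le (x : ℝ) : |Real.sinh x| ≤ |x| * Real.exp |x| := by
  wlog hx : 0 ≤ x generalizing x
  · have := this (-x) (by linarith)
    simpa using this
  rw [abs_of_nonneg hx, abs_of_nonneg (Real.sinh_nonneg_iff.2 hx), Real.sinh_eq]
  have h1 : 1 - 2 * x ≤ Real.exp (-(2 * x)) := by
    have := Real.add_one_le_exp (-(2 * x)); linarith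
  have h2 : Real.exp (-x) = Real.exp x * Real.exp (-(2 * x)) := by
    rw [← Real.exp_add]; ring_nf
  rw [h2]
  nlinarith [Real.exp_pos x]

theorem norm_Gamma_one_add_I_mul_inv_le (τ : ℝ) :
    ‖(Complex.Gamma (1 + Complex.I * τ))‖⁻¹ ≤ Real.exp (π * |τ|) := by
  rcases eq_or_ne τ 0 with rfl | hτ
  · simp
  set s : ℂ := Complex.I * τ with hs
  have hs0 : s ≠ 0 := by simp [hs, hτ]
  have h1 : Complex.Gamma (1 + s) = s * Complex.Gamma s := by
    rw [add_comm, Complex.Gamma_add_one _ hs0]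
  have hconj : 1 - s = (starRingEnd ℂ) (1 + s) := by simp [hs, sub_eq_add_neg]
  have h2 := Complex.Gamma_mul_Gamma_one_sub s
  have hsin : Complex.sin (π * s) = Real.sinh (π * τ) * Complex.I := by
    rw [hs, show (π : ℂ) * (Complex.I * τ) = ((π * τ : ℝ) : ℂ) * Complex.I by push_cast; ring,
      Complex.sin_mul_I]
    simp
  have hprod : ‖Complex.Gamma (1 + s)‖ ^ 2 * |Real.sinh (π * τ)| = π * |τ| := by
    have h3 : Complex.Gamma (1 + s) * Complex.Gamma (1 - s) = s * (π / Complex.sin (π * s)) := by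
      rw [h1, mul_assoc, h2]
    have h4 := congrArg norm h3
    rw [hconj, Complex.Gamma_conj, norm_mul, Complex.norm_conj, hsin] at h4
    have hsh : |Real.sinh (π * τ)| ≠ 0 := by
      simp [Real.sinh_eq_zero, hτ, Real.pi_ne_zero]
    simp only [norm_mul, norm_div, hs, Complex.norm_I, Complex.norm_real, Real.norm_eq_abs,
      one_mul, mul_one, abs_of_pos Real.pi_pos] at h4
    rw [hs, sq, h4]
    field_simp
  have hle := norm_sinh_div_le (π * τ)
  rw [abs_mul, abs_of_pos Real.pi_pos] at hle
  have hpos : 0 < π * |τ| := by positivity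
  have hG : 0 < ‖Complex.Gamma (1 + s)‖ := by
    rw [norm_pos_iff]; intro h; rw [h] at hprod; simp at hprod; exact hτ hprod
  have h5 : 1 ≤ ‖Complex.Gamma (1 + s)‖ ^ 2 * Real.exp (π * |τ|) := by
    have : π * |τ| ≤ (‖Complex.Gamma (1 + s)‖ ^ 2 * Real.exp (π * |τ|)) * (π * |τ|) := by
      calc π * |τ| = ‖Complex.Gamma (1 + s)‖ ^ 2 * |Real.sinh (π * τ)| := hprod.symm
        _ ≤ ‖Complex.Gamma (1 + s)‖ ^ 2 * (π * |τ| * Real.exp (π * |τ|)) := by gcongr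
        _ = _ := by ring
    exact le_of_mul_le_mul_right (by simpa using this) hpos
  rw [inv_le_iff_one_le_mul₀ hG]
  have h6 : 1 ≤ Real.exp (π * |τ|) := Real.one_le_exp hpos.le
  by_contra! h7
  have h8 : ‖Complex.Gamma (1 + s)‖ < 1 := by nlinarith
  nlinarith

end GammaBound

section BoundedMeasurable

variable {α β E : Type*} [MeasurableSpace α] [MeasurableSpace β] [NormedAddCommGroup E]
  [MeasurableSpace E]

/-- Bounded measurable functions. -/
structure BddMeas (f : α → E) : Prop where
  measurable : Measurable f
  exists_bound : ∃ C, ∀ x, ‖f x‖ ≤ C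

namespace BddMeas

theorem comp {f : α → E} (hf : BddMeas f) {g : β → α} (hg : Measurable g) :
    BddMeas fun x => f (g x) :=
  ⟨hf.measurable.comp hg, hf.exists_bound.imp fun _ hC x => hC (g x)⟩

theorem const (c : E) : BddMeas fun _ : α => c := ⟨measurable_const, ‖c‖, fun _ => le_rfl⟩

variable [BorelSpace E]

theorem norm {f : α → E} (hf : BddMeas f) : BddMeas fun x => ‖f x‖ :=
  ⟨hf.measurable.norm, hf.exists_bound.imp fun _ hC x => by simpa using hC x⟩

variable [SecondCountableTopology E]

theorem integrable {f : α → E} (hf : BddMeas f) (μ : Measure α) [IsFiniteMeasure μ] :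
    Integrable f μ := by
  obtain ⟨C, hC⟩ := hf.exists_bound
  exact Integrable.of_bound hf.measurable.aestronglyMeasurable C (Eventually.of_forall hC)

theorem add {f g : α → E} (hf : BddMeas f) (hg : BddMeas g) : BddMeas fun x => f x + g x := by
  obtain ⟨C, hC⟩ := hf.exists_bound
  obtain ⟨D, hD⟩ := hg.exists_bound
  exact ⟨hf.measurable.add hg.measurable, C + D, fun x => (norm_add_le _ _).trans
    (add_le_add (hC x) (hD x))⟩

theorem sum {ι : Type*} (s : Finset ι) {f : ι → α → E} (hf : ∀ i ∈ s, BddMeas (f i)) :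
    BddMeas fun x => ∑ i ∈ s, f i x := by
  classical
  induction s using Finset.induction_on with
  | empty => simpa using const (0 : E)
  | insert i s hi ih =>
    simp only [Finset.sum_insert hi]
    exact (hf i (by simp)).add (ih fun j hj => hf j (by simp [hj]))

variable {R : Type*} [NormedRing R] [MeasurableSpace R] [BorelSpace R] [SecondCountableTopology R]

theorem mul {f g : α → R} (hf : BddMeas f) (hg : BddMeas g) :
    BddMeas fun x => f x * g x := by
  obtain ⟨C, hC⟩ := hf.exists_bound
  obtain ⟨D, hD⟩ := hg.exists_bound
  exact ⟨hf.measurable.mul hg.measurable, C * D, fun x => (norm_mul_le _ _).trans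
    (mul_le_mul (hC x) (hD x) (norm_nonneg _) ((norm_nonneg _).trans (hC x)))⟩

theorem pow {f : α → R} (hf : BddMeas f) (n : ℕ) : BddMeas fun x => f x ^ n := by
  induction n with
  | zero => simpa using const (1 : R)
  | succ n ih => simpa only [pow_succ] using ih.mul hf

theorem conj {f : α → ℂ} (hf : BddMeas f) : BddMeas fun x => (starRingEnd ℂ) (f x) :=
  ⟨Complex.continuous_conj.measurable.comp hf.measurable,
    hf.exists_bound.imp fun _ hC x => by simpa using hC x⟩

theorem integral_prod_right [NormedSpace ℝ E] {f : α → β → E}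
    (hf : BddMeas (Function.uncurry f)) (μ : Measure β) [IsFiniteMeasure μ] :
    BddMeas fun x => ∫ y, f x y ∂μ := by
  obtain ⟨C, hC⟩ := hf.exists_bound
  refine ⟨(hf.measurable.stronglyMeasurable.integral_prod_right).measurable, C * μ.real univ,
    fun x => norm_integral_le_of_norm_le_const (Eventually.of_forall fun y => hC (x, y))⟩

theorem integrable_mul {f g : α → R} (hf : BddMeas f) {μ : Measure α} (hg : Integrable g μ) :
    Integrable (fun x => f x * g x) μ := by
  obtain ⟨C, hC⟩ := hf.exists_bound
  exact hg.bdd_mul hf.measurable.aestronglyMeasurable (Eventually.of_forall hC)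

end BddMeas

theorem schur_test {μ : Measure α} [IsFiniteMeasure μ] {P : α → α → ℝ} {u : α → ℝ} {Γ : ℝ}
    (hP : BddMeas (Function.uncurry P)) (hu : BddMeas u) (hP0 : ∀ x y, 0 ≤ P x y)
    (hsymm : ∀ x y, P x y = P y x) (hΓ : ∀ x, ∫ y, P x y ∂μ ≤ Γ) :
    ∫ x, ∫ y, u x * P x y * u y ∂μ ∂μ ≤ Γ * ∫ x, u x ^ 2 ∂μ := by
  have hb1 : BddMeas (Function.uncurry fun x y => u x * P x y * u y) :=
    ((hu.comp measurable_fst).mul hP).mul (hu.comp measurable_snd)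
  have hb2 : BddMeas (Function.uncurry fun x y => u x ^ 2 * P x y) :=
    ((hu.comp measurable_fst).pow 2).mul hP
  have hb3 : BddMeas (Function.uncurry fun x y => u y ^ 2 * P x y) :=
    ((hu.comp measurable_snd).pow 2).mul hP
  have h2 : ∫ x, ∫ y, u x ^ 2 * P x y ∂μ ∂μ ≤ Γ * ∫ x, u x ^ 2 ∂μ := by
    rw [← integral_const_mul]
    refine integral_mono ((hb2.integral_prod_right μ).integrable μ)
      (((hu.pow 2).integrable μ).const_mul Γ) fun x => ?_
    simp only
    rw [integral_const_mul, mul_comm]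
    exact mul_le_mul_of_nonneg_right (hΓ x) (sq_nonneg _)
  have h3 : ∫ x, ∫ y, u y ^ 2 * P x y ∂μ ∂μ = ∫ x, ∫ y, u x ^ 2 * P x y ∂μ ∂μ := by
    rw [integral_integral_swap (hb3.integrable (μ.prod μ))]
    simp_rw [hsymm]

  rw [integral_integral (hb1.integrable (μ.prod μ))]
  rw [integral_integral (hb2.integrable (μ.prod μ))] at h2 h3
  rw [integral_integral (hb3.integrable (μ.prod μ))] at h3
  calc _ ≤ ∫ z, ((1/2) * (u z.1 ^ 2 * P z.1 z.2) + (1/2) * (u z.2 ^ 2 * P z.1 z.2))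
          ∂(μ.prod μ) := by
        refine integral_mono (hb1.integrable (μ.prod μ))
          (((hb2.integrable (μ.prod μ)).const_mul _).add ((hb3.integrable (μ.prod μ)).const_mul _))
          fun z => ?_
        simp only
        nlinarith [mul_nonneg (sq_nonneg (u z.1 - u z.2)) (hP0 z.1 z.2)]
    _ = _ := integral_add ((hb2.integrable (μ.prod μ)).const_mul _)
          ((hb3.integrable (μ.prod μ)).const_mul _)
    _ ≤ _ := by
      rw [integral_const_mul, integral_const_mul, h3]
      linarith

end BoundedMeasurable

section LaplaceGamma

theorem norm_cpow_I_mul {s : ℝ} (hs : 0 < s) (τ : ℝ) : ‖(s : ℂ) ^ (Complex.I * τ)‖ = 1 := by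
  rw [Complex.norm_cpow_eq_rpow_re_of_pos hs]; simp

theorem measurable_cpow_I_mul (τ : ℝ) : Measurable fun s : ℝ => (s : ℂ) ^ (Complex.I * τ) :=
  Complex.measurable_ofReal.pow_const _

theorem norm_exp_neg_mul_ofReal (w : ℂ) (s : ℝ) :
    ‖Complex.exp (-(w * s))‖ = Real.exp (-w.re * s) := by
  rw [Complex.norm_exp]; simp

theorem integrableOn_cpow_mul_exp (τ : ℝ) {w : ℂ} (hw : 0 < w.re) :
    IntegrableOn (fun s : ℝ => (s : ℂ) ^ (Complex.I * τ) * Complex.exp (-(w * s))) (Ioi 0) := by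
  refine Integrable.mono' (exp_neg_integrableOn_Ioi 0 hw) ?_ ?_
  · exact ((measurable_cpow_I_mul τ).mul (by fun_prop)).aestronglyMeasurable
  · filter_upwards [ae_restrict_mem measurableSet_Ioi] with s hs
    rw [norm_mul, norm_cpow_I_mul hs, one_mul, norm_exp_neg_mul_ofReal]

theorem differentiableAt_integral_cpow_mul_exp (τ : ℝ) {w : ℂ} (hw : 0 < w.re) :
    DifferentiableAt ℂ (fun w : ℂ => ∫ s in Ioi (0 : ℝ),
      (s : ℂ) ^ (Complex.I * τ) * Complex.exp (-(w * s))) w := by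
  have hc : 0 < w.re / 4 := by positivity
  refine (hasDerivAt_integral_of_dominated_loc_of_deriv_le (μ := volume.restrict (Ioi (0 : ℝ)))
    (𝕜 := ℂ) (F := fun w s => (s : ℂ) ^ (Complex.I * τ) * Complex.exp (-(w * s)))
    (F' := fun w s => (s : ℂ) ^ (Complex.I * τ) * (Complex.exp (-(w * s)) * (-s)))
    (bound := fun s => (w.re / 4)⁻¹ * Real.exp (-(w.re / 4) * s)) (x₀ := w)
    (Metric.ball_mem_nhds w (ε := w.re / 2) (by positivity))
    (Eventually.of_forall fun z => ?_) (integrableOn_cpow_mul_exp τ hw) ?_ ?_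
    ((exp_neg_integrableOn_Ioi 0 hc).const_mul _) ?_).2.differentiableAt
  · exact ((measurable_cpow_I_mul τ).mul (by fun_prop)).aestronglyMeasurable
  · exact ((measurable_cpow_I_mul τ).mul (by fun_prop)).aestronglyMeasurable
  · filter_upwards [ae_restrict_mem measurableSet_Ioi] with s hs z hz
    have hs : (0 : ℝ) < s := hs
    rw [norm_mul, norm_mul, norm_cpow_I_mul hs, one_mul, norm_exp_neg_mul_ofReal, norm_neg,
      Complex.norm_real, Real.norm_eq_abs, abs_of_pos hs]
    have hz' : w.re / 2 ≤ z.re := by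
      have h1 := (Complex.abs_re_le_norm (z - w)).trans (mem_ball_iff_norm.1 hz).le
      rw [Complex.sub_re] at h1
      have := (abs_le.1 h1).1
      linarith
    have h2 : s ≤ (w.re / 4)⁻¹ * Real.exp (w.re / 4 * s) := by
      have := Real.add_one_le_exp (w.re / 4 * s)
      rw [inv_mul_eq_div, le_div_iff₀ hc]; linarith
    calc Real.exp (-z.re * s) * s ≤ Real.exp (-(w.re / 2) * s) *
          ((w.re / 4)⁻¹ * Real.exp (w.re / 4 * s)) := by
            gcongr
      _ = _ := by
        rw [mul_left_comm, ← Real.exp_add]; ring_nf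
  · filter_upwards with s z _
    have : HasDerivAt (fun z : ℂ => -(z * s)) (-s) z := by
      simpa using ((hasDerivAt_id z).mul_const (s : ℂ)).fun_neg
    exact this.cexp.const_mul _

theorem integral_cpow_mul_exp_neg (τ : ℝ) {w : ℂ} (hw : 0 < w.re) :
    ∫ s in Ioi (0 : ℝ), (s : ℂ) ^ (Complex.I * τ) * Complex.exp (-(w * s)) =
      Complex.exp (-(1 + Complex.I * τ) * Complex.log w) * Complex.Gamma (1 + Complex.I * τ) := by
  set U : Set ℂ := {w | 0 < w.re} with hU
  have hUo : IsOpen U := isOpen_lt continuous_const Complex.continuous_re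
  have hf : AnalyticOnNhd ℂ (fun w : ℂ => ∫ s in Ioi (0 : ℝ),
      (s : ℂ) ^ (Complex.I * τ) * Complex.exp (-(w * s))) U :=
    DifferentiableOn.analyticOnNhd
      (fun w hw => (differentiableAt_integral_cpow_mul_exp τ hw).differentiableWithinAt) hUo
  have hg : AnalyticOnNhd ℂ (fun w : ℂ => Complex.exp (-(1 + Complex.I * τ) * Complex.log w) *
      Complex.Gamma (1 + Complex.I * τ)) U := by
    refine DifferentiableOn.analyticOnNhd (fun w hw => ?_) hUo
    have : DifferentiableAt ℂ Complex.log w := Complex.differentiableAt_log (Or.inl hw)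
    exact ((this.const_mul _).cexp.mul_const _).differentiableWithinAt
  have hconv : Convex ℝ U := convex_halfSpace_re_gt 0
  refine hf.eqOn_of_preconnected_of_frequently_eq hg hconv.isPreconnected
    (z₀ := 1) (by simp [hU]) ?_ hw
  have hreal : ∀ r : ℝ, 0 < r → (∫ s in Ioi (0 : ℝ),
      (s : ℂ) ^ (Complex.I * τ) * Complex.exp (-((r : ℂ) * s))) =
      Complex.exp (-(1 + Complex.I * τ) * Complex.log r) *
        Complex.Gamma (1 + Complex.I * τ) := by
    intro r hr
    have h := Complex.integral_cpow_mul_exp_neg_mul_Ioi (a := 1 + Complex.I * τ) (r := r)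
      (by simp) hr
    rw [add_sub_cancel_left] at h
    rw [h, one_div, Complex.inv_cpow _ _ (by
      rw [Complex.arg_ofReal_of_nonneg hr.le]; exact Real.pi_pos.ne),
      Complex.cpow_def_of_ne_zero (by exact_mod_cast hr.ne'), ← Complex.exp_neg]
    congr 2; ring
  have hseq : Tendsto (fun n : ℕ => ((1 + 1 / ((n : ℝ) + 1) : ℝ) : ℂ)) atTop (𝓝[≠] 1) := by
    refine tendsto_nhdsWithin_iff.2 ⟨?_, Eventually.of_forall fun n => ?_⟩
    · have h := (tendsto_one_div_add_atTop_nhds_zero_nat (𝕜 := ℝ)).const_add 1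
      rw [add_zero] at h
      exact_mod_cast (Complex.continuous_ofReal.tendsto _).comp h
    · have : (1 + 1 / ((n : ℝ) + 1) : ℝ) ≠ 1 := by
        have : 0 < 1 / ((n : ℝ) + 1) := by positivity
        linarith
      simpa only [mem_compl_iff, mem_singleton_iff, Complex.ofReal_eq_one] using this
  refine hseq.frequently (Frequently.of_forall fun n => ?_)
  exact hreal _ (by positivity)

end LaplaceGamma

section Fourier

variable {ρ : Measure ℝ} [IsFiniteMeasure ρ]

/-- The Fourier transform of `h` with respect to the measure `ρ`. -/
noncomputable def fourierAt (ρ : Measure ℝ) (h : ℝ → ℂ) (s : ℝ) : ℂ :=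
  ∫ t, Complex.exp (Complex.I * (s * t : ℝ)) * h t ∂ρ

theorem bddMeas_exp_I_mul {α : Type*} [MeasurableSpace α] {g : α → ℝ} (hg : Measurable g) :
    BddMeas fun x => Complex.exp (Complex.I * (g x : ℝ)) :=
  ⟨by fun_prop, 1, fun x => (norm_exp_I_mul_ofReal' _).le⟩

theorem bddMeas_fourierAt {h : ℝ → ℂ} (hh : BddMeas h) : BddMeas (fourierAt ρ h) :=
  BddMeas.integral_prod_right (f := fun s t => Complex.exp (Complex.I * (s * t : ℝ)) * h t)
    ((bddMeas_exp_I_mul (by fun_prop)).mul (hh.comp measurable_snd)) ρ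

theorem conj_fourierAt_mul {h₁ h₂ : ℝ → ℂ} (s : ℝ) :
    (starRingEnd ℂ) (fourierAt ρ h₁ s) * fourierAt ρ h₂ s =
      ∫ p : ℝ × ℝ, Complex.exp (-(Complex.I * (s * (p.1 - p.2) : ℝ))) *
        ((starRingEnd ℂ) (h₁ p.1) * h₂ p.2) ∂(ρ.prod ρ) := by
  unfold fourierAt
  rw [← integral_conj, ← integral_prod_mul]
  congr 1; ext p
  rw [map_mul, ← Complex.exp_conj, mul_mul_mul_comm, ← Complex.exp_add]
  congr 2
  simp; ring

theorem integral_cauchy_kernel_le {ρ : Measure ℝ} {ε : ℝ} (hε : 0 < ε) (hρ : ρ ≤ volume) (t : ℝ) :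
    ∫ r, 2 * ε / (ε ^ 2 + (t - r) ^ 2) ∂ρ ≤ 2 * π := by
  have key : ∀ r : ℝ, 2 * ε / (ε ^ 2 + (t - r) ^ 2) = (2 / ε) * (1 + (ε⁻¹ * (t - r)) ^ 2)⁻¹ := by
    intro r; field_simp
  have hInt : Integrable (fun r : ℝ => (2 / ε) * (1 + (ε⁻¹ * (t - r)) ^ 2)⁻¹) :=
    ((integrable_inv_one_add_sq.comp_mul_left' (inv_ne_zero hε.ne')).comp_sub_left t).const_mul _
  simp_rw [key]
  refine (integral_mono_measure hρ (Eventually.of_forall fun r => by positivity) hInt).trans ?_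
  rw [integral_const_mul, integral_sub_left_eq_self (fun r => (1 + (ε⁻¹ * r) ^ 2)⁻¹),
    Measure.integral_comp_mul_left (fun r => (1 + r ^ 2)⁻¹), integral_univ_inv_one_add_sq]
  simp only [inv_inv, abs_of_pos hε, smul_eq_mul]
  field_simp; exact le_rfl

theorem integral_exp_add_exp {ε : ℝ} (hε : 0 < ε) (r : ℝ) :
    ∫ s in Ioi (0 : ℝ), (Complex.exp (-(ε + Complex.I * r) * s) +
      Complex.exp (-(ε - Complex.I * r) * s)) = ((2 * ε / (ε ^ 2 + r ^ 2) : ℝ) : ℂ) := by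
  have h1 : (-((ε : ℂ) + Complex.I * r)).re < 0 := by simpa using hε
  have h2 : (-((ε : ℂ) - Complex.I * r)).re < 0 := by simpa using hε
  have n1 : ((ε : ℂ) + Complex.I * r) ≠ 0 := fun h => by rw [h] at h1; simp at h1
  have n2 : ((ε : ℂ) - Complex.I * r) ≠ 0 := fun h => by rw [h] at h2; simp at h2
  rw [integral_add (integrableOn_exp_mul_complex_Ioi h1 0) (integrableOn_exp_mul_complex_Ioi h2 0),
    integral_exp_mul_complex_Ioi h1, integral_exp_mul_complex_Ioi h2]
  have h3 : ((ε : ℂ) ^ 2 + (r : ℂ) ^ 2) = (ε + Complex.I * r) * (ε - Complex.I * r) := by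
    ring_nf; simp
  push_cast
  rw [h3]
  simp only [mul_zero, Complex.exp_zero]
  field_simp
  ring

theorem integrable_exp_neg_mul_bddMeas {α : Type*} [MeasurableSpace α] {κ : Measure α}
    [IsFiniteMeasure κ] {ε : ℝ} (hε : 0 < ε) {F : ℝ × α → ℂ} (hF : Measurable F)
    {C : ℝ} (hFC : ∀ s > 0, ∀ x, ‖F (s, x)‖ ≤ C * Real.exp (-ε * s)) :
    Integrable F ((volume.restrict (Ioi (0 : ℝ))).prod κ) := by
  have h0 : Integrable (fun s => C * Real.exp (-ε * s)) (volume.restrict (Ioi (0 : ℝ))) :=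
    (exp_neg_integrableOn_Ioi 0 hε).const_mul C
  refine (h0.comp_fst κ).mono' hF.aestronglyMeasurable ?_
  have : ∀ᵐ p ∂((volume.restrict (Ioi (0 : ℝ))).prod κ), p.1 ∈ Ioi (0 : ℝ) :=
    Measure.quasiMeasurePreserving_fst.ae (ae_restrict_mem measurableSet_Ioi)
  filter_upwards [this] with p hp using hFC p.1 hp p.2

theorem integrableOn_exp_mul_norm_fourierAt_sq {ε : ℝ} (hε : 0 < ε) {h : ℝ → ℂ} (hh : BddMeas h) :
    IntegrableOn (fun s => Real.exp (-ε * s) * ‖fourierAt ρ h s‖ ^ 2) (Ioi 0) := by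
  simp_rw [mul_comm (Real.exp _)]
  exact ((bddMeas_fourierAt hh).norm.pow 2).integrable_mul (exp_neg_integrableOn_Ioi 0 hε)

theorem integral_exp_mul_norm_fourierAt_sq_le {ε : ℝ} (hε : 0 < ε) (hρ : ρ ≤ volume) {h : ℝ → ℂ}
    (hh : BddMeas h) :
    ∫ s in Ioi (0 : ℝ), Real.exp (-ε * s) * ‖fourierAt ρ h s‖ ^ 2 ≤ 2 * π * ∫ t, ‖h t‖ ^ 2 ∂ρ := by
  set g : ℝ × ℝ → ℂ := fun p => (starRingEnd ℂ) (h p.1) * h p.2 with hg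
  have hgb : BddMeas g := (hh.comp measurable_fst).conj.mul (hh.comp measurable_snd)
  have hneg : IntegrableOn (fun s => Real.exp (-ε * s) * ‖fourierAt ρ h (-s)‖ ^ 2) (Ioi 0) := by
    simp_rw [mul_comm (Real.exp _)]
    exact (((bddMeas_fourierAt hh).comp measurable_neg).norm.pow 2).integrable_mul
      (exp_neg_integrableOn_Ioi 0 hε)
  have hpos := integrableOn_exp_mul_norm_fourierAt_sq (ρ := ρ) hε hh
  have hle : ∫ s in Ioi (0 : ℝ), Real.exp (-ε * s) * ‖fourierAt ρ h s‖ ^ 2 ≤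
      ∫ s in Ioi (0 : ℝ), (Real.exp (-ε * s) * ‖fourierAt ρ h s‖ ^ 2 +
        Real.exp (-ε * s) * ‖fourierAt ρ h (-s)‖ ^ 2) :=
    integral_mono hpos (hpos.add hneg) fun s => le_add_of_nonneg_right (by positivity)
  refine hle.trans ?_
  set H : ℝ → ℝ := fun s => Real.exp (-ε * s) * ‖fourierAt ρ h s‖ ^ 2 +
        Real.exp (-ε * s) * ‖fourierAt ρ h (-s)‖ ^ 2 with hH
  set Φ : ℝ × (ℝ × ℝ) → ℂ := fun q => (Complex.exp (-(ε + Complex.I * (q.2.1 - q.2.2 : ℝ)) * q.1) +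
      Complex.exp (-(ε - Complex.I * (q.2.1 - q.2.2 : ℝ)) * q.1)) * g q.2 with hΦ
  have hΦm : Measurable Φ :=
    Measurable.mul (by fun_prop) (hgb.measurable.comp measurable_snd)
  obtain ⟨C, hC⟩ := hgb.exists_bound
  have hΦi : Integrable Φ ((volume.restrict (Ioi (0 : ℝ))).prod (ρ.prod ρ)) := by
    refine integrable_exp_neg_mul_bddMeas hε hΦm (C := 2 * C) fun s hs p => ?_
    simp only [hΦ, norm_mul]
    have e1 : ‖Complex.exp (-(ε + Complex.I * (p.1 - p.2 : ℝ)) * s)‖ = Real.exp (-ε * s) := by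
      rw [Complex.norm_exp]; simp
    have e2 : ‖Complex.exp (-(ε - Complex.I * (p.1 - p.2 : ℝ)) * s)‖ = Real.exp (-ε * s) := by
      rw [Complex.norm_exp]; simp
    calc _ ≤ (Real.exp (-ε * s) + Real.exp (-ε * s)) * C := by
            refine mul_le_mul ((norm_add_le _ _).trans (by rw [e1, e2])) (hC p) (norm_nonneg _)
              (by positivity)
      _ = _ := by ring
  have hHs : ∀ s, ((H s : ℝ) : ℂ) = ∫ p, Φ (s, p) ∂(ρ.prod ρ) := by
    intro s
    have hsq : ∀ s', ((‖fourierAt ρ h s'‖ ^ 2 : ℝ) : ℂ) =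
        ∫ p : ℝ × ℝ, Complex.exp (-(Complex.I * (s' * (p.1 - p.2) : ℝ))) * g p ∂(ρ.prod ρ) := by
      intro s'
      rw [← conj_fourierAt_mul, mul_comm, Complex.mul_conj, Complex.normSq_eq_norm_sq]
    have hi : ∀ s' : ℝ, Integrable (fun p : ℝ × ℝ =>
        Complex.exp (-(Complex.I * (s' * (p.1 - p.2) : ℝ))) * g p) (ρ.prod ρ) := by
      intro s'
      have := ((bddMeas_exp_I_mul (g := fun p : ℝ × ℝ => -(s' * (p.1 - p.2))) (by fun_prop)).mul
        hgb).integrable (ρ.prod ρ)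
      simpa using this
    simp only [hH]
    push_cast
    have h1 := hsq s
    have h2 := hsq (-s)
    push_cast at h1 h2
    rw [h1, h2, ← mul_add, ← integral_add (by simpa using hi s) (by simpa using hi (-s)),
      ← integral_const_mul]
    congr 1; ext p
    simp only [hΦ]
    rw [← add_mul, ← mul_assoc, mul_add, ← Complex.exp_add, ← Complex.exp_add]
    congr 3 <;> · push_cast; ring_nf
  have hHc : ((∫ s in Ioi (0 : ℝ), H s : ℝ) : ℂ) =
      ∫ p : ℝ × ℝ, ((2 * ε / (ε ^ 2 + (p.1 - p.2) ^ 2) : ℝ) : ℂ) * g p ∂(ρ.prod ρ) := by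
    rw [← integral_complex_ofReal]
    simp_rw [hHs]
    rw [integral_integral_swap (f := fun s p => Φ (s, p)) hΦi]
    congr 1; ext p
    simp only [hΦ]
    rw [integral_mul_const, integral_exp_add_exp hε]
  have hH0 : 0 ≤ ∫ s in Ioi (0 : ℝ), H s := integral_nonneg fun s => by positivity
  have hPb : BddMeas (Function.uncurry fun t r : ℝ => 2 * ε / (ε ^ 2 + (t - r) ^ 2)) := by
    refine ⟨by unfold Function.uncurry; fun_prop, 2 * ε / ε ^ 2, fun p => ?_⟩
    rw [Real.norm_of_nonneg (by simp only [Function.uncurry]; positivity)]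
    simp only [Function.uncurry]
    gcongr
    nlinarith [sq_nonneg (p.1 - p.2)]
  have hschur := schur_test (μ := ρ) hPb hh.norm (fun x y => by positivity)
    (fun x y => by rw [← neg_sub y x, neg_sq]) (integral_cauchy_kernel_le hε hρ)
  rw [integral_integral (((hh.norm.comp measurable_fst).mul hPb).mul
    (hh.norm.comp measurable_snd) |>.integrable (ρ.prod ρ))] at hschur
  refine le_trans ?_ hschur
  have h3 := congrArg norm hHc
  rw [Complex.norm_real, Real.norm_of_nonneg hH0] at h3
  rw [h3]
  refine (norm_integral_le_integral_norm _).trans (le_of_eq ?_)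
  congr 1; ext p
  simp only [hg]
  rw [norm_mul, norm_mul, RCLike.norm_conj, Complex.norm_real,
    Real.norm_of_nonneg (by positivity)]
  ring

/-- The bilinear form with kernel `(ε + i(t - r))^{-1-iτ}` is bounded on `L²`. -/
theorem norm_integral_kernel_le {ε : ℝ} (hε : 0 < ε) (hρ : ρ ≤ volume) (τ : ℝ) {h₁ h₂ : ℝ → ℂ}
    (hh₁ : BddMeas h₁) (hh₂ : BddMeas h₂) :
    ‖∫ p : ℝ × ℝ, Complex.exp (-(1 + Complex.I * τ) *
        Complex.log (ε + Complex.I * (p.1 - p.2 : ℝ))) *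
        ((starRingEnd ℂ) (h₁ p.1) * h₂ p.2) ∂(ρ.prod ρ)‖ ≤
      π * Real.exp (π * |τ|) * (∫ t, ‖h₁ t‖ ^ 2 ∂ρ + ∫ t, ‖h₂ t‖ ^ 2 ∂ρ) := by
  set g : ℝ × ℝ → ℂ := fun p => (starRingEnd ℂ) (h₁ p.1) * h₂ p.2 with hg
  have hgb : BddMeas g := (hh₁.comp measurable_fst).conj.mul (hh₂.comp measurable_snd)
  set G := Complex.Gamma (1 + Complex.I * τ) with hG
  have hG0 : G ≠ 0 := Complex.Gamma_ne_zero_of_re_pos (by simp)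
  set Φ : ℝ × (ℝ × ℝ) → ℂ := fun q => ((q.1 : ℂ) ^ (Complex.I * τ) *
    Complex.exp (-((ε + Complex.I * (q.2.1 - q.2.2 : ℝ)) * q.1))) * g q.2 with hΦ
  have hΦm : Measurable Φ :=
    (((measurable_cpow_I_mul τ).comp measurable_fst).mul (by fun_prop)).mul
      (hgb.measurable.comp measurable_snd)
  obtain ⟨C, hC⟩ := hgb.exists_bound
  have hΦi : Integrable Φ ((volume.restrict (Ioi (0 : ℝ))).prod (ρ.prod ρ)) := by
    refine integrable_exp_neg_mul_bddMeas hε hΦm (C := C) fun s hs p => ?_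
    simp only [hΦ, norm_mul]
    rw [norm_cpow_I_mul hs, norm_exp_neg_mul_ofReal, one_mul, mul_comm]
    simp only [Complex.add_re, Complex.ofReal_re, Complex.mul_re, Complex.I_re, Complex.I_im,
      Complex.ofReal_im, zero_mul, mul_zero, sub_zero, add_zero]
    gcongr
    exact hC p
  have hmain : G * (∫ p : ℝ × ℝ, Complex.exp (-(1 + Complex.I * τ) *
        Complex.log (ε + Complex.I * (p.1 - p.2 : ℝ))) * g p ∂(ρ.prod ρ)) =
      ∫ s in Ioi (0 : ℝ), (s : ℂ) ^ (Complex.I * τ) * Complex.exp (-(ε * s)) *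
        ((starRingEnd ℂ) (fourierAt ρ h₁ s) * fourierAt ρ h₂ s) := by
    rw [← integral_const_mul]
    have e1 : ∀ p : ℝ × ℝ, G * (Complex.exp (-(1 + Complex.I * τ) *
        Complex.log (ε + Complex.I * (p.1 - p.2 : ℝ))) * g p) =
        ∫ s in Ioi (0 : ℝ), Φ (s, p) := by
      intro p
      simp only [hΦ]
      rw [integral_mul_const, integral_cpow_mul_exp_neg τ (by simpa using hε)]
      ring
    simp_rw [e1]
    rw [← integral_integral_swap (f := fun s p => Φ (s, p)) hΦi]
    congr 1; ext s
    rw [conj_fourierAt_mul, ← integral_const_mul]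
    congr 1; ext p
    simp only [hΦ]
    rw [mul_assoc, mul_assoc, ← mul_assoc (Complex.exp _) (Complex.exp _), ← Complex.exp_add]
    congr 3
    push_cast; ring_nf
  have hbound : ‖G * (∫ p : ℝ × ℝ, Complex.exp (-(1 + Complex.I * τ) *
        Complex.log (ε + Complex.I * (p.1 - p.2 : ℝ))) * g p ∂(ρ.prod ρ))‖ ≤
      π * (∫ t, ‖h₁ t‖ ^ 2 ∂ρ + ∫ t, ‖h₂ t‖ ^ 2 ∂ρ) := by
    rw [hmain]
    have i1 := integrableOn_exp_mul_norm_fourierAt_sq (ρ := ρ) hε hh₁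
    have i2 := integrableOn_exp_mul_norm_fourierAt_sq (ρ := ρ) hε hh₂
    calc _ ≤ ∫ s in Ioi (0 : ℝ), ((1 / 2) * (Real.exp (-ε * s) * ‖fourierAt ρ h₁ s‖ ^ 2) +
          (1 / 2) * (Real.exp (-ε * s) * ‖fourierAt ρ h₂ s‖ ^ 2)) := by
          refine norm_integral_le_of_norm_le ((i1.const_mul _).add (i2.const_mul _)) ?_
          filter_upwards [ae_restrict_mem measurableSet_Ioi] with s hs
          rw [norm_mul, norm_mul, norm_mul, norm_cpow_I_mul hs, norm_exp_neg_mul_ofReal,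
            RCLike.norm_conj, one_mul, Complex.ofReal_re]
          nlinarith [mul_nonneg (Real.exp_pos (-ε * s)).le
            (sq_nonneg (‖fourierAt ρ h₁ s‖ - ‖fourierAt ρ h₂ s‖))]
      _ ≤ _ := by
          rw [integral_add (i1.const_mul _) (i2.const_mul _), integral_const_mul,
            integral_const_mul]
          have j1 := integral_exp_mul_norm_fourierAt_sq_le (ρ := ρ) hε hρ hh₁
          have j2 := integral_exp_mul_norm_fourierAt_sq_le (ρ := ρ) hε hρ hh₂
          linarith
  rw [norm_mul] at hbound
  have hGp : 0 < ‖G‖ := norm_pos_iff.2 hG0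
  have hGi : ‖G‖⁻¹ ≤ Real.exp (π * |τ|) := norm_Gamma_one_add_I_mul_inv_le τ
  have hS : 0 ≤ π * (∫ t, ‖h₁ t‖ ^ 2 ∂ρ + ∫ t, ‖h₂ t‖ ^ 2 ∂ρ) := le_trans (by positivity) hbound
  calc _ ≤ ‖G‖⁻¹ * (π * (∫ t, ‖h₁ t‖ ^ 2 ∂ρ + ∫ t, ‖h₂ t‖ ^ 2 ∂ρ)) := by
        rw [inv_mul_eq_div, le_div_iff₀ hGp, mul_comm]; exact hbound
    _ ≤ Real.exp (π * |τ|) * (π * (∫ t, ‖h₁ t‖ ^ 2 ∂ρ + ∫ t, ‖h₂ t‖ ^ 2 ∂ρ)) := by gcongr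
    _ = _ := by ring

end Fourier

section PowerKernel

/-- The kernel `(ε + ir)^{-a}`. -/
noncomputable def powKernel (ε : ℝ) (a : ℂ) (r : ℝ) : ℂ :=
  Complex.exp (-a * Complex.log (ε + Complex.I * r))

theorem norm_exp_neg_mul_log_le {w : ℂ} (hw : w ≠ 0) (a : ℂ) :
    ‖Complex.exp (-a * Complex.log w)‖ ≤ ‖w‖ ^ (-a.re) * Real.exp (π * |a.im|) := by
  rw [Complex.norm_exp, Real.rpow_def_of_pos (norm_pos_iff.2 hw), ← Real.exp_add]
  gcongr
  rw [Complex.mul_re, Complex.log_re, Complex.log_im, Complex.neg_re, Complex.neg_im]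
  have h1 : a.im * w.arg ≤ π * |a.im| := by
    calc a.im * w.arg ≤ |a.im * w.arg| := le_abs_self _
      _ = |w.arg| * |a.im| := by rw [abs_mul, mul_comm]
      _ ≤ π * |a.im| := by gcongr; exact Complex.abs_arg_le_pi w
  linarith

theorem add_I_mul_ne_zero {ε : ℝ} (hε : 0 < ε) (r : ℝ) : (ε + Complex.I * r : ℂ) ≠ 0 := by
  intro h
  have := congrArg Complex.re h
  simp at this
  exact hε.ne' this

theorem le_norm_add_I_mul {ε : ℝ} (hε : 0 < ε) (r : ℝ) : ε ≤ ‖(ε + Complex.I * r : ℂ)‖ := by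
  have h := Complex.abs_re_le_norm (ε + Complex.I * r : ℂ)
  simpa [abs_of_pos hε] using h

theorem norm_add_I_mul_le {ε : ℝ} (hε : 0 < ε) (r : ℝ) :
    ‖(ε + Complex.I * r : ℂ)‖ ≤ ε + |r| := by
  refine (norm_add_le _ _).trans (le_of_eq ?_)
  simp [abs_of_pos hε]

theorem bddMeas_powKernel {ε : ℝ} (hε : 0 < ε) {a : ℂ} (ha : 0 ≤ a.re) :
    BddMeas (powKernel ε a) := by
  refine ⟨by unfold powKernel; fun_prop, ε ^ (-a.re) * Real.exp (π * |a.im|), fun r => ?_⟩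
  refine (norm_exp_neg_mul_log_le (add_I_mul_ne_zero hε r) a).trans ?_
  exact mul_le_mul_of_nonneg_right (Real.rpow_le_rpow_of_nonpos hε (le_norm_add_I_mul hε r)
    (neg_nonpos.2 ha)) (Real.exp_pos _).le

end PowerKernel

section TTKernel

variable {X Y : Type*} [MeasurableSpace X] [MeasurableSpace Y] {η : Measure Y} [IsFiniteMeasure η]

/-- The kernel of `T T*`, where `T` has kernel `k`. -/
noncomputable def gramKernel (η : Measure Y) (k : X → Y → ℂ) (x x' : X) : ℂ :=
  ∫ y, k x y * (starRingEnd ℂ) (k x' y) ∂η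

theorem bddMeas_gramKernel {k : X → Y → ℂ} (hk : BddMeas (Function.uncurry k)) :
    BddMeas (Function.uncurry (gramKernel η k)) :=
  BddMeas.integral_prod_right (α := X × X) (β := Y)
    (f := fun q y => k q.1 y * (starRingEnd ℂ) (k q.2 y))
    ((hk.comp (g := fun p : (X × X) × Y => (p.1.1, p.2)) (by fun_prop)).mul
      (hk.comp (g := fun p : (X × X) × Y => (p.1.2, p.2)) (by fun_prop)).conj) η

theorem norm_gramKernel_symm {X : Type*} {η : Measure Y} (k : X → Y → ℂ) (x x' : X) :
    ‖gramKernel η k x x'‖ = ‖gramKernel η k x' x‖ := by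
  rw [← RCLike.norm_conj (gramKernel η k x' x), gramKernel, gramKernel, ← integral_conj]
  congr 2; ext y
  simp [mul_comm]

theorem integral_norm_sq_adjoint_eq {μ : Measure X} [IsFiniteMeasure μ] {κ : X → Y → ℂ}
    (hκ : BddMeas (Function.uncurry κ)) {u : X → ℂ} (hu : BddMeas u) :
    ((∫ y, ‖∫ x, (starRingEnd ℂ) (κ x y) * u x ∂μ‖ ^ 2 ∂η : ℝ) : ℂ) =
      ∫ q : X × X, gramKernel η κ q.1 q.2 * ((starRingEnd ℂ) (u q.1) * u q.2) ∂(μ.prod μ) := by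
  have hF : BddMeas (Function.uncurry fun (y : Y) (q : X × X) =>
      (κ q.1 y * (starRingEnd ℂ) (κ q.2 y)) * ((starRingEnd ℂ) (u q.1) * u q.2)) :=
    ((hκ.comp (g := fun p : Y × (X × X) => (p.2.1, p.1)) (by fun_prop)).mul
      (hκ.comp (g := fun p : Y × (X × X) => (p.2.2, p.1)) (by fun_prop)).conj).mul
    ((hu.comp (g := fun p : Y × (X × X) => p.2.1) (by fun_prop)).conj.mul
      (hu.comp (g := fun p : Y × (X × X) => p.2.2) (by fun_prop)))
  rw [← integral_complex_ofReal]
  have e : ∀ y, ((‖∫ x, (starRingEnd ℂ) (κ x y) * u x ∂μ‖ ^ 2 : ℝ) : ℂ) =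
      ∫ q : X × X, (κ q.1 y * (starRingEnd ℂ) (κ q.2 y)) *
        ((starRingEnd ℂ) (u q.1) * u q.2) ∂(μ.prod μ) := by
    intro y
    rw [← Complex.normSq_eq_norm_sq, ← Complex.mul_conj, mul_comm, ← integral_conj,
      ← integral_prod_mul]
    congr 1; ext q
    simp only [map_mul, Complex.conj_conj]
    ring
  simp_rw [e]
  rw [integral_integral_swap (hF.integrable _)]
  congr 1; ext q
  rw [integral_mul_const, gramKernel]

theorem integral_norm_sq_adjoint_le {V : Type*} [MeasurableSpace V] {σ : Measure V}
    [IsFiniteMeasure σ] {k : V → Y → ℂ} (hk : BddMeas (Function.uncurry k)) {Γ : ℝ}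
    (hΓ : ∀ v, ∫ v', ‖gramKernel η k v v'‖ ∂σ ≤ Γ) {u : V → ℂ} (hu : BddMeas u) :
    ∫ y, ‖∫ v, (starRingEnd ℂ) (k v y) * u v ∂σ‖ ^ 2 ∂η ≤ Γ * ∫ v, ‖u v‖ ^ 2 ∂σ := by
  have hc : ((∫ y, ‖∫ v, (starRingEnd ℂ) (k v y) * u v ∂σ‖ ^ 2 ∂η : ℝ) : ℂ) =
      ∫ q : V × V, gramKernel η k q.1 q.2 * ((starRingEnd ℂ) (u q.1) * u q.2) ∂(σ.prod σ) :=
    integral_norm_sq_adjoint_eq hk hu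
  have hg := bddMeas_gramKernel (η := η) hk
  have hs := schur_test (μ := σ) (P := fun v v' => ‖gramKernel η k v v'‖) hg.norm hu.norm
    (fun _ _ => norm_nonneg _) (norm_gramKernel_symm k) hΓ
  rw [integral_integral (((hu.norm.comp measurable_fst).mul hg.norm).mul
    (hu.norm.comp measurable_snd) |>.integrable (σ.prod σ))] at hs
  refine le_trans ?_ hs
  have h3 := congrArg norm hc
  rw [Complex.norm_real, Real.norm_of_nonneg (integral_nonneg fun y => by positivity)] at h3
  rw [h3]
  refine (norm_integral_le_integral_norm _).trans (le_of_eq ?_)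
  congr 1; ext q
  rw [norm_mul, norm_mul, RCLike.norm_conj]
  ring

variable {V : Type*} [MeasurableSpace V] {ρ : Measure ℝ} {σ : Measure V} [IsFiniteMeasure ρ]
  [IsFiniteMeasure σ] {k : ℝ × V → Y → ℂ} {ε : ℝ}

theorem integral_mul_powKernel_eq {A B : ℝ × V → ℂ} (hA : BddMeas A) (hB : BddMeas B) {m : ℝ → ℂ}
    (hm : BddMeas m) :
    ∫ q : (ℝ × V) × (ℝ × V), m (q.1.1 - q.2.1) * (A q.1 * B q.2) ∂((ρ.prod σ).prod (ρ.prod σ)) =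
      ∫ p : ℝ × ℝ, m (p.1 - p.2) * ((∫ v, A (p.1, v) ∂σ) * ∫ v, B (p.2, v) ∂σ) ∂(ρ.prod ρ) := by
  have ha : BddMeas fun t => ∫ v, A (t, v) ∂σ :=
    BddMeas.integral_prod_right (f := fun t v => A (t, v)) hA σ
  have hb : BddMeas fun t => ∫ v, B (t, v) ∂σ :=
    BddMeas.integral_prod_right (f := fun t v => B (t, v)) hB σ
  have hM : BddMeas fun t => ∫ r, m (t - r) * (∫ v, B (r, v) ∂σ) ∂ρ :=
    BddMeas.integral_prod_right (f := fun t r => m (t - r) * (∫ v, B (r, v) ∂σ))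
      ((hm.comp (g := fun p : ℝ × ℝ => p.1 - p.2) (by fun_prop)).mul (hb.comp measurable_snd)) ρ
  rw [integral_prod _ (BddMeas.integrable ((hm.comp
      (g := fun q : (ℝ × V) × (ℝ × V) => q.1.1 - q.2.1) (by fun_prop)).mul
      ((hA.comp measurable_fst).mul (hB.comp measurable_snd))) _),
    integral_prod _ (BddMeas.integrable ((hm.comp
      (g := fun p : ℝ × ℝ => p.1 - p.2) (by fun_prop)).mul
      ((ha.comp measurable_fst).mul (hb.comp measurable_snd))) _)]
  have e1 : ∀ x : ℝ × V, ∫ x', m (x.1 - x'.1) * (A x * B x') ∂(ρ.prod σ) =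
      A x * ∫ r, m (x.1 - r) * (∫ v, B (r, v) ∂σ) ∂ρ := by
    intro x
    rw [integral_prod _ (BddMeas.integrable ((hm.comp
      (g := fun x' : ℝ × V => x.1 - x'.1) (by fun_prop)).mul ((BddMeas.const (A x)).mul hB)) _),
      ← integral_const_mul]
    congr 1; ext r
    simp only
    rw [integral_const_mul, integral_const_mul]
    ring
  simp only [e1]
  rw [integral_prod _ (BddMeas.integrable (hA.mul (hM.comp measurable_fst)) _)]
  congr 1; ext t
  simp only
  rw [integral_mul_const, ← integral_const_mul]
  congr 1; ext r
  ring

/-- The `L²` endpoint. -/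
theorem norm_integral_powKernel_gramKernel_le (hε : 0 < ε) (hρ : ρ ≤ volume)
    (hk : BddMeas (Function.uncurry k)) {Γ : ℝ}
    (hΓ : ∀ t v, ∫ v', ‖gramKernel η k (t, v) (t, v')‖ ∂σ ≤ Γ) (τ : ℝ) {u w : ℝ × V → ℂ}
    (hu : BddMeas u) (hw : BddMeas w) :
    ‖∫ q : (ℝ × V) × (ℝ × V), powKernel ε (1 + Complex.I * τ) (q.1.1 - q.2.1) *
        gramKernel η k q.1 q.2 * ((starRingEnd ℂ) (u q.1) * w q.2)
        ∂((ρ.prod σ).prod (ρ.prod σ))‖ ≤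
      π * Real.exp (π * |τ|) * Γ * (∫ x, ‖u x‖ ^ 2 ∂(ρ.prod σ) + ∫ x, ‖w x‖ ^ 2 ∂(ρ.prod σ)) := by
  have hm : BddMeas (powKernel ε (1 + Complex.I * τ)) := bddMeas_powKernel hε (by simp)
  set h : (ℝ × V → ℂ) → Y → ℝ → ℂ := fun u y t => ∫ v, (starRingEnd ℂ) (k (t, v) y) * u (t, v) ∂σ
    with hh
  have hhb : ∀ {u}, BddMeas u → BddMeas (Function.uncurry (h u)) := fun {u} hu =>
    BddMeas.integral_prod_right (α := Y × ℝ) (β := V)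
      (f := fun p v => (starRingEnd ℂ) (k (p.2, v) p.1) * u (p.2, v))
      ((hk.comp (g := fun q : (Y × ℝ) × V => ((q.1.2, q.2), q.1.1)) (by fun_prop)).conj.mul
        (hu.comp (g := fun q : (Y × ℝ) × V => (q.1.2, q.2)) (by fun_prop))) σ
  have hL2 : ∀ {u}, BddMeas u → ∫ y, ∫ t, ‖h u y t‖ ^ 2 ∂ρ ∂η ≤ Γ * ∫ x, ‖u x‖ ^ 2 ∂(ρ.prod σ) := by
    intro u hu
    rw [integral_integral_swap (((hhb hu).norm.pow 2).integrable (η.prod ρ)),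
      integral_prod _ ((hu.norm.pow 2).integrable _), ← integral_const_mul]
    refine integral_mono ?_ ?_ fun t => ?_
    · exact (BddMeas.integral_prod_right (α := ℝ) (β := Y) (f := fun t y => ‖h u y t‖ ^ 2)
        (((hhb hu).comp measurable_swap).norm.pow 2) η).integrable ρ
    · exact ((BddMeas.integral_prod_right (f := fun t v => ‖u (t, v)‖ ^ 2)
        (hu.norm.pow 2) σ).integrable ρ).const_mul Γ
    · exact integral_norm_sq_adjoint_le (k := fun v y => k (t, v) y)
        (hk.comp (g := fun p : V × Y => ((t, p.1), p.2)) (by fun_prop)) (hΓ t)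
        (hu.comp (g := fun v : V => (t, v)) (by fun_prop))
  have hmain : ∫ q : (ℝ × V) × (ℝ × V), powKernel ε (1 + Complex.I * τ) (q.1.1 - q.2.1) *
        gramKernel η k q.1 q.2 * ((starRingEnd ℂ) (u q.1) * w q.2)
        ∂((ρ.prod σ).prod (ρ.prod σ)) =
      ∫ y, ∫ p : ℝ × ℝ, powKernel ε (1 + Complex.I * τ) (p.1 - p.2) *
        ((starRingEnd ℂ) (h u y p.1) * h w y p.2) ∂(ρ.prod ρ) ∂η := by
    have hb : BddMeas (Function.uncurry fun (q : (ℝ × V) × (ℝ × V)) (y : Y) =>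
        powKernel ε (1 + Complex.I * τ) (q.1.1 - q.2.1) *
        ((k q.1 y * (starRingEnd ℂ) (u q.1)) * ((starRingEnd ℂ) (k q.2 y) * w q.2))) :=
      (hm.comp (g := fun p : ((ℝ × V) × (ℝ × V)) × Y => p.1.1.1 - p.1.2.1) (by fun_prop)).mul
      (((hk.comp (g := fun p : ((ℝ × V) × (ℝ × V)) × Y => (p.1.1, p.2)) (by fun_prop)).mul
        (hu.comp (g := fun p : ((ℝ × V) × (ℝ × V)) × Y => p.1.1) (by fun_prop)).conj).mul
      ((hk.comp (g := fun p : ((ℝ × V) × (ℝ × V)) × Y => (p.1.2, p.2)) (by fun_prop)).conj.mul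
        (hw.comp (g := fun p : ((ℝ × V) × (ℝ × V)) × Y => p.1.2) (by fun_prop))))
    calc _ = ∫ q : (ℝ × V) × (ℝ × V), ∫ y, powKernel ε (1 + Complex.I * τ) (q.1.1 - q.2.1) *
        ((k q.1 y * (starRingEnd ℂ) (u q.1)) * ((starRingEnd ℂ) (k q.2 y) * w q.2)) ∂η
          ∂((ρ.prod σ).prod (ρ.prod σ)) := by
          congr 1; ext q
          rw [gramKernel, ← integral_const_mul, ← integral_mul_const]
          congr 1; ext y; ring
      _ = _ := by
          rw [integral_integral_swap (hb.integrable _)]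
          congr 1; ext y
          rw [integral_mul_powKernel_eq (A := fun x => k x y * (starRingEnd ℂ) (u x))
            (B := fun x => (starRingEnd ℂ) (k x y) * w x)
            ((hk.comp (g := fun x : ℝ × V => (x, y)) (by fun_prop)).mul hu.conj)
            ((hk.comp (g := fun x : ℝ × V => (x, y)) (by fun_prop)).conj.mul hw) hm]
          congr 1; ext p
          simp only [hh]
          rw [← integral_conj]
          simp
  rw [hmain]
  have i1 : ∀ {u}, BddMeas u → Integrable (fun y => ∫ t, ‖h u y t‖ ^ 2 ∂ρ) η := fun {u} hu =>
    (BddMeas.integral_prod_right (f := fun y t => ‖h u y t‖ ^ 2)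
      ((hhb hu).norm.pow 2) ρ).integrable η
  have hC : 0 ≤ π * Real.exp (π * |τ|) := by positivity
  calc _ ≤ ∫ y, π * Real.exp (π * |τ|) * (∫ t, ‖h u y t‖ ^ 2 ∂ρ + ∫ t, ‖h w y t‖ ^ 2 ∂ρ) ∂η := by
        refine norm_integral_le_of_norm_le (((i1 hu).add (i1 hw)).const_mul _)
          (Eventually.of_forall fun y => ?_)
        exact norm_integral_kernel_le hε hρ τ
          ((hhb hu).comp (g := fun t : ℝ => (y, t)) (by fun_prop))
          ((hhb hw).comp (g := fun t : ℝ => (y, t)) (by fun_prop))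
    _ = π * Real.exp (π * |τ|) *
        (∫ y, ∫ t, ‖h u y t‖ ^ 2 ∂ρ ∂η + ∫ y, ∫ t, ‖h w y t‖ ^ 2 ∂ρ ∂η) := by
        rw [integral_const_mul, integral_add (i1 hu) (i1 hw)]
    _ ≤ π * Real.exp (π * |τ|) * (Γ * ∫ x, ‖u x‖ ^ 2 ∂(ρ.prod σ) +
          Γ * ∫ x, ‖w x‖ ^ 2 ∂(ρ.prod σ)) :=
        mul_le_mul_of_nonneg_left (add_le_add (hL2 hu) (hL2 hw)) hC
    _ = _ := by ring

end TTKernel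

section HilbertSchmidt

variable {X : Type*} [MeasurableSpace X] {μ : Measure X} [IsFiniteMeasure μ] {n : ℕ}
  {u : Fin n → X → ℂ}

theorem integral_norm_mul_norm_le {E F : Type*} [NormedAddCommGroup E] [MeasurableSpace E]
    [BorelSpace E] [SecondCountableTopology E] [NormedAddCommGroup F] [MeasurableSpace F]
    [BorelSpace F] [SecondCountableTopology F] {f : X → E} {g : X → F}
    (hf : BddMeas f) (hg : BddMeas g) :
    ∫ x, ‖f x‖ * ‖g x‖ ∂μ ≤
      (∫ x, ‖f x‖ ^ 2 ∂μ) ^ (1 / 2 : ℝ) * (∫ x, ‖g x‖ ^ 2 ∂μ) ^ (1 / 2 : ℝ) := by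
  have hmem : ∀ {h : X → ℝ}, BddMeas h → MemLp h (ENNReal.ofReal 2) μ := fun {h} hh => by
    obtain ⟨C, hC⟩ := hh.exists_bound
    exact MemLp.of_bound hh.measurable.aestronglyMeasurable C (Eventually.of_forall hC)
  have := integral_mul_le_Lp_mul_Lq_of_nonneg (μ := μ) (p := 2) (q := 2)
    Real.HolderConjugate.two_two (f := fun x => ‖f x‖) (g := fun x => ‖g x‖)
    (Eventually.of_forall fun _ => norm_nonneg _)
    (Eventually.of_forall fun _ => norm_nonneg _) (hmem hf.norm) (hmem hg.norm)
  simpa using this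

theorem integral_norm_sq_sum_eq (hu : ∀ i, BddMeas (u i))
    (horth : ∀ i j, ∫ x, (starRingEnd ℂ) (u i x) * u j x ∂μ = if i = j then 1 else 0)
    (γ : Fin n → ℂ) :
    ∫ q : X × X, ‖∑ i, γ i * ((starRingEnd ℂ) (u i q.1) * u i q.2)‖ ^ 2 ∂(μ.prod μ) =
      ∑ i, ‖γ i‖ ^ 2 := by
  apply Complex.ofReal_injective
  rw [← integral_complex_ofReal]
  have e1 : ∀ q : X × X,
      ((‖∑ i, γ i * ((starRingEnd ℂ) (u i q.1) * u i q.2)‖ ^ 2 : ℝ) : ℂ) =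
      ∑ i, ∑ j, (γ i * (starRingEnd ℂ) (γ j)) * (((starRingEnd ℂ) (u i q.1) * u j q.1) *
        ((starRingEnd ℂ) (u j q.2) * u i q.2)) := by
    intro q
    rw [← Complex.normSq_eq_norm_sq, ← Complex.mul_conj, map_sum, Finset.sum_mul_sum]
    refine Finset.sum_congr rfl fun i _ => Finset.sum_congr rfl fun j _ => ?_
    simp only [map_mul, Complex.conj_conj]
    ring
  simp_rw [e1]
  have hb : ∀ i j, BddMeas fun q : X × X => (γ i * (starRingEnd ℂ) (γ j)) *
      (((starRingEnd ℂ) (u i q.1) * u j q.1) * ((starRingEnd ℂ) (u j q.2) * u i q.2)) :=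
    fun i j => (BddMeas.const _).mul
      ((((hu i).comp measurable_fst).conj.mul ((hu j).comp measurable_fst)).mul
      (((hu j).comp measurable_snd).conj.mul ((hu i).comp measurable_snd)))
  rw [integral_finsetSum _ fun i _ => (BddMeas.sum _ fun j _ => hb i j).integrable _]
  push_cast
  refine Finset.sum_congr rfl fun i _ => ?_
  rw [integral_finsetSum _ fun j _ => (hb i j).integrable _]
  have e2 : ∀ j, ∫ q : X × X, (γ i * (starRingEnd ℂ) (γ j)) *
      (((starRingEnd ℂ) (u i q.1) * u j q.1) * ((starRingEnd ℂ) (u j q.2) * u i q.2))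
        ∂(μ.prod μ) = if i = j then γ i * (starRingEnd ℂ) (γ i) else 0 := by
    intro j
    rw [integral_const_mul, integral_prod_mul (f := fun x => (starRingEnd ℂ) (u i x) * u j x)
      (g := fun x => (starRingEnd ℂ) (u j x) * u i x), horth, horth]
    by_cases h : i = j
    · subst h; simp
    · simp [h, Ne.symm h]
  simp_rw [e2]
  simp [Complex.mul_conj, Complex.normSq_eq_norm_sq]

/-- The Hilbert–Schmidt endpoint. -/
theorem norm_sum_integral_mul_le (hu : ∀ i, BddMeas (u i))
    (horth : ∀ i j, ∫ x, (starRingEnd ℂ) (u i x) * u j x ∂μ = if i = j then 1 else 0)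
    (γ : Fin n → ℂ) {H : X × X → ℂ} (hH : BddMeas H) :
    ‖∑ i, γ i * ∫ q : X × X, H q * ((starRingEnd ℂ) (u i q.1) * u i q.2) ∂(μ.prod μ)‖ ≤
      (∑ i, ‖γ i‖ ^ 2) ^ (1 / 2 : ℝ) * (∫ q, ‖H q‖ ^ 2 ∂(μ.prod μ)) ^ (1 / 2 : ℝ) := by
  have hS : ∀ i, BddMeas fun q : X × X => (starRingEnd ℂ) (u i q.1) * u i q.2 := fun i =>
    ((hu i).comp measurable_fst).conj.mul ((hu i).comp measurable_snd)
  rw [← integral_norm_sq_sum_eq hu horth γ]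
  have e : ∑ i, γ i * ∫ q : X × X, H q * ((starRingEnd ℂ) (u i q.1) * u i q.2) ∂(μ.prod μ) =
      ∫ q : X × X, (∑ i, γ i * ((starRingEnd ℂ) (u i q.1) * u i q.2)) * H q ∂(μ.prod μ) := by
    simp_rw [Finset.sum_mul]
    rw [integral_finsetSum _ fun i _ =>
      ((((BddMeas.const (γ i)).mul (hS i)).mul hH).integrable _)]
    refine Finset.sum_congr rfl fun i _ => ?_
    rw [← integral_const_mul]
    congr 1; ext q; ring
  rw [e]
  refine (norm_integral_le_integral_norm _).trans ?_
  simp_rw [norm_mul]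
  exact integral_norm_mul_norm_le
    (BddMeas.sum _ fun i _ => (BddMeas.const (γ i)).mul (hS i)) hH

end HilbertSchmidt

section Interpolation

variable {V Y : Type*} [MeasurableSpace V] [MeasurableSpace Y] {ρ : Measure ℝ} {σ : Measure V}
  {η : Measure Y} [IsFiniteMeasure ρ] [IsFiniteMeasure σ] [IsFiniteMeasure η]
  {k : ℝ × V → Y → ℂ} {ε : ℝ} {n : ℕ} {u : Fin n → ℝ × V → ℂ} {W : ℝ × V → ℝ} {Γ₁ Γ₂ : ℝ}

/-- The constant in the interpolation theorem. -/
noncomputable def interpConst (H : ℝ) : ℝ := 2 * π * Real.exp (1 + (π * H) ^ 2 / 4)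

theorem interpConst_pos (H : ℝ) : 0 < interpConst H := by unfold interpConst; positivity

theorem exp_neg_sq_add_mul_le (B τ : ℝ) :
    Real.exp (-τ ^ 2) * Real.exp (B * |τ|) ≤ Real.exp (B ^ 2 / 4) := by
  rw [← Real.exp_add]
  gcongr
  have : τ ^ 2 = |τ| ^ 2 := (sq_abs τ).symm
  nlinarith [sq_nonneg (|τ| - B / 2)]

theorem norm_exp_sq_sub_le {z : ℂ} (hz0 : 0 ≤ z.re) (hz1 : z.re ≤ 1) (θ : ℝ) :
    ‖Complex.exp (z ^ 2 - θ ^ 2)‖ ≤ Real.exp (z.re) * Real.exp (-z.im ^ 2) := by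
  rw [Complex.norm_exp, ← Real.exp_add]
  gcongr
  have : (z ^ 2 - (θ : ℂ) ^ 2).re = z.re ^ 2 - z.im ^ 2 - θ ^ 2 := by
    simp [sq]
  rw [this]
  nlinarith [sq_nonneg θ]

theorem bddMeas_log (hW : Measurable W) {δ M : ℝ} (hδ : 0 < δ) (hWδ : ∀ x, δ ≤ W x)
    (hWM : ∀ x, W x ≤ M) : BddMeas fun x => ((Real.log (W x) : ℝ) : ℂ) := by
  refine ⟨by fun_prop, |Real.log δ| + |Real.log M|, fun x => ?_⟩
  rw [Complex.norm_real, Real.norm_eq_abs, abs_le]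
  have h1 := Real.log_le_log hδ (hWδ x)
  have h2 := Real.log_le_log (hδ.trans_le (hWδ x)) (hWM x)
  constructor
  · have := neg_abs_le (Real.log δ); have := abs_nonneg (Real.log M); linarith
  · have := le_abs_self (Real.log M); have := abs_nonneg (Real.log δ); linarith

theorem bddMeas_rpow (hW : Measurable W) {δ M : ℝ} (hδ : 0 < δ) (hWδ : ∀ x, δ ≤ W x)
    (hWM : ∀ x, W x ≤ M) {s : ℝ} (hs : 0 ≤ s) : BddMeas fun x => W x ^ s := by
  refine ⟨by fun_prop, M ^ s, fun x => ?_⟩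
  have h0 : 0 ≤ W x := hδ.le.trans (hWδ x)
  rw [Real.norm_of_nonneg (by positivity)]
  exact Real.rpow_le_rpow h0 (hWM x) hs

theorem bddMeas_exp_I_mul_log (hW : Measurable W) (s : ℝ) :
    BddMeas fun x => Complex.exp (Complex.I * ((s * Real.log (W x) : ℝ) : ℂ)) :=
  bddMeas_exp_I_mul (by fun_prop)

theorem integral_norm_sq_of_orthonormal {X : Type*} [MeasurableSpace X] {μ : Measure X}
    {u : Fin n → X → ℂ}
    (horth : ∀ i j, ∫ x, (starRingEnd ℂ) (u i x) * u j x ∂μ = if i = j then 1 else 0) (i : Fin n) :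
    ∫ x, ‖u i x‖ ^ 2 ∂μ = 1 := by
  apply Complex.ofReal_injective
  rw [← integral_complex_ofReal]
  have := horth i i
  simp only [if_true] at this
  rw [Complex.ofReal_one, ← this]
  congr 1; ext x
  rw [mul_comm, Complex.mul_conj, Complex.normSq_eq_norm_sq]

theorem norm_interp_left_le {H : ℝ} (hH : 0 < H) (hε : 0 < ε) (hρ : ρ ≤ volume)
    (hk : BddMeas (Function.uncurry k))
    (hΓ : ∀ t v, ∫ v', ‖gramKernel η k (t, v) (t, v')‖ ∂σ ≤ Γ₁) (hW : Measurable W)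
    {u : ℝ × V → ℂ} (hu : BddMeas u) (hu1 : ∫ x, ‖u x‖ ^ 2 ∂(ρ.prod σ) = 1) {z : ℂ}
    (hz : z.re = 0) :
    ‖∫ q : (ℝ × V) × (ℝ × V), gramKernel η k q.1 q.2 *
        Complex.exp (z * H * ((Real.log (W q.1) : ℝ) + (Real.log (W q.2) : ℝ))) *
        powKernel ε (1 - z * H) (q.1.1 - q.2.1) * ((starRingEnd ℂ) (u q.1) * u q.2)
        ∂((ρ.prod σ).prod (ρ.prod σ))‖ ≤ 2 * π * Real.exp (π * H * |z.im|) * Γ₁ := by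
  obtain ⟨τ, rfl⟩ : ∃ τ : ℝ, z = Complex.I * τ :=
    ⟨z.im, by apply Complex.ext <;> simp [hz]⟩
  have hb : BddMeas fun x => u x * Complex.exp (Complex.I * ((τ * H * Real.log (W x) : ℝ) : ℂ)) :=
    hu.mul (bddMeas_exp_I_mul_log hW _)
  have ha : BddMeas fun x =>
      u x * Complex.exp (Complex.I * ((-(τ * H) * Real.log (W x) : ℝ) : ℂ)) :=
    hu.mul (bddMeas_exp_I_mul_log hW _)
  have h := norm_integral_powKernel_gramKernel_le hε hρ hk hΓ (-(τ * H)) ha hb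
  simp only [norm_mul, norm_exp_I_mul_ofReal', mul_one, hu1] at h
  have him : (Complex.I * (τ : ℂ)).im = τ := by simp
  rw [him]
  rw [abs_neg, abs_mul, abs_of_pos hH] at h
  calc _ = _ := ?_
    _ ≤ _ := h
    _ = _ := by ring_nf
  congr 2; ext q
  rw [map_mul, ← Complex.exp_conj]
  have e1 : (1 - Complex.I * τ * H : ℂ) = 1 + Complex.I * ((-(τ * H) : ℝ) : ℂ) := by
    push_cast; ring
  have e2 : (starRingEnd ℂ) (Complex.I * ((-(τ * H) * Real.log (W q.1) : ℝ) : ℂ)) =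
      Complex.I * ((τ * H * Real.log (W q.1) : ℝ) : ℂ) := by
    rw [map_mul, Complex.conj_I, Complex.conj_ofReal]; push_cast; ring
  rw [e1, e2]
  have e3 : Complex.exp (Complex.I * τ * H * ((Real.log (W q.1) : ℝ) + (Real.log (W q.2) : ℝ))) =
      Complex.exp (Complex.I * ((τ * H * Real.log (W q.1) : ℝ) : ℂ)) *
      Complex.exp (Complex.I * ((τ * H * Real.log (W q.2) : ℝ) : ℂ)) := by
    rw [← Complex.exp_add]; push_cast; ring_nf
  rw [e3]
  ring

theorem norm_exp_mul_log_add {H : ℝ} {z : ℂ} (hz : z.re = 1) {a b : ℝ} (ha : 0 < a) (hb : 0 < b) :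
    ‖Complex.exp (z * H * ((Real.log a : ℝ) + (Real.log b : ℝ)))‖ = a ^ H * b ^ H := by
  rw [Complex.norm_exp, Real.rpow_def_of_pos ha, Real.rpow_def_of_pos hb, ← Real.exp_add]
  congr 1
  simp [hz]
  ring

theorem norm_interp_right_le {H : ℝ} (hH : 1 < H) (hε : 0 < ε)
    (hk : BddMeas (Function.uncurry k)) (hΓ0 : 0 ≤ Γ₂)
    (hΓ : ∀ x x', (ε + |x.1 - x'.1|) ^ (H - 1) * ‖gramKernel η k x x'‖ ≤ Γ₂) (hW : Measurable W)
    {δ M : ℝ} (hδ : 0 < δ) (hWδ : ∀ x, δ ≤ W x) (hWM : ∀ x, W x ≤ M)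
    (hu : ∀ i, BddMeas (u i))
    (horth : ∀ i j, ∫ x, (starRingEnd ℂ) (u i x) * u j x ∂(ρ.prod σ) = if i = j then 1 else 0)
    (γ : Fin n → ℂ) {z : ℂ} (hz : z.re = 1) :
    ‖∑ i, γ i * ∫ q : (ℝ × V) × (ℝ × V), gramKernel η k q.1 q.2 *
        Complex.exp (z * H * ((Real.log (W q.1) : ℝ) + (Real.log (W q.2) : ℝ))) *
        powKernel ε (1 - z * H) (q.1.1 - q.2.1) * ((starRingEnd ℂ) (u i q.1) * u i q.2)
        ∂((ρ.prod σ).prod (ρ.prod σ))‖ ≤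
      (∑ i, ‖γ i‖ ^ 2) ^ (1 / 2 : ℝ) *
        (Real.exp (π * H * |z.im|) * Γ₂ * ∫ x, W x ^ (2 * H) ∂(ρ.prod σ)) := by
  have hH0 : 0 < H := one_pos.trans hH
  have hW0 : ∀ x, 0 < W x := fun x => hδ.trans_le (hWδ x)
  set E : ℝ := Real.exp (π * H * |z.im|) with hE
  set G : (ℝ × V) × (ℝ × V) → ℂ := fun q => gramKernel η k q.1 q.2 *
        Complex.exp (z * H * ((Real.log (W q.1) : ℝ) + (Real.log (W q.2) : ℝ))) *
        powKernel ε (1 - z * H) (q.1.1 - q.2.1) with hG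
  have hWb : BddMeas fun x => W x ^ H := bddMeas_rpow hW hδ hWδ hWM hH0.le
  have hWWb : BddMeas fun q : (ℝ × V) × (ℝ × V) => W q.1 ^ H * W q.2 ^ H :=
    (hWb.comp measurable_fst).mul (hWb.comp measurable_snd)
  have hGle : ∀ q, ‖G q‖ ≤ E * Γ₂ * (W q.1 ^ H * W q.2 ^ H) := by
    intro q
    simp only [hG]
    rw [norm_mul, norm_mul, norm_exp_mul_log_add hz (hW0 _) (hW0 _)]
    have h1 : ‖powKernel ε (1 - z * H) (q.1.1 - q.2.1)‖ ≤
        (ε + |q.1.1 - q.2.1|) ^ (H - 1) * E := by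
      refine (norm_exp_neg_mul_log_le (add_I_mul_ne_zero hε _) _).trans ?_
      have e1 : -(1 - z * H).re = H - 1 := by simp [hz]
      have e2 : |(1 - z * H).im| = H * |z.im| := by
        simp [abs_mul, abs_of_pos hH0, mul_comm]
      rw [e1, e2, ← mul_assoc]
      exact mul_le_mul_of_nonneg_right (Real.rpow_le_rpow (norm_nonneg _)
        (norm_add_I_mul_le hε _) (by linarith)) (Real.exp_pos _).le
    calc _ ≤ ‖gramKernel η k q.1 q.2‖ * (W q.1 ^ H * W q.2 ^ H) *
          ((ε + |q.1.1 - q.2.1|) ^ (H - 1) * E) := by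
            have := hW0 q.1; have := hW0 q.2
            gcongr
      _ = E * ((ε + |q.1.1 - q.2.1|) ^ (H - 1) * ‖gramKernel η k q.1 q.2‖) *
          (W q.1 ^ H * W q.2 ^ H) := by ring
      _ ≤ _ := by
            have := hW0 q.1; have := hW0 q.2
            gcongr
            exact hΓ _ _
  have hGb : BddMeas G := by
    refine ⟨?_, ?_⟩
    · refine ((bddMeas_gramKernel hk).measurable.mul (by fun_prop)).mul ?_
      unfold powKernel; fun_prop
    · obtain ⟨C, hC⟩ := hWWb.exists_bound
      refine ⟨E * Γ₂ * C, fun q => (hGle q).trans ?_⟩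
      gcongr
      exact (le_abs_self _).trans (hC q)
  refine (norm_sum_integral_mul_le hu horth γ hGb).trans ?_
  gcongr
  have hJ : ∫ q : (ℝ × V) × (ℝ × V), W q.1 ^ (2 * H) * W q.2 ^ (2 * H)
      ∂((ρ.prod σ).prod (ρ.prod σ)) = (∫ x, W x ^ (2 * H) ∂(ρ.prod σ)) ^ 2 := by
    rw [integral_prod_mul (f := fun x => W x ^ (2 * H)) (g := fun x => W x ^ (2 * H)), sq]
  have hJ0 : 0 ≤ ∫ x, W x ^ (2 * H) ∂(ρ.prod σ) :=
    integral_nonneg fun x => Real.rpow_nonneg (hW0 x).le _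
  have hsq : ∫ q, ‖G q‖ ^ 2 ∂((ρ.prod σ).prod (ρ.prod σ)) ≤
      (E * Γ₂ * ∫ x, W x ^ (2 * H) ∂(ρ.prod σ)) ^ 2 := by
    rw [mul_pow, ← hJ, ← integral_const_mul]
    have hW2b : BddMeas fun x => W x ^ (2 * H) := bddMeas_rpow hW hδ hWδ hWM (by positivity)
    refine integral_mono ((hGb.norm.pow 2).integrable _)
      ((((hW2b.comp measurable_fst).mul (hW2b.comp measurable_snd)).integrable _).const_mul _)
      fun q => ?_
    have h1 := pow_le_pow_left₀ (norm_nonneg _) (hGle q) 2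
    refine h1.trans (le_of_eq ?_)
    rw [mul_pow, mul_pow, mul_pow, ← Real.rpow_natCast (W q.1 ^ H), ← Real.rpow_natCast (W q.2 ^ H),
      ← Real.rpow_mul (hW0 _).le, ← Real.rpow_mul (hW0 _).le]
    push_cast
    rw [mul_comm H 2]
  calc _ ≤ ((E * Γ₂ * ∫ x, W x ^ (2 * H) ∂(ρ.prod σ)) ^ 2) ^ (1 / 2 : ℝ) :=
        Real.rpow_le_rpow (integral_nonneg fun q => by positivity) hsq (by norm_num)
    _ = _ := by
        rw [← Real.sqrt_eq_rpow, Real.sqrt_sq (by positivity)]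

end Interpolation

section ThreeLines

variable {V Y : Type*} [MeasurableSpace V] [MeasurableSpace Y] {ρ : Measure ℝ} {σ : Measure V}
  {η : Measure Y} {k : ℝ × V → Y → ℂ} {ε : ℝ} {n : ℕ} {u : Fin n → ℝ × V → ℂ} {W : ℝ × V → ℝ}
  {Γ₁ Γ₂ : ℝ}

/-- The analytic family of quadratic forms interpolating between the two endpoints. -/
noncomputable def interpForm (ρ : Measure ℝ) (σ : Measure V) (η : Measure Y) (k : ℝ × V → Y → ℂ)
    (ε H : ℝ) (W : ℝ × V → ℝ) (u : ℝ × V → ℂ) (z : ℂ) : ℂ :=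
  ∫ q : (ℝ × V) × (ℝ × V), gramKernel η k q.1 q.2 *
    Complex.exp (z * H * ((Real.log (W q.1) : ℝ) + (Real.log (W q.2) : ℝ))) *
    powKernel ε (1 - z * H) (q.1.1 - q.2.1) * ((starRingEnd ℂ) (u q.1) * u q.2)
    ∂((ρ.prod σ).prod (ρ.prod σ))

theorem norm_log_add_I_mul_le (hε : 0 < ε) {r R : ℝ} (hr : |r| ≤ R) :
    ‖Complex.log (ε + Complex.I * r)‖ ≤ |Real.log ε| + |Real.log (ε + R)| + π := by
  refine (Complex.norm_le_abs_re_add_abs_im _).trans ?_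
  rw [Complex.log_re, Complex.log_im]
  refine add_le_add ?_ (Complex.abs_arg_le_pi _)
  have h1 := Real.log_le_log hε (le_norm_add_I_mul hε r)
  have h2 := Real.log_le_log (hε.trans_le (le_norm_add_I_mul hε r))
    ((norm_add_I_mul_le hε r).trans (add_le_add_right hr ε))
  rw [abs_le]
  constructor
  · have := neg_abs_le (Real.log ε); have := abs_nonneg (Real.log (ε + R)); linarith
  · have := le_abs_self (Real.log (ε + R)); have := abs_nonneg (Real.log ε); linarith

theorem interpForm_inv {H : ℝ} (hH : H ≠ 0) (hW0 : ∀ x, 0 < W x) (u : ℝ × V → ℂ) :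
    interpForm ρ σ η k ε H W u ((H⁻¹ : ℝ) : ℂ) =
      ∫ q : (ℝ × V) × (ℝ × V), gramKernel η k q.1 q.2 * ((W q.1 : ℂ) * (W q.2 : ℂ)) *
        ((starRingEnd ℂ) (u q.1) * u q.2) ∂((ρ.prod σ).prod (ρ.prod σ)) := by
  rw [interpForm]
  congr 1; ext q
  have e1 : ((H⁻¹ : ℝ) : ℂ) * H = 1 := by
    push_cast
    exact inv_mul_cancel₀ (by exact_mod_cast hH)
  rw [e1, one_mul, sub_self, Complex.exp_add, ← Complex.ofReal_exp, ← Complex.ofReal_exp,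
    Real.exp_log (hW0 _), Real.exp_log (hW0 _)]
  simp [powKernel]

variable [IsFiniteMeasure η]

theorem exists_interpForm_eq (hε : 0 < ε) {R : ℝ} (hR : ∀ᵐ t ∂ρ, |t| ≤ R)
    (hk : BddMeas (Function.uncurry k)) (hW : Measurable W) {δ M : ℝ} (hδ : 0 < δ)
    (hWδ : ∀ x, δ ≤ W x) (hWM : ∀ x, W x ≤ M) (H : ℝ) {u : ℝ × V → ℂ} (hu : BddMeas u) :
    ∃ A b : (ℝ × V) × (ℝ × V) → ℂ, ∃ CA Cb : ℝ, Measurable A ∧ Measurable b ∧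
      (∀ᵐ q ∂((ρ.prod σ).prod (ρ.prod σ)), ‖A q‖ ≤ CA) ∧
      (∀ᵐ q ∂((ρ.prod σ).prod (ρ.prod σ)), ‖b q‖ ≤ Cb) ∧
      ∀ z, interpForm ρ σ η k ε H W u z =
        ∫ q, A q * Complex.exp (z * b q) ∂((ρ.prod σ).prod (ρ.prod σ)) := by
  have hl := bddMeas_log hW hδ hWδ hWM
  have hll : BddMeas fun q : (ℝ × V) × (ℝ × V) =>
      (((Real.log (W q.1) : ℝ) : ℂ) + ((Real.log (W q.2) : ℝ) : ℂ)) :=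
    (hl.comp measurable_fst).add (hl.comp measurable_snd)
  have hA : BddMeas fun q : (ℝ × V) × (ℝ × V) => gramKernel η k q.1 q.2 *
      powKernel ε 1 (q.1.1 - q.2.1) * ((starRingEnd ℂ) (u q.1) * u q.2) :=
    ((bddMeas_gramKernel hk).mul ((bddMeas_powKernel hε (a := 1) (by simp)).comp
      (g := fun q : (ℝ × V) × (ℝ × V) => q.1.1 - q.2.1) (by fun_prop))).mul
      ((hu.comp measurable_fst).conj.mul (hu.comp measurable_snd))
  obtain ⟨CA, hCA⟩ := hA.exists_bound
  obtain ⟨C, hC⟩ := hll.exists_bound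
  refine ⟨_, fun q => H * (((Real.log (W q.1) : ℝ) : ℂ) + ((Real.log (W q.2) : ℝ) : ℂ)) +
    H * Complex.log (ε + Complex.I * (q.1.1 - q.2.1 : ℝ)), CA,
    |H| * C + |H| * (|Real.log ε| + |Real.log (ε + (R + R))| + π), hA.measurable, ?_,
    Eventually.of_forall hCA, ?_, fun z => ?_⟩
  · exact (hll.measurable.const_mul _).add (by fun_prop)
  · have h1 : ∀ᵐ x ∂(ρ.prod σ), |x.1| ≤ R := Measure.quasiMeasurePreserving_fst.ae hR
    have h2 : ∀ᵐ q ∂((ρ.prod σ).prod (ρ.prod σ)), |q.1.1| ≤ R :=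
      Measure.quasiMeasurePreserving_fst.ae h1
    have h3 : ∀ᵐ q ∂((ρ.prod σ).prod (ρ.prod σ)), |q.2.1| ≤ R :=
      Measure.quasiMeasurePreserving_snd.ae h1
    filter_upwards [h2, h3] with q hq1 hq2
    refine (norm_add_le _ _).trans ?_
    rw [norm_mul, norm_mul, Complex.norm_real, Real.norm_eq_abs]
    gcongr
    · exact hC q
    · exact norm_log_add_I_mul_le hε ((abs_sub _ _).trans (add_le_add hq1 hq2))
  · rw [interpForm]
    congr 1; ext q
    have e : Complex.exp (z * (H * (((Real.log (W q.1) : ℝ) : ℂ) + ((Real.log (W q.2) : ℝ) : ℂ)) +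
        H * Complex.log (ε + Complex.I * (q.1.1 - q.2.1 : ℝ)))) * powKernel ε 1 (q.1.1 - q.2.1) =
        Complex.exp (z * H * ((Real.log (W q.1) : ℝ) + (Real.log (W q.2) : ℝ))) *
        powKernel ε (1 - z * H) (q.1.1 - q.2.1) := by
      simp only [powKernel]
      rw [← Complex.exp_add, ← Complex.exp_add]
      ring_nf
    linear_combination (-1 : ℂ) * gramKernel η k q.1 q.2 *
      ((starRingEnd ℂ) (u q.1) * u q.2) * e

theorem exists_norm_mul_exp_bound {G : ℂ → ℂ} {D Cb : ℝ} (hD : 0 ≤ D)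
    (hG : ∀ z, ‖G z‖ ≤ D * Real.exp (‖z‖ * Cb)) (hCb : 0 ≤ Cb) (θ : ℝ) :
    ∃ B, ∀ z : ℂ, 0 ≤ z.re → z.re ≤ 1 → ‖Complex.exp (z ^ 2 - θ ^ 2) * G z‖ ≤ B := by
  refine ⟨Real.exp 1 * D * Real.exp Cb * Real.exp (Cb ^ 2 / 4), fun z h0 h1 => ?_⟩
  rw [norm_mul]
  have hz : ‖z‖ ≤ 1 + |z.im| := by
    refine (Complex.norm_le_abs_re_add_abs_im z).trans ?_
    rw [abs_of_nonneg h0]; linarith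
  calc _ ≤ (Real.exp 1 * Real.exp (-z.im ^ 2)) * (D * Real.exp ((1 + |z.im|) * Cb)) := by
        refine mul_le_mul ((norm_exp_sq_sub_le h0 h1 θ).trans ?_) ((hG z).trans ?_)
          (norm_nonneg _) (by positivity)
        · gcongr
        · gcongr
    _ = Real.exp 1 * D * Real.exp Cb * (Real.exp (-z.im ^ 2) * Real.exp (Cb * |z.im|)) := by
        rw [show (1 + |z.im|) * Cb = Cb + Cb * |z.im| by ring, Real.exp_add]; ring
    _ ≤ _ := by
        gcongr
        exact exp_neg_sq_add_mul_le _ _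

variable [IsFiniteMeasure ρ] [IsFiniteMeasure σ]

/-- Schatten-type bound for `W T T* W` obtained by complex interpolation. -/
theorem norm_sum_mul_integral_gramKernel_le {H : ℝ} (hH : 1 < H) (hε : 0 < ε) (hρ : ρ ≤ volume)
    {R : ℝ} (hR : ∀ᵐ t ∂ρ, |t| ≤ R) (hk : BddMeas (Function.uncurry k))
    (hΓ₁0 : 0 ≤ Γ₁) (hΓ₁ : ∀ t v, ∫ v', ‖gramKernel η k (t, v) (t, v')‖ ∂σ ≤ Γ₁)
    (hΓ₂0 : 0 ≤ Γ₂)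
    (hΓ₂ : ∀ x x', (ε + |x.1 - x'.1|) ^ (H - 1) * ‖gramKernel η k x x'‖ ≤ Γ₂)
    (hW : Measurable W) {δ M : ℝ} (hδ : 0 < δ) (hWδ : ∀ x, δ ≤ W x) (hWM : ∀ x, W x ≤ M)
    (hu : ∀ i, BddMeas (u i))
    (horth : ∀ i j, ∫ x, (starRingEnd ℂ) (u i x) * u j x ∂(ρ.prod σ) = if i = j then 1 else 0)
    {c : Fin n → ℝ} (hc : ∀ i, 0 < c i) {p : ℝ} (hp : p * (1 - H⁻¹ / 2) = 1) :
    ‖∑ i, (c i : ℂ) * ∫ q : (ℝ × V) × (ℝ × V), gramKernel η k q.1 q.2 *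
        ((W q.1 : ℂ) * (W q.2 : ℂ)) * ((starRingEnd ℂ) (u i q.1) * u i q.2)
        ∂((ρ.prod σ).prod (ρ.prod σ))‖ ≤
      (interpConst H * (Γ₁ * ∑ i, c i ^ p)) ^ (1 - H⁻¹) *
      (interpConst H * (Γ₂ * (∑ i, c i ^ p) ^ (1 / 2 : ℝ) *
        ∫ x, W x ^ (2 * H) ∂(ρ.prod σ))) ^ H⁻¹ := by
  have hH0 : 0 < H := one_pos.trans hH
  have hW0 : ∀ x, 0 < W x := fun x => hδ.trans_le (hWδ x)
  set θ : ℝ := H⁻¹ with hθ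
  set Q : Fin n → ℂ → ℂ := fun i z => Complex.exp (p * (1 - z / 2) * (Real.log (c i) : ℝ)) *
    interpForm ρ σ η k ε H W (u i) z with hQ
  set F : ℂ → ℂ := fun z => Complex.exp (z ^ 2 - (θ : ℂ) ^ 2) * ∑ i, Q i z with hF
  have hnormc : ∀ i (z : ℂ), ‖Complex.exp (p * (1 - z / 2) * (Real.log (c i) : ℝ))‖ =
      c i ^ (p * (1 - z.re / 2)) := by
    intro i z
    rw [Complex.norm_exp, Real.rpow_def_of_pos (hc i)]
    congr 1
    simp
    ring
  have hQd : ∀ i, Differentiable ℂ (Q i) := by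
    intro i
    obtain ⟨A, b, CA, Cb, hA, hb, hAC, hbC, he⟩ :=
      exists_interpForm_eq (η := η) (σ := σ) hε hR hk hW hδ hWδ hWM H (hu i)
    have : Differentiable ℂ (interpForm ρ σ η k ε H W (u i)) := by
      rw [show interpForm ρ σ η k ε H W (u i) = _ from funext he]
      exact differentiable_integral_mul_exp hA.aestronglyMeasurable hb.aestronglyMeasurable hAC hbC
    exact Differentiable.mul (by fun_prop) this
  have hQb : ∀ i, ∃ B, ∀ z : ℂ, 0 ≤ z.re → z.re ≤ 1 →
      ‖Complex.exp (z ^ 2 - (θ : ℂ) ^ 2) * Q i z‖ ≤ B := by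
    intro i
    obtain ⟨A, b, CA, Cb, hA, hb, hAC, hbC, he⟩ :=
      exists_interpForm_eq (η := η) (σ := σ) hε hR hk hW hδ hWδ hWM H (hu i)
    set m := ((ρ.prod σ).prod (ρ.prod σ)).real univ
    refine exists_norm_mul_exp_bound (D := Real.exp |p * Real.log (c i)| * (|CA| * m))
      (Cb := |p * Real.log (c i)| / 2 + |Cb|) (by positivity) (fun z => ?_) (by positivity) θ
    simp only [hQ]
    rw [norm_mul, he z]
    have h1 := norm_integral_mul_exp_le hAC hbC z
    have h2 : ‖Complex.exp (p * (1 - z / 2) * (Real.log (c i) : ℝ))‖ ≤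
        Real.exp |p * Real.log (c i)| * Real.exp (‖z‖ * (|p * Real.log (c i)| / 2)) := by
      refine (Complex.norm_exp_le_exp_norm _).trans ?_
      rw [← Real.exp_add]
      gcongr
      have e1 : (p * (1 - z / 2) * (Real.log (c i) : ℝ) : ℂ) =
        ((p * Real.log (c i) : ℝ) : ℂ) * (1 - z / 2) := by push_cast; ring
      rw [e1, norm_mul, Complex.norm_real, Real.norm_eq_abs]
      have : ‖1 - z / 2‖ ≤ 1 + ‖z‖ / 2 := (norm_sub_le _ _).trans (by simp)
      nlinarith [mul_le_mul_of_nonneg_left this (abs_nonneg (p * Real.log (c i)))]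
    calc _ ≤ (Real.exp |p * Real.log (c i)| * Real.exp (‖z‖ * (|p * Real.log (c i)| / 2))) *
          (|CA| * Real.exp (‖z‖ * |Cb|) * m) := by
          refine mul_le_mul h2 (h1.trans ?_) (norm_nonneg _) (by positivity)
          gcongr
          · exact le_abs_self _
          · exact le_abs_self _
      _ = _ := by rw [mul_add ‖z‖, Real.exp_add]; ring
  have hFd : Differentiable ℂ F := by
    refine Differentiable.mul (by fun_prop) ?_
    exact Differentiable.fun_sum fun i _ => hQd i
  have hFb : BddAbove ((norm ∘ F) '' Complex.HadamardThreeLines.verticalClosedStrip 0 1) := by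
    choose B hB using hQb
    refine ⟨∑ i, B i, ?_⟩
    rintro _ ⟨z, hz, rfl⟩
    have hz : z.re ∈ Icc (0 : ℝ) 1 := hz
    simp only [Function.comp, hF, Finset.mul_sum]
    exact (norm_sum_le _ _).trans (Finset.sum_le_sum fun i _ => hB i z hz.1 hz.2)
  set S := ∑ i, c i ^ p with hS
  set J := ∫ x, W x ^ (2 * H) ∂(ρ.prod σ) with hJ
  have hS0 : 0 ≤ S := Finset.sum_nonneg fun i _ => Real.rpow_nonneg (hc i).le _
  have hJ0 : 0 ≤ J := integral_nonneg fun x => Real.rpow_nonneg (hW0 x).le _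
  have hleft : ∀ z ∈ Complex.re ⁻¹' {(0 : ℝ)}, ‖F z‖ ≤ interpConst H * (Γ₁ * S) := by
    intro z hz
    have hz : z.re = 0 := hz
    have hsum : ‖∑ i, Q i z‖ ≤ 2 * π * Real.exp (π * H * |z.im|) * Γ₁ * S := by
      refine (norm_sum_le _ _).trans ?_
      rw [hS, Finset.mul_sum]
      refine Finset.sum_le_sum fun i _ => ?_
      simp only [hQ]
      rw [norm_mul, hnormc, hz, mul_comm]
      simp only [zero_div, sub_zero, mul_one]
      refine mul_le_mul_of_nonneg_right ?_ (Real.rpow_nonneg (hc i).le _)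
      exact norm_interp_left_le hH0 hε hρ hk hΓ₁ hW (hu i)
        (integral_norm_sq_of_orthonormal horth i) hz
    simp only [hF]
    rw [norm_mul]
    calc _ ≤ (Real.exp z.re * Real.exp (-z.im ^ 2)) *
          (2 * π * Real.exp (π * H * |z.im|) * Γ₁ * S) :=
          mul_le_mul (norm_exp_sq_sub_le hz.ge (by rw [hz]; norm_num) θ) hsum (norm_nonneg _)
            (by positivity)
      _ = 2 * π * (Real.exp (-z.im ^ 2) * Real.exp (π * H * |z.im|)) * (Γ₁ * S) := by
          rw [hz, Real.exp_zero]; ring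
      _ ≤ 2 * π * Real.exp ((π * H) ^ 2 / 4) * (Γ₁ * S) := by
          gcongr; exact exp_neg_sq_add_mul_le _ _
      _ ≤ _ := by
          unfold interpConst
          gcongr
          linarith
  have hright : ∀ z ∈ Complex.re ⁻¹' {(1 : ℝ)},
      ‖F z‖ ≤ interpConst H * (Γ₂ * S ^ (1 / 2 : ℝ) * J) := by
    intro z hz
    have hz : z.re = 1 := hz
    have hsum := norm_interp_right_le hH hε hk hΓ₂0 hΓ₂ hW hδ hWδ hWM hu horth
      (fun i => Complex.exp (p * (1 - z / 2) * (Real.log (c i) : ℝ))) hz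
    have hγ : ∑ i, ‖Complex.exp (p * (1 - z / 2) * (Real.log (c i) : ℝ))‖ ^ 2 = S := by
      refine Finset.sum_congr rfl fun i _ => ?_
      rw [hnormc, ← Real.rpow_natCast, ← Real.rpow_mul (hc i).le, hz]
      congr 1; push_cast; ring
    rw [hγ] at hsum
    simp only [hF]
    rw [norm_mul]
    have hpi : 1 ≤ 2 * π := by have := Real.pi_gt_three; linarith
    calc _ ≤ (Real.exp z.re * Real.exp (-z.im ^ 2)) *
          (S ^ (1 / 2 : ℝ) * (Real.exp (π * H * |z.im|) * Γ₂ * J)) :=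
          mul_le_mul (norm_exp_sq_sub_le (by rw [hz]; norm_num) hz.le θ) hsum (norm_nonneg _)
            (by positivity)
      _ = Real.exp 1 * (Real.exp (-z.im ^ 2) * Real.exp (π * H * |z.im|)) *
          (Γ₂ * S ^ (1 / 2 : ℝ) * J) := by rw [hz]; ring
      _ ≤ Real.exp 1 * Real.exp ((π * H) ^ 2 / 4) * (Γ₂ * S ^ (1 / 2 : ℝ) * J) := by
          gcongr; exact exp_neg_sq_add_mul_le _ _
      _ ≤ _ := by
          unfold interpConst
          rw [Real.exp_add, ← mul_assoc (2 * π)]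
          gcongr
          exact le_mul_of_one_le_left (Real.exp_pos _).le hpi
  have hθ1 : θ ≤ 1 := inv_le_one_of_one_le₀ hH.le
  have hθ0 : 0 ≤ θ := by positivity
  have hmain := Complex.HadamardThreeLines.norm_le_interp_of_mem_verticalClosedStrip₀₁' F
    (z := (θ : ℂ)) (by
      simp only [Complex.HadamardThreeLines.verticalClosedStrip, mem_preimage, Complex.ofReal_re]
      exact ⟨hθ0, hθ1⟩)
    hFd.diffContOnCl hFb hleft hright
  rw [Complex.ofReal_re] at hmain
  refine le_trans (le_of_eq ?_) hmain
  simp only [hF, hQ, sub_self, Complex.exp_zero, one_mul]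
  congr 1
  refine Finset.sum_congr rfl fun i _ => ?_
  rw [hθ, interpForm_inv hH0.ne' hW0, ← hθ]
  congr 1
  have : (p * (1 - (θ : ℂ) / 2) : ℂ) = 1 := by exact_mod_cast hp
  rw [this, one_mul, ← Complex.ofReal_exp, Real.exp_log (hc i)]

end ThreeLines

section SingularValues

variable {X Y : Type*} [MeasurableSpace X] [MeasurableSpace Y] {μ : Measure X} {η : Measure Y}
  [IsFiniteMeasure μ] [IsFiniteMeasure η] {n : ℕ}

theorem integral_norm_sq_eq_conj_mul {μ : Measure X} (g : X → ℂ) :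
    ∫ x, (starRingEnd ℂ) (g x) * g x ∂μ = ((∫ x, ‖g x‖ ^ 2 ∂μ : ℝ) : ℂ) := by
  rw [← integral_complex_ofReal]
  congr 1; ext x
  rw [mul_comm, Complex.mul_conj, Complex.normSq_eq_norm_sq]

/-- A finite family of functions can be rotated to an orthogonal one. -/
theorem exists_orthogonal_rotation {g : Fin n → X → ℂ} (hg : ∀ j, BddMeas (g j)) :
    ∃ (U : Matrix (Fin n) (Fin n) ℂ) (s : Fin n → ℝ), (∀ k, ∑ j, ‖U j k‖ ^ 2 = 1) ∧
      (∀ j, ∑ k, ‖U j k‖ ^ 2 = 1) ∧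
      (∀ k l, ∫ x, (starRingEnd ℂ) (∑ j, U j k * g j x) * (∑ j, U j l * g j x) ∂μ =
        if k = l then (s k : ℂ) else 0) ∧
      ∀ j, ∫ x, ‖g j x‖ ^ 2 ∂μ = ∑ k, ‖U j k‖ ^ 2 * s k := by
  set M : Matrix (Fin n) (Fin n) ℂ :=
    Matrix.of fun j k => ∫ x, (starRingEnd ℂ) (g j x) * g k x ∂μ with hM
  have hMH : M.IsHermitian := by
    ext j k
    simp only [hM, Matrix.conjTranspose_apply, Matrix.of_apply]
    rw [RCLike.star_def, ← integral_conj]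
    congr 1; ext x; simp [mul_comm]
  obtain ⟨U, s, hUU, hUU', hsp⟩ : ∃ (U : Matrix (Fin n) (Fin n) ℂ) (s : Fin n → ℝ),
      star U * U = 1 ∧ U * star U = 1 ∧
        M = U * Matrix.diagonal (fun k => (s k : ℂ)) * star U := by
    refine ⟨hMH.eigenvectorUnitary, hMH.eigenvalues, Unitary.coe_star_mul_self _,
      Unitary.coe_mul_star_self _, ?_⟩
    have := hMH.spectral_theorem
    rwa [Unitary.conjStarAlgAut_apply] at this
  have hdiag : star U * M * U = Matrix.diagonal (fun k => (s k : ℂ)) := by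
    rw [hsp]
    calc _ = (star U * U) * Matrix.diagonal (fun k => (s k : ℂ)) * (star U * U) := by
          simp only [Matrix.mul_assoc]
      _ = _ := by rw [hUU]; simp
  refine ⟨U, s, fun k => ?_, fun j => ?_, fun k l => ?_, fun j => ?_⟩
  · have := congrFun (congrFun hUU k) k
    rw [Matrix.mul_apply, Matrix.one_apply_eq] at this
    apply Complex.ofReal_injective
    push_cast
    rw [← this]
    refine Finset.sum_congr rfl fun j _ => ?_
    rw [Matrix.star_apply, RCLike.star_def, mul_comm, Complex.mul_conj, Complex.normSq_eq_norm_sq]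
    push_cast; rfl
  · have := congrFun (congrFun hUU' j) j
    rw [Matrix.mul_apply, Matrix.one_apply_eq] at this
    apply Complex.ofReal_injective
    push_cast
    rw [← this]
    refine Finset.sum_congr rfl fun k _ => ?_
    rw [Matrix.star_apply, RCLike.star_def, Complex.mul_conj, Complex.normSq_eq_norm_sq]
    push_cast; rfl
  · have := congrFun (congrFun hdiag k) l
    rw [Matrix.diagonal_apply] at this
    refine Eq.trans ?_ this
    have e : ∀ x, (starRingEnd ℂ) (∑ j, U j k * g j x) * (∑ j, U j l * g j x) =
        ∑ j', ∑ j, ((starRingEnd ℂ) (U j k) * U j' l) * ((starRingEnd ℂ) (g j x) * g j' x) := by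
      intro x
      rw [map_sum, Finset.sum_mul_sum, Finset.sum_comm]
      refine Finset.sum_congr rfl fun i _ => Finset.sum_congr rfl fun j _ => ?_
      rw [map_mul]; ring
    simp_rw [e]
    have hb : ∀ j j', BddMeas fun x => ((starRingEnd ℂ) (U j k) * U j' l) *
        ((starRingEnd ℂ) (g j x) * g j' x) := fun j j' =>
      (BddMeas.const _).mul ((hg j).conj.mul (hg j'))
    rw [integral_finsetSum _ fun i _ => (BddMeas.sum _ fun j _ => hb j i).integrable _,
      Matrix.mul_apply]
    refine Finset.sum_congr rfl fun i _ => ?_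
    rw [integral_finsetSum _ fun j _ => (hb j i).integrable _, Matrix.mul_apply, Finset.sum_mul]
    refine Finset.sum_congr rfl fun j _ => ?_
    rw [integral_const_mul, Matrix.star_apply, RCLike.star_def, hM, Matrix.of_apply]
    ring
  · apply Complex.ofReal_injective
    rw [← integral_norm_sq_eq_conj_mul]
    have h1 : ∫ x, (starRingEnd ℂ) (g j x) * g j x ∂μ = M j j := rfl
    rw [h1, hsp, Matrix.mul_apply]
    push_cast
    refine Finset.sum_congr rfl fun k _ => ?_
    rw [Matrix.mul_diagonal, Matrix.star_apply, RCLike.star_def]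
    have : (‖U j k‖ : ℂ) ^ 2 = U j k * (starRingEnd ℂ) (U j k) := by
      rw [Complex.mul_conj, Complex.normSq_eq_norm_sq]; push_cast; rfl
    rw [this]
    ring

theorem bddMeas_integral_mul {κ : X → Y → ℂ} (hκ : BddMeas (Function.uncurry κ)) {f : Y → ℂ}
    (hfm : Measurable f) (hf : Integrable f η) : BddMeas fun x => ∫ y, κ x y * f y ∂η := by
  obtain ⟨C, hC⟩ := hκ.exists_bound
  refine ⟨((hκ.measurable.mul (hfm.comp measurable_snd)).stronglyMeasurable.integral_prod_right
    (f := fun x y => κ x y * f y)).measurable, ∫ y, C * ‖f y‖ ∂η, fun x => ?_⟩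
  refine norm_integral_le_of_norm_le (hf.norm.const_mul C) (Eventually.of_forall fun y => ?_)
  rw [norm_mul]
  exact mul_le_mul_of_nonneg_right (hC (x, y)) (norm_nonneg _)

theorem integral_norm_mul_norm_le_of_memLp {η : Measure Y} {f g : Y → ℂ} (hf : MemLp f 2 η)
    (hg : MemLp g 2 η) :
    ∫ y, ‖f y‖ * ‖g y‖ ∂η ≤
      (∫ y, ‖f y‖ ^ 2 ∂η) ^ (1 / 2 : ℝ) * (∫ y, ‖g y‖ ^ 2 ∂η) ^ (1 / 2 : ℝ) := by
  have := integral_mul_norm_le_Lp_mul_Lq (μ := η) (p := 2) (q := 2)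
    Real.HolderConjugate.two_two (f := f) (g := g) (by simpa using hf) (by simpa using hg)
  simpa using this

theorem BddMeas.memLp {E : Type*} [NormedAddCommGroup E] [MeasurableSpace E]
    [BorelSpace E] [SecondCountableTopology E] {f : X → E} (hf : BddMeas f) (p : ENNReal) :
    MemLp f p μ := by
  obtain ⟨C, hC⟩ := hf.exists_bound
  exact MemLp.of_bound hf.measurable.aestronglyMeasurable C (Eventually.of_forall hC)

/-- `|⟨u, T f⟩|² ≤ ‖f‖² ‖T* u‖²`. -/
theorem norm_sq_integral_conj_mul_le {κ : X → Y → ℂ} (hκ : BddMeas (Function.uncurry κ)) {f : Y → ℂ}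
    (hf : MemLp f 2 η) (hf1 : ∫ y, ‖f y‖ ^ 2 ∂η ≤ 1) {u : X → ℂ}
    (hu : BddMeas u) :
    ‖∫ x, (starRingEnd ℂ) (u x) * ∫ y, κ x y * f y ∂η ∂μ‖ ^ 2 ≤
      ∫ y, ‖∫ x, (starRingEnd ℂ) (κ x y) * u x ∂μ‖ ^ 2 ∂η := by
  have hfi : Integrable f η := hf.integrable (by norm_num)
  have hb : BddMeas fun q : X × Y => (starRingEnd ℂ) (u q.1) * κ q.1 q.2 :=
    (hu.comp measurable_fst).conj.mul hκ
  have hInt : Integrable (Function.uncurry fun x y => (starRingEnd ℂ) (u x) * κ x y * f y)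
      (μ.prod η) := hb.integrable_mul (hfi.comp_snd μ)
  have hB : BddMeas fun y => ∫ x, (starRingEnd ℂ) (κ x y) * u x ∂μ :=
    BddMeas.integral_prod_right (f := fun y x => (starRingEnd ℂ) (κ x y) * u x)
      ((hκ.comp measurable_swap).conj.mul (hu.comp measurable_snd)) μ
  have e : ∫ x, (starRingEnd ℂ) (u x) * ∫ y, κ x y * f y ∂η ∂μ =
      ∫ y, (starRingEnd ℂ) (∫ x, (starRingEnd ℂ) (κ x y) * u x ∂μ) * f y ∂η := by
    simp_rw [← integral_const_mul, ← mul_assoc]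
    rw [integral_integral_swap hInt]
    congr 1; ext y
    rw [integral_mul_const, ← integral_conj]
    congr 2; ext x; simp [mul_comm]
  rw [e]
  set B := fun y => ∫ x, (starRingEnd ℂ) (κ x y) * u x ∂μ
  have hB0 : 0 ≤ ∫ y, ‖B y‖ ^ 2 ∂η := integral_nonneg fun _ => by positivity
  have h1 : ‖∫ y, (starRingEnd ℂ) (B y) * f y ∂η‖ ≤ (∫ y, ‖B y‖ ^ 2 ∂η) ^ (1 / 2 : ℝ) := by
    refine (norm_integral_le_integral_norm _).trans ?_
    have := integral_norm_mul_norm_le_of_memLp (hB.memLp (μ := η) 2) hf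
    simp_rw [norm_mul, RCLike.norm_conj]
    refine this.trans ?_
    refine mul_le_of_le_one_right (by positivity) ?_
    exact Real.rpow_le_one (integral_nonneg fun _ => by positivity) hf1 (by norm_num)
  calc _ ≤ ((∫ y, ‖B y‖ ^ 2 ∂η) ^ (1 / 2 : ℝ)) ^ 2 := by gcongr
    _ = _ := by rw [← Real.sqrt_eq_rpow, Real.sq_sqrt hB0]

theorem rpow_inv_le_of_le_mul_rpow {p q : ℝ} (hpq : p.HolderConjugate q) {S A : ℝ} (hS : 0 ≤ S)
    (hA : 0 ≤ A) (h : S ≤ A * S ^ (1 / p)) : S ^ (1 / q) ≤ A := by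
  rcases hS.eq_or_lt with h0 | h0
  · rw [← h0, Real.zero_rpow (by have := hpq.symm.pos; positivity)]; exact hA
  · have e : S = S ^ (1 / q) * S ^ (1 / p) := by
      rw [← Real.rpow_add h0, one_div, one_div, add_comm, hpq.inv_add_inv_eq_one, Real.rpow_one]
    have hp : 0 < S ^ (1 / p) := Real.rpow_pos_of_pos h0 _
    refine le_of_mul_le_mul_right ?_ hp
    rwa [← e]

/-- Hölder's inequality against a doubly stochastic matrix. -/
theorem sum_mul_sum_mul_le {p q : ℝ} (hpq : p.HolderConjugate q) {w : Fin n → Fin n → ℝ}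
    (hw : ∀ j k, 0 ≤ w j k) (hw1 : ∀ k, ∑ j, w j k = 1) (hw2 : ∀ j, ∑ k, w j k = 1)
    {ν s : Fin n → ℝ} (hν : ∀ j, 0 ≤ ν j) (hs : ∀ k, 0 ≤ s k) :
    ∑ j, ν j * ∑ k, w j k * s k ≤ (∑ j, ν j ^ p) ^ (1 / p) * (∑ k, s k ^ q) ^ (1 / q) := by
  have hp := hpq.pos
  have hq := hpq.symm.pos
  have key := Real.inner_le_Lp_mul_Lq_of_nonneg
    (Finset.univ ×ˢ Finset.univ : Finset (Fin n × Fin n))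
    (f := fun a => w a.1 a.2 ^ (1 / p) * ν a.1) (g := fun a => w a.1 a.2 ^ (1 / q) * s a.2) hpq
    (fun a _ => mul_nonneg (Real.rpow_nonneg (hw _ _) _) (hν _))
    (fun a _ => mul_nonneg (Real.rpow_nonneg (hw _ _) _) (hs _))
  have e1 : ∀ j k, (w j k ^ (1 / p) * ν j) ^ p = w j k * ν j ^ p := fun j k => by
    rw [Real.mul_rpow (Real.rpow_nonneg (hw _ _) _) (hν _), ← Real.rpow_mul (hw _ _),
      one_div_mul_cancel hp.ne', Real.rpow_one]
  have e2 : ∀ j k, (w j k ^ (1 / q) * s k) ^ q = w j k * s k ^ q := fun j k => by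
    rw [Real.mul_rpow (Real.rpow_nonneg (hw _ _) _) (hs _), ← Real.rpow_mul (hw _ _),
      one_div_mul_cancel hq.ne', Real.rpow_one]
  have e3 : ∀ j k, w j k ^ (1 / p) * ν j * (w j k ^ (1 / q) * s k) = ν j * (w j k * s k) :=
    fun j k => by
    have : w j k ^ (1 / p) * w j k ^ (1 / q) = w j k := by
      rw [← Real.rpow_add_of_nonneg (hw _ _) (by positivity) (by positivity), one_div, one_div,
        hpq.inv_add_inv_eq_one, Real.rpow_one]
    calc _ = ν j * ((w j k ^ (1 / p) * w j k ^ (1 / q)) * s k) := by ring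
      _ = _ := by rw [this]
  simp only [Finset.sum_product, e1, e2, e3] at key
  calc _ = ∑ j, ∑ k, ν j * (w j k * s k) := by simp_rw [Finset.mul_sum]
    _ ≤ _ := key
    _ = _ := by
      rw [Finset.sum_comm (f := fun j k => w j k * s k ^ q)]
      simp_rw [← Finset.sum_mul, hw1, hw2, one_mul]

/-- Duality between Schatten bounds for the adjoint and bounds on orthonormal systems. -/
theorem sum_mul_integral_norm_sq_le {p q A : ℝ} (hpq : p.HolderConjugate q) (hA0 : 0 ≤ A)
    {κ : X → Y → ℂ} (hκ : BddMeas (Function.uncurry κ))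
    (hA : ∀ (m : ℕ) (u : Fin m → X → ℂ) (c : Fin m → ℝ), (∀ i, BddMeas (u i)) →
      (∀ i j, ∫ x, (starRingEnd ℂ) (u i x) * u j x ∂μ = if i = j then 1 else 0) →
      (∀ i, 0 < c i) → ∑ i, c i * ∫ y, ‖∫ x, (starRingEnd ℂ) (κ x y) * u i x ∂μ‖ ^ 2 ∂η ≤
        A * (∑ i, c i ^ p) ^ (1 / p))
    {f : Fin n → Y → ℂ} (hfm : ∀ j, Measurable (f j)) (hf : ∀ j, MemLp (f j) 2 η)
    (hsub : ∀ v : Fin n → ℂ, ∫ y, ‖∑ j, v j * f j y‖ ^ 2 ∂η ≤ ∑ j, ‖v j‖ ^ 2)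
    {ν : Fin n → ℝ} (hν : ∀ j, 0 ≤ ν j) :
    ∑ j, ν j * ∫ x, ‖∫ y, κ x y * f j y ∂η‖ ^ 2 ∂μ ≤ A * (∑ j, ν j ^ p) ^ (1 / p) := by
  have hfi : ∀ j, Integrable (f j) η := fun j => (hf j).integrable (by norm_num)
  have hg : ∀ j, BddMeas fun x => ∫ y, κ x y * f j y ∂η := fun j =>
    bddMeas_integral_mul hκ (hfm j) (hfi j)
  obtain ⟨U, s, hU1, hU2, hortho, hnorm⟩ := exists_orthogonal_rotation (μ := μ) hg
  set G : Fin n → X → ℂ := fun k x => ∑ j, U j k * ∫ y, κ x y * f j y ∂η with hG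
  have hGb : ∀ k, BddMeas (G k) := fun k => BddMeas.sum _ fun j _ => (BddMeas.const _).mul (hg j)
  set F : Fin n → Y → ℂ := fun k y => ∑ j, U j k * f j y with hF
  have hFG : ∀ k x, ∫ y, κ x y * F k y ∂η = G k x := by
    intro k x
    simp only [hF, hG]
    simp_rw [Finset.mul_sum]
    have hki : ∀ j, Integrable (fun y => κ x y * f j y) η := fun j =>
      BddMeas.integrable_mul (hκ.comp (g := fun y => (x, y)) (by fun_prop)) (hfi j)
    rw [integral_finsetSum]
    · refine Finset.sum_congr rfl fun j _ => ?_
      rw [← integral_const_mul]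
      congr 1; ext y; ring
    · intro j _
      refine ((hki j).const_mul (U j k)).congr (Eventually.of_forall fun y => ?_)
      simp only; ring
  have hFm : ∀ k, MemLp (F k) 2 η := fun k => by
    simp only [hF]
    exact memLp_finsetSum _ fun j _ => (hf j).const_mul _
  have hF1 : ∀ k, ∫ y, ‖F k y‖ ^ 2 ∂η ≤ 1 := fun k => by
    have := hsub fun j => U j k
    rwa [hU1] at this
  have hss : ∀ k, ∫ x, ‖G k x‖ ^ 2 ∂μ = s k := fun k => by
    apply Complex.ofReal_injective
    rw [← integral_norm_sq_eq_conj_mul]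
    exact (hortho k k).trans (if_pos rfl)
  have hs0 : ∀ k, 0 ≤ s k := fun k => by
    rw [← hss]; exact integral_nonneg fun _ => by positivity
  have hp := hpq.pos
  have hq := hpq.symm.pos
  have hSq : ∑ k, s k ^ q ≤ A * (∑ k, s k ^ q) ^ (1 / p) := by
    set e := (Fintype.equivFin {k // 0 < s k}).symm
    have hsum : ∀ h : Fin n → ℝ, (∀ k, s k = 0 → h k = 0) → ∑ i, h (e i) = ∑ k, h k := by
      intro h hh
      rw [Equiv.sum_comp e fun k => h k]
      rw [← Finset.sum_subtype (Finset.univ.filter fun k => 0 < s k) (by simp) h]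
      exact Finset.sum_filter_of_ne fun k _ hk => (hs0 k).lt_of_ne fun h0 => hk (hh k h0.symm)
    have hspos : ∀ i, 0 < s (e i) := fun i => (e i).2
    have horth' : ∀ i j, ∫ x, (starRingEnd ℂ) (((√(s (e i)))⁻¹ : ℝ) * G (e i) x) *
        (((√(s (e j)))⁻¹ : ℝ) * G (e j) x) ∂μ = if i = j then 1 else 0 := by
      intro i j
      have e1 : ∀ x, (starRingEnd ℂ) (((√(s (e i)))⁻¹ : ℝ) * G (e i) x) *
        (((√(s (e j)))⁻¹ : ℝ) * G (e j) x) = (((√(s (e i)))⁻¹ * (√(s (e j)))⁻¹ : ℝ) : ℂ) *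
          ((starRingEnd ℂ) (G (e i) x) * G (e j) x) := by
        intro x
        rw [map_mul, Complex.conj_ofReal]; push_cast; ring
      simp_rw [e1]
      rw [integral_const_mul, hortho]
      by_cases hij : i = j
      · subst hij
        rw [if_pos rfl, if_pos rfl, ← Complex.ofReal_mul, ← Complex.ofReal_one]
        congr 1
        rw [← mul_inv, Real.mul_self_sqrt (hs0 _), inv_mul_cancel₀ (hspos i).ne']
      · rw [if_neg hij, if_neg fun h => hij (e.injective (Subtype.ext h)), mul_zero]
    have key := hA _ (fun i x => ((√(s (e i)))⁻¹ : ℝ) * G (e i) x) (fun i => s (e i) ^ (q - 1))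
      (fun i => (BddMeas.const _).mul (hGb _)) horth' fun i => Real.rpow_pos_of_pos (hspos i) _
    have hpw : ∀ i, (s (e i) ^ (q - 1)) ^ p = s (e i) ^ q := fun i => by
      rw [← Real.rpow_mul (hs0 _)]
      congr 1
      exact hpq.symm.sub_one_mul_conj
    simp_rw [hpw] at key
    rw [hsum (fun k => s k ^ q) fun k hk => by rw [hk, Real.zero_rpow hq.ne']] at key
    refine le_trans ?_ key
    rw [← hsum (fun k => s k ^ q) fun k hk => by rw [hk, Real.zero_rpow hq.ne']]
    refine Finset.sum_le_sum fun i _ => ?_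
    have h1 := norm_sq_integral_conj_mul_le (μ := μ) hκ (hFm (e i)) (hF1 (e i))
      (u := fun x => ((√(s (e i)))⁻¹ : ℝ) * G (e i) x) ((BddMeas.const _).mul (hGb _))
    simp_rw [hFG] at h1
    have e2 : ∫ x, (starRingEnd ℂ) (((√(s (e i)))⁻¹ : ℝ) * G (e i) x) * G (e i) x ∂μ =
        ((√(s (e i)) : ℝ) : ℂ) := by
      have e1 : ∀ x, (starRingEnd ℂ) (((√(s (e i)))⁻¹ : ℝ) * G (e i) x) * G (e i) x =
          (((√(s (e i)))⁻¹ : ℝ) : ℂ) * ((starRingEnd ℂ) (G (e i) x) * G (e i) x) := by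
        intro x
        rw [map_mul, Complex.conj_ofReal]; ring
      simp_rw [e1]
      rw [integral_const_mul, hortho, if_pos rfl, ← Complex.ofReal_mul]
      congr 1
      rw [inv_mul_eq_div, Real.div_sqrt]
    rw [e2, Complex.norm_real, Real.norm_eq_abs, sq_abs, Real.sq_sqrt (hs0 _)] at h1
    calc s (e i) ^ q = s (e i) ^ (q - 1) * s (e i) := by
          rw [← Real.rpow_add_one (hspos i).ne']; congr 1; ring
      _ ≤ _ := mul_le_mul_of_nonneg_left h1 (Real.rpow_nonneg (hs0 _) _)
  have hS0 : 0 ≤ ∑ k, s k ^ q := Finset.sum_nonneg fun k _ => Real.rpow_nonneg (hs0 k) _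
  have hSA := rpow_inv_le_of_le_mul_rpow hpq hS0 hA0 hSq
  simp_rw [hnorm]
  refine (sum_mul_sum_mul_le hpq (fun j k => sq_nonneg _) hU1 hU2 hν hs0).trans ?_
  rw [mul_comm]
  exact mul_le_mul_of_nonneg_right hSA (Real.rpow_nonneg
    (Finset.sum_nonneg fun j _ => Real.rpow_nonneg (hν j) _) _)

end SingularValues

section Duality

theorem gramKernel_mul {X Y : Type*} [MeasurableSpace Y] {η : Measure Y} (k : X → Y → ℂ) (W : X → ℝ)
    (x x' : X) : gramKernel η (fun x y => (W x : ℂ) * k x y) x x' =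
      gramKernel η k x x' * ((W x : ℂ) * (W x' : ℂ)) := by
  rw [gramKernel, gramKernel, ← integral_mul_const]
  congr 1; ext y
  rw [map_mul, Complex.conj_ofReal]; ring

theorem interp_bound_eq {θ I Γ₁ Γ₂ S w : ℝ} (hI : 0 < I) (h1 : 0 ≤ Γ₁) (h2 : 0 ≤ Γ₂) (hS : 0 ≤ S)
    (hw : 0 ≤ w) (hθ0 : 0 < θ) (hθ1 : θ < 1) :
    (I * (Γ₁ * S)) ^ (1 - θ) * (I * (Γ₂ * S ^ (1 / 2 : ℝ) * w)) ^ θ =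
      (I * Γ₁ ^ (1 - θ) * (Γ₂ * w) ^ θ) * S ^ (1 - θ / 2) := by
  have e1 : I ^ (1 - θ) * I ^ θ = I := by
    rw [← Real.rpow_add hI]; simp
  have e2 : S ^ (1 - θ) * (S ^ (1 / 2 : ℝ)) ^ θ = S ^ (1 - θ / 2) := by
    rw [← Real.rpow_mul hS, ← Real.rpow_add_of_nonneg hS (by linarith) (by positivity)]
    congr 1; ring
  rw [Real.mul_rpow hI.le (by positivity), Real.mul_rpow hI.le (by positivity),
    Real.mul_rpow h1 hS, show Γ₂ * S ^ (1 / 2 : ℝ) * w = S ^ (1 / 2 : ℝ) * (Γ₂ * w) by ring,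
    Real.mul_rpow (by positivity : 0 ≤ S ^ (1 / 2 : ℝ)) (by positivity), ← e2]
  calc _ = (I ^ (1 - θ) * I ^ θ) * Γ₁ ^ (1 - θ) * (Γ₂ * w) ^ θ *
        (S ^ (1 - θ) * (S ^ (1 / 2 : ℝ)) ^ θ) := by ring
    _ = _ := by rw [e1]

variable {V Y : Type*} [MeasurableSpace V] [MeasurableSpace Y] {ρ : Measure ℝ} {σ : Measure V}
  {η : Measure Y} [IsFiniteMeasure ρ] [IsFiniteMeasure σ] [IsFiniteMeasure η]
  {k : ℝ × V → Y → ℂ} {ε : ℝ} {n : ℕ} {Γ₁ Γ₂ : ℝ}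

/-- The weighted form of the bound for orthonormal systems. -/
theorem integral_weight_mul_le {H : ℝ} (hH : 1 < H) (hε : 0 < ε) (hρ : ρ ≤ volume) {R : ℝ}
    (hR : ∀ᵐ t ∂ρ, |t| ≤ R) (hk : BddMeas (Function.uncurry k)) (hΓ₁0 : 0 ≤ Γ₁)
    (hΓ₁ : ∀ t v, ∫ v', ‖gramKernel η k (t, v) (t, v')‖ ∂σ ≤ Γ₁) (hΓ₂0 : 0 ≤ Γ₂)
    (hΓ₂ : ∀ x x', (ε + |x.1 - x'.1|) ^ (H - 1) * ‖gramKernel η k x x'‖ ≤ Γ₂)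
    {W : ℝ × V → ℝ} (hW : Measurable W) {δ M : ℝ} (hδ : 0 < δ) (hWδ : ∀ x, δ ≤ W x)
    (hWM : ∀ x, W x ≤ M) {p : ℝ} (hp : p * (1 - H⁻¹ / 2) = 1)
    {f : Fin n → Y → ℂ} (hfm : ∀ j, Measurable (f j)) (hf : ∀ j, MemLp (f j) 2 η)
    (hsub : ∀ v : Fin n → ℂ, ∫ y, ‖∑ j, v j * f j y‖ ^ 2 ∂η ≤ ∑ j, ‖v j‖ ^ 2)
    {ν : Fin n → ℝ} (hν : ∀ j, 0 ≤ ν j) :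
    ∫ x, W x ^ 2 * ∑ j, ν j * ‖∫ y, k x y * f j y ∂η‖ ^ 2 ∂(ρ.prod σ) ≤
      (interpConst H * Γ₁ ^ (1 - H⁻¹) * (Γ₂ * ∫ x, W x ^ (2 * H) ∂(ρ.prod σ)) ^ H⁻¹) *
        (∑ j, ν j ^ p) ^ (1 / p) := by
  have hH0 : 0 < H := by linarith
  have hθ0 : 0 < H⁻¹ := inv_pos.2 hH0
  have hθ1 : H⁻¹ < 1 := inv_lt_one_of_one_lt₀ hH
  have hp0 : p ≠ 0 := by rintro rfl; simp at hp
  have hpinv : p⁻¹ = 1 - H⁻¹ / 2 := by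
    rw [inv_eq_iff_eq_inv]; exact eq_inv_of_mul_eq_one_left hp
  have hpq : p.HolderConjugate (2 * H) := by
    have hp1 : 1 < p := by
      have : 0 < p := inv_pos.1 (by rw [hpinv]; linarith)
      rw [← inv_lt_one₀ this, hpinv]; linarith
    rw [Real.holderConjugate_iff]
    exact ⟨hp1, by rw [hpinv, mul_inv]; ring⟩
  have hI := interpConst_pos H
  have hw0 : 0 ≤ ∫ x, W x ^ (2 * H) ∂(ρ.prod σ) :=
    integral_nonneg fun x => Real.rpow_nonneg (hδ.le.trans (hWδ x)) _
  have hWb : BddMeas W := ⟨hW, M, fun x => by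
    rw [Real.norm_of_nonneg (hδ.le.trans (hWδ x))]; exact hWM x⟩
  have hWc : BddMeas fun x => (W x : ℂ) :=
    ⟨by fun_prop, M, fun x => by
      rw [Complex.norm_real, Real.norm_of_nonneg (hδ.le.trans (hWδ x))]; exact hWM x⟩
  set κ : ℝ × V → Y → ℂ := fun x y => (W x : ℂ) * k x y with hκdef
  have hκ : BddMeas (Function.uncurry κ) := (hWc.comp measurable_fst).mul hk
  have main := sum_mul_integral_norm_sq_le (μ := ρ.prod σ) (η := η) hpq
    (A := interpConst H * Γ₁ ^ (1 - H⁻¹) * (Γ₂ * ∫ x, W x ^ (2 * H) ∂(ρ.prod σ)) ^ H⁻¹)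
    (by positivity) hκ (fun m u c hu horth hc => ?_) hfm hf hsub hν
  · refine le_trans (le_of_eq ?_) main
    have hb : ∀ j, BddMeas fun x => ‖∫ y, κ x y * f j y ∂η‖ ^ 2 := fun j =>
      (bddMeas_integral_mul hκ (hfm j) ((hf j).integrable (by norm_num))).norm.pow 2
    simp_rw [← integral_const_mul]
    rw [← integral_finsetSum _ fun j _ => ((hb j).integrable _).const_mul _]
    congr 1; ext x
    rw [Finset.mul_sum]
    refine Finset.sum_congr rfl fun j _ => ?_
    simp only [hκdef]
    simp_rw [mul_assoc]
    rw [integral_const_mul, norm_mul, mul_pow, Complex.norm_real, Real.norm_eq_abs, sq_abs]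
    ring
  · have key := norm_sum_mul_integral_gramKernel_le hH hε hρ hR hk hΓ₁0 hΓ₁ hΓ₂0 hΓ₂ hW hδ hWδ hWM
      hu horth hc hp
    have hS0 : 0 ≤ ∑ i, c i ^ p := Finset.sum_nonneg fun i _ => Real.rpow_nonneg (hc i).le _
    rw [interp_bound_eq hI hΓ₁0 hΓ₂0 hS0 hw0 hθ0 hθ1] at key
    rw [one_div, hpinv]
    refine le_trans ?_ key
    refine le_trans (le_abs_self _) ?_
    rw [← Real.norm_eq_abs, ← Complex.norm_real]
    refine le_of_eq ?_
    congr 1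
    push_cast
    refine Finset.sum_congr rfl fun i _ => ?_
    congr 1
    have := integral_norm_sq_adjoint_eq (μ := ρ.prod σ) (η := η) hκ (hu i)
    rw [this]
    congr 1; ext q
    rw [gramKernel_mul]

/-- The density bound for orthonormal systems on a finite measure space. -/
theorem integral_density_rpow_le {H : ℝ} (hH : 1 < H) (hε : 0 < ε) (hρ : ρ ≤ volume) {R : ℝ}
    (hR : ∀ᵐ t ∂ρ, |t| ≤ R) (hk : BddMeas (Function.uncurry k)) (hΓ₁0 : 0 ≤ Γ₁)
    (hΓ₁ : ∀ t v, ∫ v', ‖gramKernel η k (t, v) (t, v')‖ ∂σ ≤ Γ₁) (hΓ₂0 : 0 ≤ Γ₂)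
    (hΓ₂ : ∀ x x', (ε + |x.1 - x'.1|) ^ (H - 1) * ‖gramKernel η k x x'‖ ≤ Γ₂)
    {p r : ℝ} (hp : p * (1 - H⁻¹ / 2) = 1) (hr : H.HolderConjugate r)
    {f : Fin n → Y → ℂ} (hfm : ∀ j, Measurable (f j)) (hf : ∀ j, MemLp (f j) 2 η)
    (hsub : ∀ v : Fin n → ℂ, ∫ y, ‖∑ j, v j * f j y‖ ^ 2 ∂η ≤ ∑ j, ‖v j‖ ^ 2)
    {ν : Fin n → ℝ} (hν : ∀ j, 0 ≤ ν j) :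
    (∫ x, (∑ j, ν j * ‖∫ y, k x y * f j y ∂η‖ ^ 2) ^ r ∂(ρ.prod σ)) ^ (1 / r) ≤
      interpConst H * Γ₁ ^ (1 - H⁻¹) * Γ₂ ^ H⁻¹ * (∑ j, ν j ^ p) ^ (1 / p) := by
  set G : ℝ × V → ℝ := fun x => ∑ j, ν j * ‖∫ y, k x y * f j y ∂η‖ ^ 2 with hGdef
  have hGb : BddMeas G := BddMeas.sum _ fun j _ => (BddMeas.const _).mul
    ((bddMeas_integral_mul hk (hfm j) ((hf j).integrable (by norm_num))).norm.pow 2)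
  have hG0 : ∀ x, 0 ≤ G x := fun x => Finset.sum_nonneg fun j _ =>
    mul_nonneg (hν j) (by positivity)
  obtain ⟨C, hC⟩ := hGb.exists_bound
  have hH0 : 0 < H := by linarith
  have hr0 : 0 < r := hr.symm.pos
  have hr1 : 1 < r := hr.symm.lt
  have hI := interpConst_pos H
  have hνp : 0 ≤ ∑ j, ν j ^ p := Finset.sum_nonneg fun j _ => Real.rpow_nonneg (hν j) _
  set S := ∫ x, G x ^ r ∂(ρ.prod σ) with hS
  have hS0 : 0 ≤ S := integral_nonneg fun x => Real.rpow_nonneg (hG0 x) _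
  set B := interpConst H * Γ₁ ^ (1 - H⁻¹) * Γ₂ ^ H⁻¹ * (∑ j, ν j ^ p) ^ (1 / p) with hB
  have hB0 : 0 ≤ B := by positivity
  have hGr : BddMeas fun x => G x ^ r := ⟨hGb.measurable.pow_const r, C ^ r, fun x => by
    rw [Real.norm_of_nonneg (Real.rpow_nonneg (hG0 x) _)]
    exact Real.rpow_le_rpow (hG0 x) ((le_abs_self _).trans (hC x)) hr0.le⟩
  have hHr : H⁻¹ + r⁻¹ = 1 := hr.inv_add_inv_eq_one
  have hrH : r = H / (H - 1) := hr.conjugate_eq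
  have hHm : 0 < H - 1 := by linarith
  have step : ∀ δ : ℝ, 0 < δ → δ ≤ 1 →
      S ≤ B * (S + δ ^ r * (ρ.prod σ).real univ) ^ H⁻¹ := by
    intro δ hδ hδ1
    have hmax0 : ∀ x, 0 < max (G x) δ := fun x => lt_max_of_lt_right hδ
    set t : ℝ := 1 / (2 * (H - 1)) with ht
    have ht0 : 0 < t := by positivity
    have h := integral_weight_mul_le hH hε hρ hR hk hΓ₁0 hΓ₁ hΓ₂0 hΓ₂
      (W := fun x => max (G x) δ ^ t) ((hGb.measurable.max measurable_const).pow_const t)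
      (δ := δ ^ t) (M := (max C 1) ^ t)
      (Real.rpow_pos_of_pos hδ _) (fun x => Real.rpow_le_rpow hδ.le (le_max_right _ _) ht0.le)
      (fun x => Real.rpow_le_rpow (hmax0 x).le
        (max_le_max ((le_abs_self _).trans (hC x)) hδ1) ht0.le) hp hfm hf hsub hν
    have e1 : ∀ x, (max (G x) δ ^ t) ^ 2 = max (G x) δ ^ (r - 1) := fun x => by
      rw [← Real.rpow_natCast, ← Real.rpow_mul (hmax0 x).le]
      congr 1
      rw [ht, hrH]; push_cast; field_simp; ring
    have e2 : ∀ x, (max (G x) δ ^ t) ^ (2 * H) = max (G x) δ ^ r := fun x => by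
      rw [← Real.rpow_mul (hmax0 x).le]
      congr 1
      rw [ht, hrH]; field_simp
    simp only [e1, e2] at h
    have hmaxb : BddMeas fun x => max (G x) δ ^ (r - 1) :=
      ⟨(hGb.measurable.max measurable_const).pow_const _, (max C 1) ^ (r - 1), fun x => by
        rw [Real.norm_of_nonneg (Real.rpow_nonneg (hmax0 x).le _)]
        exact Real.rpow_le_rpow (hmax0 x).le
          (max_le_max ((le_abs_self _).trans (hC x)) hδ1) (by linarith)⟩
    have lower : S ≤ ∫ x, max (G x) δ ^ (r - 1) * G x ∂(ρ.prod σ) := by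
      refine integral_mono (hGr.integrable _) ((hmaxb.mul hGb).integrable _) fun x => ?_
      simp only
      calc G x ^ r = G x ^ (r - 1) * G x := by
            rw [← Real.rpow_add_one' (hG0 x) (by linarith)]; congr 1; ring
        _ ≤ _ := mul_le_mul_of_nonneg_right
            (Real.rpow_le_rpow (hG0 x) (le_max_left _ _) (by linarith)) (hG0 x)
    have upper : ∫ x, max (G x) δ ^ r ∂(ρ.prod σ) ≤ S + δ ^ r * (ρ.prod σ).real univ := by
      calc _ ≤ ∫ x, (G x ^ r + δ ^ r) ∂(ρ.prod σ) := by
            refine integral_mono_of_nonneg (Eventually.of_forall fun x =>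
              Real.rpow_nonneg (hmax0 x).le _) ((hGr.add (BddMeas.const _)).integrable _)
              (Eventually.of_forall fun x => ?_)
            simp only
            have h1 := Real.rpow_nonneg (hG0 x) r
            have h2 := Real.rpow_nonneg hδ.le r
            rcases max_choice (G x) δ with h | h <;> rw [h] <;> linarith
        _ = _ := by
            rw [integral_add (hGr.integrable _) (integrable_const _), integral_const, smul_eq_mul,
              mul_comm (δ ^ r)]
    have hm0 : 0 ≤ ∫ x, max (G x) δ ^ r ∂(ρ.prod σ) :=
      integral_nonneg fun x => Real.rpow_nonneg (hmax0 x).le _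
    calc S ≤ _ := lower
      _ ≤ _ := h
      _ = B * (∫ x, max (G x) δ ^ r ∂(ρ.prod σ)) ^ H⁻¹ := by
          rw [Real.mul_rpow hΓ₂0 hm0, hB]; ring
      _ ≤ _ := mul_le_mul_of_nonneg_left
          (Real.rpow_le_rpow hm0 upper (inv_nonneg.2 hH0.le)) hB0
  have lim : S ≤ B * S ^ (1 / H) := by
    have hc : Continuous fun δ : ℝ => B * (S + δ ^ r * (ρ.prod σ).real univ) ^ H⁻¹ := by
      refine continuous_const.mul (Continuous.rpow_const ?_ fun _ => Or.inr (inv_nonneg.2 hH0.le))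
      exact continuous_const.add ((Real.continuous_rpow_const hr0.le).mul continuous_const)
    have ht : Tendsto (fun δ : ℝ => B * (S + δ ^ r * (ρ.prod σ).real univ) ^ H⁻¹) (𝓝[>] 0)
        (𝓝 (B * S ^ H⁻¹)) := by
      have := (hc.tendsto 0).mono_left (nhdsWithin_le_nhds (s := Ioi 0))
      simpa [Real.zero_rpow hr0.ne'] using this
    rw [one_div]
    refine ge_of_tendsto ht ?_
    filter_upwards [Ioc_mem_nhdsGT (zero_lt_one' ℝ)] with δ hδ using step δ hδ.1 hδ.2
  exact rpow_inv_le_of_le_mul_rpow hr hS0 hB0 lim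

end Duality

section DensityBound

/-- The oscillatory integral operator with phase `ψ` and amplitude `b`. -/
noncomputable def oscOp {X Y : Type*} [MeasureSpace Y] (ψ : X × Y → ℝ) (b : X × Y → ℂ) (lam : ℝ)
    (f : Y → ℂ) (x : X) : ℂ :=
  ∫ y, Complex.exp (Complex.I * (lam * ψ (x, y) : ℝ)) * b (x, y) * f y

/-- The square sums bound for an operator applied to orthonormal systems. -/
def DensityBound (d : ℕ) (ψ : (Fin (d + 1) → ℝ) × (Fin (d + 1) → ℝ) → ℝ)
    (b : (Fin (d + 1) → ℝ) × (Fin (d + 1) → ℝ) → ℂ) : Prop :=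
  ∃ C : ℝ, 0 ≤ C ∧ ∀ lam : ℝ, 1 ≤ lam → ∀ (n : ℕ) (f : Fin n → (Fin (d + 1) → ℝ) → ℂ),
    (∀ j, Measurable (f j)) → (∀ j, MemLp (f j) 2 volume) →
    (∀ v : Fin n → ℂ, ∫ y, ‖∑ j, v j * f j y‖ ^ 2 ≤ ∑ j, ‖v j‖ ^ 2) →
    ∀ ν : Fin n → ℝ, (∀ j, 0 ≤ ν j) →
      eLpNorm (fun x => ∑ j, ν j * ‖oscOp ψ b lam (f j) x‖ ^ 2)
          (ENNReal.ofReal (((d : ℝ) + 2) / d)) volume ≤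
        ENNReal.ofReal (C * lam ^ (-((d : ℝ) * (d + 1)) / (d + 2)) *
          (∑ j, ν j ^ (((d : ℝ) + 2) / (d + 1))) ^ (((d : ℝ) + 1) / (d + 2)))

variable {d : ℕ} {ψ : (Fin (d + 1) → ℝ) × (Fin (d + 1) → ℝ) → ℝ}
  {b : (Fin (d + 1) → ℝ) × (Fin (d + 1) → ℝ) → ℂ}

theorem measurable_oscOp (hψ : Continuous ψ) (hb : Continuous b) (lam : ℝ)
    {f : (Fin (d + 1) → ℝ) → ℂ} (hf : Measurable f) : Measurable (oscOp ψ b lam f) := by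
  have : Measurable fun q : (Fin (d + 1) → ℝ) × (Fin (d + 1) → ℝ) =>
      Complex.exp (Complex.I * (lam * ψ (q.1, q.2) : ℝ)) * b (q.1, q.2) * f q.2 := by
    have h1 : Measurable ψ := hψ.measurable
    have h2 : Measurable b := hb.measurable
    fun_prop
  exact (this.stronglyMeasurable.integral_prod_right
    (f := fun x y => Complex.exp (Complex.I * (lam * ψ (x, y) : ℝ)) * b (x, y) * f y)).measurable

theorem integrable_oscOp (hψ : Continuous ψ) (hb : Continuous b) (hbs : HasCompactSupport b)
    (lam : ℝ) {f : (Fin (d + 1) → ℝ) → ℂ} (hf : MemLp f 2 volume) (x : Fin (d + 1) → ℝ) :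
    Integrable fun y => Complex.exp (Complex.I * (lam * ψ (x, y) : ℝ)) * b (x, y) * f y := by
  have h1 : Continuous fun y => Complex.exp (Complex.I * (lam * ψ (x, y) : ℝ)) * b (x, y) := by
    fun_prop
  have h2 : HasCompactSupport fun y =>
      Complex.exp (Complex.I * (lam * ψ (x, y) : ℝ)) * b (x, y) :=
    (hasCompactSupport_slice hbs x).mul_left
  exact (h1.memLp_of_hasCompactSupport (p := 2) h2).integrable_mul hf

theorem densityBound_zero : DensityBound d ψ 0 := by
  refine ⟨0, le_rfl, fun lam _ n f _ _ _ ν _ => ?_⟩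
  have : (fun x => ∑ j, ν j * ‖oscOp ψ 0 lam (f j) x‖ ^ 2) = 0 := by
    ext x; simp [oscOp]
  rw [this]; simp

theorem DensityBound.add (hd : 0 < d) (hψ : Continuous ψ) {b₁ b₂}
    (h₁ : Continuous b₁) (h₂ : Continuous b₂)
    (hs₁ : HasCompactSupport b₁) (hs₂ : HasCompactSupport b₂) (H₁ : DensityBound d ψ b₁)
    (H₂ : DensityBound d ψ b₂) : DensityBound d ψ (b₁ + b₂) := by
  obtain ⟨C₁, hC₁, H₁⟩ := H₁
  obtain ⟨C₂, hC₂, H₂⟩ := H₂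
  refine ⟨2 * (C₁ + C₂), by positivity, fun lam hlam n f hfm hf hsub ν hν => ?_⟩
  have hp : 1 ≤ ENNReal.ofReal (((d : ℝ) + 2) / d) := by
    rw [ENNReal.one_le_ofReal, le_div_iff₀ (by exact_mod_cast hd)]; linarith
  set g₁ := fun x => ∑ j, ν j * ‖oscOp ψ b₁ lam (f j) x‖ ^ 2 with hg₁
  set g₂ := fun x => ∑ j, ν j * ‖oscOp ψ b₂ lam (f j) x‖ ^ 2 with hg₂
  have hm : ∀ {b}, Continuous b → Measurable fun x => ∑ j, ν j * ‖oscOp ψ b lam (f j) x‖ ^ 2 :=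
    fun hb => Finset.measurable_fun_sum _ fun j _ =>
      measurable_const.mul ((measurable_oscOp hψ hb lam (hfm j)).norm.pow_const 2)
  have hadd : ∀ j x, oscOp ψ (b₁ + b₂) lam (f j) x =
      oscOp ψ b₁ lam (f j) x + oscOp ψ b₂ lam (f j) x := by
    intro j x
    simp only [oscOp]
    rw [← integral_add (integrable_oscOp hψ h₁ hs₁ lam (hf j) x)
      (integrable_oscOp hψ h₂ hs₂ lam (hf j) x)]
    congr 1; ext y; simp only [Pi.add_apply]; ring
  set E := lam ^ (-((d : ℝ) * (d + 1)) / (d + 2)) *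
          (∑ j, ν j ^ (((d : ℝ) + 2) / (d + 1))) ^ (((d : ℝ) + 1) / (d + 2)) with hE
  have hE0 : 0 ≤ E := mul_nonneg (Real.rpow_nonneg (by linarith) _)
    (Real.rpow_nonneg (Finset.sum_nonneg fun j _ => Real.rpow_nonneg (hν j) _) _)
  have b1 := H₁ lam hlam n f hfm hf hsub ν hν
  have b2 := H₂ lam hlam n f hfm hf hsub ν hν
  rw [mul_assoc, ← hE] at b1 b2 ⊢
  calc _ ≤ eLpNorm ((2 : ℝ) • (g₁ + g₂)) (ENNReal.ofReal (((d : ℝ) + 2) / d)) volume := by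
        refine eLpNorm_mono_real fun x => ?_
        rw [Real.norm_of_nonneg (Finset.sum_nonneg fun j _ => mul_nonneg (hν j) (by positivity))]
        simp only [hg₁, hg₂, Pi.smul_apply, Pi.add_apply, smul_eq_mul, ← Finset.sum_add_distrib,
          Finset.mul_sum]
        refine Finset.sum_le_sum fun j _ => ?_
        rw [hadd, ← mul_add, mul_left_comm]
        refine mul_le_mul_of_nonneg_left ?_ (hν j)
        have h := norm_add_le (oscOp ψ b₁ lam (f j) x) (oscOp ψ b₂ lam (f j) x)
        nlinarith [norm_nonneg (oscOp ψ b₁ lam (f j) x + oscOp ψ b₂ lam (f j) x),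
          sq_nonneg (‖oscOp ψ b₁ lam (f j) x‖ - ‖oscOp ψ b₂ lam (f j) x‖)]
    _ ≤ 2 * (ENNReal.ofReal (C₁ * E) + ENNReal.ofReal (C₂ * E)) := by
        rw [eLpNorm_const_smul]
        have : ‖(2 : ℝ)‖ₑ = 2 := by
          rw [Real.enorm_eq_ofReal (by norm_num)]; simp
        rw [this]
        gcongr
        exact (eLpNorm_add_le (hm h₁).aestronglyMeasurable (hm h₂).aestronglyMeasurable hp).trans
          (add_le_add b1 b2)
    _ = _ := by
        rw [← ENNReal.ofReal_add (by positivity) (by positivity),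
          show (2 : ENNReal) = ENNReal.ofReal 2 by simp, ← ENNReal.ofReal_mul (by norm_num)]
        congr 1; ring

end DensityBound

section LocalDensityBound

variable {d : ℕ} {ψ : (Fin (d + 1) → ℝ) × (Fin (d + 1) → ℝ) → ℝ}
  {b : (Fin (d + 1) → ℝ) × (Fin (d + 1) → ℝ) → ℂ}

theorem const_mul_rpow_mul_rpow_eq {d A B l : ℝ} (hd : 0 < d) (hA : 0 ≤ A) (hB : 0 ≤ B)
    (hl : 0 < l) :
    (A * l ^ (-d)) ^ (1 - (1 + d / 2)⁻¹) * (B * l ^ (-(d / 2))) ^ (1 + d / 2)⁻¹ =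
      A ^ (1 - (1 + d / 2)⁻¹) * B ^ (1 + d / 2)⁻¹ * l ^ (-(d * (d + 1)) / (d + 2)) := by
  rw [Real.mul_rpow hA (Real.rpow_nonneg hl.le _), Real.mul_rpow hB (Real.rpow_nonneg hl.le _),
    ← Real.rpow_mul hl.le, ← Real.rpow_mul hl.le]
  have : l ^ (-d * (1 - (1 + d / 2)⁻¹)) * l ^ (-(d / 2) * (1 + d / 2)⁻¹) =
      l ^ (-(d * (d + 1)) / (d + 2)) := by
    rw [← Real.rpow_add hl]
    congr 1
    have : (1 + d / 2)⁻¹ = 2 / (d + 2) := by field_simp; ring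
    rw [this]; field_simp; ring
  rw [← this]; ring

theorem densityBound_of_ttKernel_le (hd : 0 < d) (hψ : Continuous ψ) (hb : Continuous b)
    (hbs : HasCompactSupport b) (i₀ : Fin (d + 1)) {C : ℝ} (hC0 : 0 ≤ C)
    (hK : ∀ lam : ℝ, 0 ≤ lam → ∀ x x' : Fin (d + 1) → ℝ,
      (x i₀ = x' i₀ → ‖ttKernel ψ b lam x x'‖ ≤ C * (1 + lam * ‖x - x'‖) ^ (-((d : ℝ) + 1))) ∧
      ‖ttKernel ψ b lam x x'‖ ≤ C * (1 + lam * ‖x - x'‖) ^ (-((d : ℝ) / 2))) :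
    DensityBound d ψ b := by
  have hd' : (0 : ℝ) < d := by exact_mod_cast hd
  set H : ℝ := 1 + (d : ℝ) / 2 with hHdef
  set J : ℝ := ∫ h : Fin d → ℝ, (1 + ‖h‖) ^ (-((d : ℝ) + 1)) with hJ
  have hJ0 : 0 ≤ J := integral_nonneg fun h => by positivity
  have hI := interpConst_pos H
  refine ⟨interpConst H * ((C * J) ^ (1 - H⁻¹) * C ^ H⁻¹), by positivity,
    fun lam hlam n f hfm hf hsub ν hν => ?_⟩
  have hlam0 : 0 < lam := by linarith
  obtain ⟨R, hR⟩ := hbs.isCompact.isBounded.subset_closedBall 0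
  have hbz : ∀ x y, b (x, y) ≠ 0 → ‖x‖ ≤ R ∧ ‖y‖ ≤ R := by
    intro x y h
    have := hR (subset_tsupport _ h)
    rw [mem_closedBall_zero_iff, Prod.norm_def, max_le_iff] at this
    exact this
  set e : (Fin (d + 1) → ℝ) ≃ᵐ ℝ × (Fin d → ℝ) :=
    MeasurableEquiv.piFinSuccAbove (fun _ => ℝ) i₀ with he
  have hmp : MeasurePreserving e volume volume := volume_preserving_piFinSuccAbove (fun _ => ℝ) i₀
  have hes : ∀ z, e.symm z = i₀.insertNth (α := fun _ => ℝ) z.1 z.2 := fun z => rfl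
  have hes0 : ∀ z, e.symm z i₀ = z.1 := fun z => by rw [hes]; simp
  have hes1 : ∀ z j, e.symm z (i₀.succAbove j) = z.2 j := fun z j => by rw [hes]; simp
  set k : ℝ × (Fin d → ℝ) → (Fin (d + 1) → ℝ) → ℂ := fun z y =>
    Complex.exp (Complex.I * (lam * ψ (e.symm z, y) : ℝ)) * b (e.symm z, y) with hk
  have hkz : ∀ z y, k z y ≠ 0 → |z.1| ≤ R ∧ ‖z.2‖ ≤ R ∧ ‖y‖ ≤ R := by
    intro z y h
    have h1 := hbz _ _ (right_ne_zero_of_mul h)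
    refine ⟨?_, ?_, h1.2⟩
    · have := (norm_le_pi_norm (e.symm z) i₀).trans h1.1
      rwa [hes0] at this
    · refine (pi_norm_le_iff_of_nonneg ((norm_nonneg _).trans h1.2)).2 fun j => ?_
      have := (norm_le_pi_norm (e.symm z) (i₀.succAbove j)).trans h1.1
      rwa [hes1] at this
  have hkb : BddMeas (Function.uncurry k) := by
    obtain ⟨B, hB⟩ := hb.bounded_above_of_compact_support hbs
    refine ⟨?_, B, fun q => ?_⟩
    · have h1 : Measurable ψ := hψ.measurable
      have h2 : Measurable b := hb.measurable
      simp only [hk, Function.uncurry_def]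
      fun_prop
    · simp only [hk, Function.uncurry_def]
      rw [norm_mul, norm_exp_I_mul_ofReal', one_mul]
      exact hB _
  set ρ : Measure ℝ := volume.restrict (Icc (-R) R) with hρ
  set σ : Measure (Fin d → ℝ) := volume.restrict (Metric.closedBall 0 R) with hσ
  set η : Measure (Fin (d + 1) → ℝ) := volume.restrict (Metric.closedBall 0 R) with hη
  have : IsFiniteMeasure ρ := isFiniteMeasure_restrict.2 (measure_Icc_lt_top).ne
  have : IsFiniteMeasure σ := isFiniteMeasure_restrict.2 (measure_closedBall_lt_top).ne
  have : IsFiniteMeasure η := isFiniteMeasure_restrict.2 (measure_closedBall_lt_top).ne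
  have hker : ∀ z z', gramKernel η k z z' = ttKernel ψ b lam (e.symm z) (e.symm z') := by
    intro z z'
    rw [gramKernel, ttKernel, hη, setIntegral_eq_integral_of_forall_compl_eq_zero]
    · congr 1; ext y
      simp only [hk, map_mul, ← Complex.exp_conj, Complex.conj_I, Complex.conj_ofReal]
      rw [show ((lam * (ψ (e.symm z, y) - ψ (e.symm z', y)) : ℝ) : ℂ) =
        ((lam * ψ (e.symm z, y) : ℝ) : ℂ) - ((lam * ψ (e.symm z', y) : ℝ) : ℂ) by
          push_cast; ring, mul_sub, sub_eq_add_neg, Complex.exp_add, ← neg_mul]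
      ring
    · intro y hy
      rw [mem_closedBall_zero_iff] at hy
      by_contra h
      exact hy (hkz z y (left_ne_zero_of_mul h)).2.2
  have hop : ∀ j z, ∫ y, k z y * f j y ∂η = oscOp ψ b lam (f j) (e.symm z) := by
    intro j z
    rw [hη, setIntegral_eq_integral_of_forall_compl_eq_zero]
    · rfl
    · intro y hy
      rw [mem_closedBall_zero_iff] at hy
      by_contra h
      exact hy (hkz z y (left_ne_zero_of_mul h)).2.2
  have hnorm1 : ∀ t v v', ‖v - v'‖ ≤ ‖e.symm (t, v) - e.symm (t, v')‖ := by
    intro t v v'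
    refine (pi_norm_le_iff_of_nonneg (norm_nonneg _)).2 fun j => ?_
    have := norm_le_pi_norm (e.symm (t, v) - e.symm (t, v')) (i₀.succAbove j)
    rwa [Pi.sub_apply, hes1, hes1] at this
  have hnorm2 : ∀ z z' : ℝ × (Fin d → ℝ), |z.1 - z'.1| ≤ ‖e.symm z - e.symm z'‖ := by
    intro z z'
    have := norm_le_pi_norm (e.symm z - e.symm z') i₀
    rwa [Pi.sub_apply, hes0, hes0] at this
  have hΓ₁ : ∀ t v, ∫ v', ‖gramKernel η k (t, v) (t, v')‖ ∂σ ≤ C * J * lam ^ (-(d : ℝ)) := by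
    intro t v
    have hInt := integrable_one_add_mul_norm_rpow (d := d) hlam0
    have hInt_sub : Integrable fun v' : Fin d → ℝ =>
        C * (1 + lam * ‖v - v'‖) ^ (-((d : ℝ) + 1)) :=
      (hInt.comp_sub_left v).const_mul C
    calc _ ≤ ∫ v', C * (1 + lam * ‖v - v'‖) ^ (-((d : ℝ) + 1)) ∂σ := by
          refine integral_mono_of_nonneg (Eventually.of_forall fun _ => norm_nonneg _)
            hInt_sub.restrict (Eventually.of_forall fun v' => ?_)
          simp only
          rw [hker]
          refine ((hK lam hlam0.le _ _).1 (by rw [hes0, hes0])).trans ?_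
          refine mul_le_mul_of_nonneg_left ?_ hC0
          refine Real.rpow_le_rpow_of_nonpos (by positivity) ?_ (by linarith)
          have := mul_le_mul_of_nonneg_left (hnorm1 t v v') hlam0.le
          linarith
      _ ≤ ∫ v', C * (1 + lam * ‖v - v'‖) ^ (-((d : ℝ) + 1)) :=
          setIntegral_le_integral hInt_sub (Eventually.of_forall fun v' => by positivity)
      _ = _ := by
          rw [integral_const_mul,
            integral_sub_left_eq_self (fun w : Fin d → ℝ => (1 + lam * ‖w‖) ^ (-((d : ℝ) + 1))),
            integral_one_add_mul_norm_rpow hlam0]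
          ring
  have hΓ₂ : ∀ z z', (lam⁻¹ + |z.1 - z'.1|) ^ (H - 1) * ‖gramKernel η k z z'‖ ≤
      C * lam ^ (-((d : ℝ) / 2)) := by
    intro z z'
    set D := ‖e.symm z - e.symm z'‖ with hD
    have hD0 : 0 ≤ D := norm_nonneg _
    have e1 : lam⁻¹ + D = lam⁻¹ * (1 + lam * D) := by field_simp
    have hH1 : H - 1 = (d : ℝ) / 2 := by rw [hHdef]; ring
    have hP : 0 < 1 + lam * D := by positivity
    calc _ ≤ (lam⁻¹ + D) ^ (H - 1) * (C * (1 + lam * D) ^ (-((d : ℝ) / 2))) := by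
          refine mul_le_mul ?_ ?_ (norm_nonneg _) (by positivity)
          · refine Real.rpow_le_rpow (by positivity) ?_ (by rw [hH1]; positivity)
            have := hnorm2 z z'
            linarith
          · rw [hker]; exact (hK lam hlam0.le _ _).2
      _ = C * lam⁻¹ ^ ((d : ℝ) / 2) *
          ((1 + lam * D) ^ ((d : ℝ) / 2) * (1 + lam * D) ^ (-((d : ℝ) / 2))) := by
          rw [hH1, e1, Real.mul_rpow (by positivity) hP.le]; ring
      _ = _ := by
          rw [← Real.rpow_add hP, add_neg_cancel, Real.rpow_zero, mul_one,
            Real.inv_rpow hlam0.le, Real.rpow_neg hlam0.le]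
  have hH1 : 1 < H := by rw [hHdef]; linarith
  set r : ℝ := ((d : ℝ) + 2) / d with hr
  set p : ℝ := ((d : ℝ) + 2) / (d + 1) with hp
  have hHr : H.HolderConjugate r := by
    rw [Real.holderConjugate_iff]
    refine ⟨hH1, ?_⟩
    rw [hHdef, hr]; field_simp; ring
  have hr0 : 0 < r := hHr.symm.pos
  have hpH : p * (1 - H⁻¹ / 2) = 1 := by
    rw [hHdef, hp]; field_simp; ring
  have main := integral_density_rpow_le (η := η) (ρ := ρ) (σ := σ) hH1 (inv_pos.2 hlam0)
    Measure.restrict_le_self (R := R)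
    ((ae_restrict_iff' measurableSet_Icc).2 (Eventually.of_forall fun t ht => abs_le.2 ht))
    hkb (by positivity) hΓ₁ (by positivity) hΓ₂ hpH hHr hfm (fun j => (hf j).restrict _)
    (fun v => (setIntegral_le_integral
      ((memLp_finsetSum _ fun j _ => (hf j).const_mul (v j)).integrable_norm_pow (by norm_num))
      (Eventually.of_forall fun _ => by positivity)).trans (hsub v)) hν
  set G : ℝ × (Fin d → ℝ) → ℝ := fun z => ∑ j, ν j * ‖∫ y, k z y * f j y ∂η‖ ^ 2 with hG
  have hG0 : ∀ z, 0 ≤ G z := fun z => Finset.sum_nonneg fun j _ =>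
    mul_nonneg (hν j) (by positivity)
  have hGb : BddMeas G := BddMeas.sum _ fun j _ => (BddMeas.const _).mul
    ((bddMeas_integral_mul hkb (hfm j) (((hf j).restrict _).integrable (by norm_num))).norm.pow 2)
  have hGs : Function.support G ⊆ Icc (-R) R ×ˢ Metric.closedBall 0 R := by
    intro z hz
    by_contra hzs
    apply hz
    have hkz' : ∀ y, k z y = 0 := fun y => by
      by_contra h
      have := hkz z y h
      exact hzs ⟨abs_le.1 this.1, mem_closedBall_zero_iff.2 this.2.1⟩
    simp [hG, hkz']
  have hGe : (fun x => ∑ j, ν j * ‖oscOp ψ b lam (f j) x‖ ^ 2) = G ∘ e := by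
    ext x
    simp only [hG, Function.comp, hop, MeasurableEquiv.symm_apply_apply]
  have hpr : ρ.prod σ = (volume : Measure (ℝ × (Fin d → ℝ))).restrict
      (Icc (-R) R ×ˢ Metric.closedBall 0 R) := by
    rw [hρ, hσ, Measure.prod_restrict]; rfl
  rw [hGe, eLpNorm_comp_measurePreserving hGb.measurable.aestronglyMeasurable hmp,
    ← eLpNorm_restrict_eq_of_support_subset hGs, ← hpr,
    (hGb.memLp _).eLpNorm_eq_integral_rpow_norm (by simpa using hr0) ENNReal.ofReal_ne_top,
    ENNReal.toReal_ofReal hr0.le]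
  refine ENNReal.ofReal_le_ofReal ?_
  simp_rw [Real.norm_of_nonneg (hG0 _)]
  rw [← one_div]
  refine main.trans (le_of_eq ?_)
  have hp1 : 1 / p = ((d : ℝ) + 1) / (d + 2) := by rw [hp, one_div_div]
  have := const_mul_rpow_mul_rpow_eq hd' (mul_nonneg hC0 hJ0) hC0 hlam0
  rw [← hHdef] at this
  rw [mul_assoc (interpConst H), this, hp1]
  ring

end LocalDensityBound

section Main

theorem integral_norm_sq_sum_of_orthonormal {α : Type*} [MeasurableSpace α] {μ : Measure α} {n : ℕ}
    {f : Fin n → Lp ℂ 2 μ} (hf : Orthonormal ℂ f) (v : Fin n → ℂ) :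
    ∫ y, ‖∑ j, v j * f j y‖ ^ 2 ∂μ = ∑ j, ‖v j‖ ^ 2 := by
  set F : Lp ℂ 2 μ := ∑ j, v j • f j with hF
  have h1 : inner ℂ F F = ∑ j, (starRingEnd ℂ) (v j) * v j := by
    rw [hF, hf.inner_sum]
  have hae : ∀ᵐ y ∂μ, F y = ∑ j, v j * f j y := by
    have h2 : ∀ᵐ y ∂μ, ∀ j, (v j • f j : Lp ℂ 2 μ) y = v j * f j y := by
      rw [ae_all_iff]
      intro j
      filter_upwards [Lp.coeFn_smul (v j) (f j)] with y hy
      rw [hy]; rfl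
    filter_upwards [h2, Lp.coeFn_finsetSum Finset.univ fun j => v j • f j] with y hy hy'
    rw [hF, hy', Finset.sum_apply]
    exact Finset.sum_congr rfl fun j _ => hy j
  apply Complex.ofReal_injective
  rw [← integral_norm_sq_eq_conj_mul]
  push_cast
  calc _ = ∫ y, (starRingEnd ℂ) (F y) * F y ∂μ := by
        refine integral_congr_ae ?_
        filter_upwards [hae] with y hy
        rw [hy]
    _ = inner ℂ F F := by
        rw [L2.inner_def]
        congr 1; ext y
        rw [RCLike.inner_apply, mul_comm]
    _ = _ := by
        rw [h1]
        refine Finset.sum_congr rfl fun j _ => ?_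
        rw [mul_comm, Complex.mul_conj, Complex.normSq_eq_norm_sq]
        push_cast; rfl

theorem densityBound_of_rank {d : ℕ} (hd : 0 < d)
    {a : (Fin (d + 1) → ℝ) × (Fin (d + 1) → ℝ) → ℂ}
    {ψ : (Fin (d + 1) → ℝ) × (Fin (d + 1) → ℝ) → ℝ}
    (ha : ContDiff ℝ ∞ a) (has : HasCompactSupport a) (hψ : ContDiff ℝ ∞ ψ)
    (hrank : ∀ q ∈ tsupport a, (mixedHess ψ q).rank = d)
    (hcurv : ∀ q ∈ tsupport a, ∀ e, ∑ i, e i ^ 2 = 1 → Matrix.vecMul e (mixedHess ψ q) = 0 →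
      (dirHess ψ q e).rank = d) : DensityBound d ψ a := by
  refine localization densityBound_zero (fun f g hf hg hfs hgs Hf Hg =>
    Hf.add hd hψ.continuous hf.continuous hg.continuous hfs hgs Hg) ha has fun q hq => ?_
  obtain ⟨i₀, ε, hε, h⟩ := exists_local_ttKernel_le hd hψ (q := q) (U := Function.support a)
    (ha.continuous.isOpen_support) hq (fun p hp => by
      by_contra hdet
      have h1 := hrank p (subset_tsupport _ hp)
      have h2 := Matrix.rank_of_isUnit _ ((Matrix.isUnit_iff_isUnit_det _).2 (Ne.isUnit hdet))
      rw [h1, Fintype.card_fin] at h2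
      omega) (hrank q hq) (hcurv q hq)
  refine ⟨ε, hε, fun f hf hfs hfsub => ?_⟩
  obtain ⟨C, hC0, hC⟩ := h f hf hfs hfsub
  exact densityBound_of_ttKernel_le hd hψ.continuous hf.continuous hfs i₀ hC0 hC

end Main

end OscInt

/-- Schatten-type bound (in density form) on oscillatory integral operators with a
distance-type degenerate phase on `ℝ^N × ℝ^N`, for systems of orthonormal functions. -/
theorem stmt_1 (N : ℕ) (hN : 2 ≤ N)
    (a : (Fin N → ℝ) × (Fin N → ℝ) → ℂ)
    (ψ : (Fin N → ℝ) × (Fin N → ℝ) → ℝ)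
    (ha_smooth : ContDiff ℝ (⊤ : ℕ∞) a)
    (ha_supp : HasCompactSupport a)
    (hψ_smooth : ContDiff ℝ (⊤ : ℕ∞) ψ)
    -- the mixed Hessian `∂²ψ/∂x_i∂y_j` has rank `N - 1` on the support of `a`
    (hrank : ∀ p ∈ tsupport a,
      (Matrix.of fun (i j : Fin N) =>
          fderiv ℝ (fun x => fderiv ℝ (fun y => ψ (x, y)) p.2 (Pi.single j 1)) p.1
            (Pi.single i 1)).rank = N - 1)
    -- nonvanishing Gauss curvature: for every unit vector `e` for which
    -- `y ↦ e·∇ₓψ(x₀,y)` is critical at `y₀`, the Hessian in `y` has rank `N - 1`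
    (hcurv : ∀ p ∈ tsupport a, ∀ e : Fin N → ℝ, (∑ i, e i ^ 2) = 1 →
      (∀ j : Fin N,
        fderiv ℝ (fun y => ∑ i, e i * fderiv ℝ (fun x => ψ (x, y)) p.1 (Pi.single i 1)) p.2
          (Pi.single j 1) = 0) →
      (Matrix.of fun (j k : Fin N) =>
          fderiv ℝ (fun y =>
              fderiv ℝ (fun y' => ∑ i, e i * fderiv ℝ (fun x => ψ (x, y')) p.1 (Pi.single i 1))
                y (Pi.single k 1)) p.2 (Pi.single j 1)).rank = N - 1) :
    ∃ C > (0:ℝ), ∀ lam : ℝ, 1 ≤ lam →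
      ∀ (n : ℕ) (f : Fin n → Lp ℂ 2 (volume : Measure (Fin N → ℝ))),
        Orthonormal ℂ f → ∀ ν : Fin n → ℂ,
        eLpNorm (fun x : Fin N → ℝ => ∑ j, ν j *
            ((‖∫ y : Fin N → ℝ,
                Complex.exp (Complex.I * (lam * ψ (x, y) : ℝ)) * a (x, y) * (f j : (Fin N → ℝ) → ℂ) y‖ ^ 2 : ℝ) : ℂ))
          (ENNReal.ofReal (((N : ℝ) + 1) / ((N : ℝ) - 1))) volume
        ≤ ENNReal.ofReal (C * lam ^ (-((N : ℝ) * ((N : ℝ) - 1)) / ((N : ℝ) + 1)) *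
            (∑ j, ‖ν j‖ ^ (((N : ℝ) + 1) / (N : ℝ))) ^ ((N : ℝ) / ((N : ℝ) + 1))) := by
  obtain ⟨d, rfl⟩ : ∃ d, N = d + 1 := ⟨N - 1, by omega⟩
  have hd : 0 < d := by omega
  have hdpos : (0 : ℝ) < d := by exact_mod_cast hd
  simp only [Nat.add_sub_cancel] at hrank hcurv
  obtain ⟨C, hC0, hC⟩ := OscInt.densityBound_of_rank hd ha_smooth ha_supp hψ_smooth
    (fun q hq => by
      refine Eq.trans ?_ (hrank q hq)
      congr 1
      ext i j
      exact (OscInt.fderiv_fderiv_eq_mixedHess hψ_smooth q i j).symm)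
    (fun q hq e he hcrit => by
      refine Eq.trans ?_ (hcurv q hq e he fun j => ?_)
      · congr 1
        ext j k
        simp_rw [Matrix.of_apply, OscInt.sum_fderiv_fst hψ_smooth]
        exact OscInt.dirHess_apply_eq hψ_smooth q.1 q.2 e j k
      · simp_rw [OscInt.sum_fderiv_fst hψ_smooth]
        rw [OscInt.fderiv_fst_single hψ_smooth, hcrit, Pi.zero_apply])
  refine ⟨C + 1, by positivity, fun lam hlam n f hf ν => ?_⟩
  have key := hC lam hlam n (fun j => f j) (fun j => (Lp.stronglyMeasurable (f j)).measurable)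
    (fun j => Lp.memLp (f j)) (fun v => (OscInt.integral_norm_sq_sum_of_orthonormal hf v).le)
    (fun j => ‖ν j‖) (fun j => norm_nonneg _)
  have e1 : ((d + 1 : ℕ) : ℝ) + 1 = d + 2 := by push_cast; ring
  have e2 : ((d + 1 : ℕ) : ℝ) - 1 = d := by push_cast; ring
  have e3 : ((d + 1 : ℕ) : ℝ) = d + 1 := by push_cast; ring
  rw [e1, e2, e3, mul_comm ((d : ℝ) + 1) d]
  refine (eLpNorm_mono_real fun x => ?_).trans (key.trans (ENNReal.ofReal_le_ofReal ?_))
  · refine (norm_sum_le _ _).trans (Finset.sum_le_sum fun j _ => ?_)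
    rw [norm_mul, Complex.norm_real, Real.norm_of_nonneg (by positivity)]
    rfl
  · gcongr
    linarith
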